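/- arXiv:1311.7637 — 9 statements merged into one kernel-verified Lean document; each statement's English description precedes it below -/
import Mathlib

section
/- Let S, M and R be finite-dimensional Hilbert spaces, let ρ_{SR} be a density matrix on S⊗R, let {X_x}_{x∈X} and {Z_z}_{z∈Z} be POVMs on S (finite families of positive semidefinite matrices each summing to the identity), and let ℰ be a completely positive trace-preserving linear map from operators on S to operators on S⊗M. Set ρ^ℰ_{SMR} = (ℰ⊗id_R)(ρ_{SR}), and define the classical-quantum states ρ_{ZR} = Σ_z |z⟩⟨z| ⊗ tr_S[(Z_z⊗1_R)ρ_{SR}], ρ^ℰ_{ZR} = Σ_z |z⟩⟨z| ⊗ tr_{SM}[(Z_z⊗1_{MR})ρ^ℰ_{SMR}], and ρ^ℰ_{XM} = Σ_x |x⟩⟨x| ⊗ tr_{SR}[(X_x⊗1_{MR})ρ^ℰ_{SMR}]. Then for every α ∈ [1/2, ∞], D_α(ρ_{ZR} ∥ ρ^ℰ_{ZR}) + H_max(X|M)_{ρ^ℰ} + H_α(Z|R)_ρ ≥ log₂(1/c), where c = max_{x,z} ‖√(X_x) √(Z_z)‖_∞² and ‖·‖_∞ is the operator (largest-singular-value)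 norm. -/
open scoped Kronecker ComplexOrder ENNReal
open scoped Classical

noncomputable section

/-- Apply a real function to a Hermitian matrix via the functional calculus
(spectral decomposition); returns 0 on non-Hermitian input. -/
def matFun {n : Type*} [Fintype n] [DecidableEq n] (f : ℝ → ℝ) (A : Matrix n n ℂ) :
    Matrix n n ℂ :=
  if hA : A.IsHermitian then
    (hA.eigenvectorUnitary : Matrix n n ℂ) *
      Matrix.diagonal (fun i => (f (hA.eigenvalues i) : ℂ)) *
      star (hA.eigenvectorUnitary : Matrix n n ℂ)
  else 0

/-- Real power of a positive semidefinite matrix, taken on its support. -/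
def matPow {n : Type*} [Fintype n] [DecidableEq n] (p : ℝ) (A : Matrix n n ℂ) :
    Matrix n n ℂ :=
  matFun (fun x => if 0 < x then Real.rpow x p else 0) A

/-- Base-2 logarithm of a positive semidefinite matrix, taken on its support. -/
def matLog2 {n : Type*} [Fintype n] [DecidableEq n] (A : Matrix n n ℂ) : Matrix n n ℂ :=
  matFun (fun x => if 0 < x then Real.logb 2 x else 0) A

/-- Loewner order: `A ≤ B` iff `B - A` is positive semidefinite. -/
def loewnerLE {n : Type*} [Fintype n] (A B : Matrix n n ℂ) : Prop :=
  (B - A).PosSemidef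

/-- The support of `ρ` is contained in the support of `σ` (for PSD matrices). -/
def suppLE {n : Type*} [Fintype n] (ρ σ : Matrix n n ℂ) : Prop :=
  ∀ v : n → ℂ, σ.mulVec v = 0 → ρ.mulVec v = 0

/-- `ρ` is a density matrix. -/
def IsDensityMatrix {n : Type*} [Fintype n] (ρ : Matrix n n ℂ) : Prop :=
  ρ.PosSemidef ∧ ρ.trace = 1

/-- The sandwiched Rényi relative entropy `D_α(ρ‖σ)` (in bits), for
`α ∈ [1/2,∞]` (parametrized by `ℝ≥0∞`), with the limiting definitions at
`α = 1` (Umegaki relative entropy) and `α = ∞` (max-relative entropy),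
taking values in the extended reals. -/
def sandRenyi {n : Type*} [Fintype n] [DecidableEq n] (α : ℝ≥0∞)
    (ρ σ : Matrix n n ℂ) : EReal :=
  if α = ⊤ then
    if ∃ l : ℝ, 0 ≤ l ∧ loewnerLE ρ (l • σ) then
      ((Real.logb 2 (sInf {l : ℝ | 0 ≤ l ∧ loewnerLE ρ (l • σ)}) : ℝ) : EReal)
    else ⊤
  else if α = 1 then
    if suppLE ρ σ then (((ρ * (matLog2 ρ - matLog2 σ)).trace.re : ℝ) : EReal)
    else ⊤
  else
    if 1 < α.toReal ∧ ¬ suppLE ρ σ then ⊤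
    else
      if 0 < ((matPow α.toReal
          (matPow ((1 - α.toReal) / (2 * α.toReal)) σ * ρ *
            matPow ((1 - α.toReal) / (2 * α.toReal)) σ)).trace.re) then
        (((α.toReal - 1)⁻¹ * Real.logb 2 ((matPow α.toReal
          (matPow ((1 - α.toReal) / (2 * α.toReal)) σ * ρ *
            matPow ((1 - α.toReal) / (2 * α.toReal)) σ)).trace.re) : ℝ) : EReal)
      else ⊤

/-- The conditional Rényi entropy `H_α(A|B)_ρ = sup_η [ - D_α(ρ_{AB} ‖ 1_A ⊗ η_B) ]`,
where the supremum runs over density matrices on `B`.  `H_max = H_{1/2}` and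
`H_min = H_∞`. -/
def condRenyi {A B : Type*} [Fintype A] [DecidableEq A] [Fintype B] [DecidableEq B]
    (α : ℝ≥0∞) (ρ : Matrix (A × B) (A × B) ℂ) : EReal :=
  sSup {x : EReal | ∃ η : Matrix B B ℂ, IsDensityMatrix η ∧
    x = - sandRenyi α ρ ((1 : Matrix A A ℂ) ⊗ₖ η)}

/-- A POVM: a finite family of positive semidefinite matrices summing to the identity. -/
def IsPOVM {I n : Type*} [Fintype I] [Fintype n] [DecidableEq n]
    (E : I → Matrix n n ℂ) : Prop :=
  (∀ i, (E i).PosSemidef) ∧ ∑ i, E i = 1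

/-- The extension `Φ ⊗ id_R` of a linear map on matrices to a bipartite system,
acting blockwise. -/
def extendRight {S T R : Type*} [Fintype S] [Fintype T] [Fintype R]
    (Φ : Matrix S S ℂ →ₗ[ℂ] Matrix T T ℂ)
    (M : Matrix (S × R) (S × R) ℂ) : Matrix (T × R) (T × R) ℂ :=
  fun p q => Φ (fun s s' => M (s, p.2) (s', q.2)) p.1 q.1

/-- Complete positivity: every matrix extension `Φ ⊗ id_k` maps positive
semidefinite matrices to positive semidefinite matrices. -/
def IsCompletelyPositive {S T : Type*} [Fintype S] [Fintype T]
    (Φ : Matrix S S ℂ →ₗ[ℂ] Matrix T T ℂ) : Prop :=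
  ∀ (k : ℕ) (M : Matrix (S × Fin k) (S × Fin k) ℂ),
    M.PosSemidef → (extendRight Φ M).PosSemidef

/-- Trace preservation. -/
def IsTracePreserving {S T : Type*} [Fintype S] [Fintype T]
    (Φ : Matrix S S ℂ →ₗ[ℂ] Matrix T T ℂ) : Prop :=
  ∀ M : Matrix S S ℂ, (Φ M).trace = M.trace

end

namespace SandwichedRenyi

section FunctionalCalculus

open scoped MatrixOrder Matrix.Norms.L2Operator
open Matrix

variable {n m k : Type*} [Fintype n] [DecidableEq n] [Fintype m] [DecidableEq m]
  [Fintype k] [DecidableEq k]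

lemma matFun_eq_cfc {A : Matrix n n ℂ} (hA : A.IsHermitian) (f : ℝ → ℝ) :
    matFun f A = cfc f A := by
  rw [hA.cfc_eq, Matrix.IsHermitian.cfc, matFun, dif_pos hA, Unitary.conjStarAlgAut_apply]
  rfl

lemma continuousOn_spectrum (A : Matrix n n ℂ) (f : ℝ → ℝ) : ContinuousOn f (spectrum ℝ A) :=
  (Matrix.finite_real_spectrum (A := A)).continuousOn f

lemma matFun_isHermitian (A : Matrix n n ℂ) (f : ℝ → ℝ) : (matFun f A).IsHermitian := by
  by_cases hA : A.IsHermitian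
  · rw [matFun_eq_cfc hA]
    exact cfc_predicate (R := ℝ) f A
  · rw [matFun, dif_neg hA]
    exact isHermitian_zero

lemma matFun_mul {A : Matrix n n ℂ} (hA : A.IsHermitian) (f g : ℝ → ℝ) :
    matFun f A * matFun g A = matFun (fun x => f x * g x) A := by
  rw [matFun_eq_cfc hA, matFun_eq_cfc hA, matFun_eq_cfc hA,
    cfc_mul f g A (continuousOn_spectrum A f) (continuousOn_spectrum A g)]

lemma matFun_congr {A : Matrix n n ℂ} (hA : A.PosSemidef) {f g : ℝ → ℝ}
    (h : ∀ x, 0 ≤ x → f x = g x) : matFun f A = matFun g A := by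
  rw [matFun_eq_cfc hA.1, matFun_eq_cfc hA.1]
  exact cfc_congr fun x hx => h x (spectrum_nonneg_of_nonneg hA.nonneg hx)

lemma matFun_congr_posDef {A : Matrix n n ℂ} (hA : A.PosDef) {f g : ℝ → ℝ}
    (h : ∀ x, 0 < x → f x = g x) : matFun f A = matFun g A := by
  rw [matFun_eq_cfc hA.1, matFun_eq_cfc hA.1]
  refine cfc_congr fun x hx => h x ?_
  rw [hA.1.spectrum_real_eq_range_eigenvalues] at hx
  obtain ⟨i, rfl⟩ := hx
  exact hA.eigenvalues_pos i

lemma matFun_posSemidef {A : Matrix n n ℂ} (hA : A.PosSemidef) {f : ℝ → ℝ}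
    (h : ∀ x, 0 ≤ x → 0 ≤ f x) : (matFun f A).PosSemidef := by
  rw [matFun_eq_cfc hA.1, ← nonneg_iff_posSemidef]
  exact cfc_nonneg fun x hx => h x (spectrum_nonneg_of_nonneg hA.nonneg hx)

lemma matFun_id {A : Matrix n n ℂ} (hA : A.IsHermitian) : matFun (fun x => x) A = A := by
  rw [matFun_eq_cfc hA]
  exact cfc_id' ℝ A

lemma matPow_posSemidef {A : Matrix n n ℂ} (hA : A.PosSemidef) (p : ℝ) :
    (matPow p A).PosSemidef := by
  refine matFun_posSemidef hA fun x hx => ?_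
  split_ifs
  · exact Real.rpow_nonneg hx p
  · exact le_rfl

lemma matPow_mul_matPow {A : Matrix n n ℂ} (hA : A.PosSemidef) (p q : ℝ) :
    matPow p A * matPow q A = matPow (p + q) A := by
  rw [matPow, matPow, matPow, matFun_mul hA.1]
  congr 1
  funext x
  split_ifs with h
  · exact (Real.rpow_add h p q).symm
  · simp

lemma matPow_one {A : Matrix n n ℂ} (hA : A.PosSemidef) : matPow 1 A = A := by
  conv_rhs => rw [← matFun_id hA.1]
  refine matFun_congr hA fun x hx => ?_
  split_ifs with h
  · exact Real.rpow_one x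
  · linarith

lemma matPow_half_mul_self {A : Matrix n n ℂ} (hA : A.PosSemidef) :
    matPow (1 / 2) A * matPow (1 / 2) A = A := by
  rw [matPow_mul_matPow hA, add_halves, matPow_one hA]

lemma matPow_eq_rpow {A : Matrix n n ℂ} (hA : A.PosSemidef) {p : ℝ} (hp : 0 < p) :
    matPow p A = A ^ p := by
  rw [CFC.rpow_eq_cfc_real (ha := hA.nonneg), ← matFun_eq_cfc hA.1]
  refine matFun_congr hA fun x hx => ?_
  split_ifs with h
  · rfl
  · rw [le_antisymm (not_lt.mp h) hx, Real.zero_rpow hp.ne']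

lemma matPow_eq_rpow_of_posDef {A : Matrix n n ℂ} (hA : A.PosDef) (p : ℝ) :
    matPow p A = A ^ p := by
  rw [CFC.rpow_eq_cfc_real (ha := hA.posSemidef.nonneg), ← matFun_eq_cfc hA.1]
  refine matFun_congr_posDef hA fun x hx => ?_
  rw [if_pos hx]
  rfl

lemma matPow_le_matPow {A B : Matrix n n ℂ} (hA : A.PosSemidef) (hAB : A ≤ B) {p : ℝ}
    (hp : 0 < p) (hp1 : p ≤ 1) : matPow p A ≤ matPow p B := by
  have hB : B.PosSemidef := nonneg_iff_posSemidef.mp (hA.nonneg.trans hAB)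
  rw [matPow_eq_rpow hA hp, matPow_eq_rpow hB hp]
  exact CFC.rpow_le_rpow ⟨hp.le, hp1⟩ hAB

lemma matPow_neg_le_matPow_neg {A B : Matrix n n ℂ} (hA : A.PosDef) (hAB : A ≤ B) {p : ℝ}
    (hp : 0 < p) (hp1 : p ≤ 1) : matPow (-p) B ≤ matPow (-p) A := by
  have hA' : IsStrictlyPositive A := isStrictlyPositive_iff_posDef.mpr hA
  have hB' : IsStrictlyPositive B := hA'.of_le hAB
  have hB : B.PosDef := isStrictlyPositive_iff_posDef.mp hB'
  have key : ∀ C : Matrix n n ℂ, IsStrictlyPositive C → C ^ (-p) = Ring.inverse (C ^ p) := by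
    intro C hC
    have hu : IsUnit (C ^ p) := hC.isUnit.cfcRpow p hC.nonneg
    rw [← Ring.inverse_mul_cancel_left _ (C ^ (-p)) hu, CFC.rpow_mul_rpow_neg p hC, mul_one]
  rw [matPow_eq_rpow_of_posDef hA, matPow_eq_rpow_of_posDef hB, key A hA', key B hB']
  have : IsStrictlyPositive (A ^ p) :=
    ⟨CFC.rpow_nonneg, hA'.isUnit.cfcRpow p hA'.nonneg⟩
  exact CStarAlgebra.ringInverse_le_ringInverse (CFC.rpow_le_rpow ⟨hp.le, hp1⟩ hAB) this

lemma matFun_log_le {A B : Matrix n n ℂ} (hA : A.PosDef) (hAB : A ≤ B) :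
    matLog2 A ≤ matLog2 B := by
  have hA' : IsStrictlyPositive A := isStrictlyPositive_iff_posDef.mpr hA
  have hB' : IsStrictlyPositive B := hA'.of_le hAB
  have hB : B.PosDef := isStrictlyPositive_iff_posDef.mp hB'
  have key : ∀ C : Matrix n n ℂ, C.PosDef → matLog2 C = (Real.log 2)⁻¹ • CFC.log C := by
    intro C hC
    rw [CFC.log, ← cfc_smul _ _ _ (continuousOn_spectrum C _), ← matFun_eq_cfc hC.1]
    refine matFun_congr_posDef hC fun x hx => ?_
    rw [if_pos hx, Real.logb, smul_eq_mul, div_eq_inv_mul]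
  rw [key A hA, key B hB]
  have h2 : 0 ≤ (Real.log 2)⁻¹ := by positivity
  have := CFC.log_le_log hAB hA'
  rw [le_iff] at this ⊢
  rw [← smul_sub]
  exact this.smul h2

lemma matFun_eq_aeval {A : Matrix n n ℂ} (hA : A.IsHermitian) {f : ℝ → ℝ} {q : Polynomial ℝ}
    (h : ∀ x ∈ spectrum ℝ A, f x = q.eval x) : matFun f A = Polynomial.aeval A q := by
  rw [matFun_eq_cfc hA]
  exact (cfc_congr h).trans (cfc_polynomial q A hA)

/-- The functional calculus with `f 0 = 0` gives the same trace on `C Cᴴ` and `Cᴴ C`. -/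
lemma trace_matFun_mul_conjTranspose (C : Matrix m n ℂ) {f : ℝ → ℝ} (hf : f 0 = 0) :
    (matFun f (C * Cᴴ)).trace = (matFun f (Cᴴ * C)).trace := by
  have h1 : (C * Cᴴ).IsHermitian := (posSemidef_self_mul_conjTranspose C).1
  have h2 : (Cᴴ * C).IsHermitian := (posSemidef_conjTranspose_mul_self C).1
  have hfin : (spectrum ℝ (C * Cᴴ) ∪ spectrum ℝ (Cᴴ * C) ∪ {0}).Finite :=
    ((finite_real_spectrum).union (finite_real_spectrum)).union (Set.finite_singleton 0)
  obtain ⟨q, hq⟩ : ∃ q : Polynomial ℝ,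
      ∀ x ∈ spectrum ℝ (C * Cᴴ) ∪ spectrum ℝ (Cᴴ * C) ∪ {0}, q.eval x = f x :=
    ⟨Lagrange.interpolate hfin.toFinset id f, fun x hx =>
      Lagrange.eval_interpolate_at_node (s := hfin.toFinset) (v := id) f
        Function.injective_id.injOn (hfin.mem_toFinset.mpr hx)⟩
  have hq0 : q.eval 0 = 0 := by rw [hq 0 (by simp), hf]
  obtain ⟨g, rfl⟩ : Polynomial.X ∣ q := by
    rw [Polynomial.X_dvd_iff, Polynomial.coeff_zero_eq_eval_zero, hq0]
  rw [matFun_eq_aeval h1 fun x hx => (hq x (by simp [hx])).symm,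
    matFun_eq_aeval h2 fun x hx => (hq x (by simp [hx])).symm,
    map_mul, map_mul, Polynomial.aeval_X, Polynomial.aeval_X]
  have hpow : ∀ j : ℕ, Cᴴ * (C * Cᴴ) ^ j = (Cᴴ * C) ^ j * Cᴴ := by
    intro j
    induction j with
    | zero => simp
    | succ j ih =>
      rw [pow_succ, ← Matrix.mul_assoc, ih, pow_succ]
      simp only [Matrix.mul_assoc]
  have key : Cᴴ * Polynomial.aeval (C * Cᴴ) g = Polynomial.aeval (Cᴴ * C) g * Cᴴ := by
    rw [Polynomial.aeval_eq_sum_range, Polynomial.aeval_eq_sum_range, Matrix.mul_sum,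
      Matrix.sum_mul]
    refine Finset.sum_congr rfl fun j _ => ?_
    rw [Matrix.mul_smul, Matrix.smul_mul, hpow]
  rw [Matrix.mul_assoc, key, trace_mul_comm, Matrix.mul_assoc, trace_mul_comm]

lemma trace_sandwich {ρ σ : Matrix n n ℂ} (hσ : σ.PosSemidef) {G : Matrix n k ℂ}
    (hG : ρ = G * Gᴴ) (s a : ℝ) :
    (matPow a (matPow s σ * ρ * matPow s σ)).trace =
      (matPow a (Gᴴ * matPow (s + s) σ * G)).trace := by
  have h := trace_matFun_mul_conjTranspose (matPow s σ * G)
    (f := fun x => if 0 < x then Real.rpow x a else 0) (by simp)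
  have hs : (matPow s σ)ᴴ = matPow s σ := (matPow_posSemidef hσ s).1
  rw [conjTranspose_mul, hs] at h
  change (matPow a _).trace = (matPow a _).trace at h
  rw [hG]
  simp only [Matrix.mul_assoc] at h ⊢
  rw [h, ← Matrix.mul_assoc (matPow s σ) (matPow s σ), matPow_mul_matPow hσ]

end FunctionalCalculus
end SandwichedRenyi

namespace SandwichedRenyi

section TraceInequalities

open scoped MatrixOrder Matrix.Norms.L2Operator
open Matrix

variable {n m k : Type*} [Fintype n] [DecidableEq n] [Fintype m] [DecidableEq m]
  [Fintype k] [DecidableEq k]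

lemma exists_diagonalization {A : Matrix n n ℂ} (hA : A.IsHermitian) :
    ∃ U : Matrix n n ℂ, Uᴴ * U = 1 ∧ U * Uᴴ = 1 ∧
      (∀ f : ℝ → ℝ, matFun f A = U * diagonal (fun i => (f (hA.eigenvalues i) : ℂ)) * Uᴴ) ∧
      Uᴴ * A * U = diagonal (fun i => (hA.eigenvalues i : ℂ)) := by
  have hU : (hA.eigenvectorUnitary : Matrix n n ℂ)ᴴ * (hA.eigenvectorUnitary : Matrix n n ℂ) = 1 :=
    Unitary.coe_star_mul_self hA.eigenvectorUnitary
  have hU' : (hA.eigenvectorUnitary : Matrix n n ℂ) * (hA.eigenvectorUnitary : Matrix n n ℂ)ᴴ = 1 :=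
    Unitary.coe_mul_star_self hA.eigenvectorUnitary
  have hf : ∀ f : ℝ → ℝ, matFun f A = (hA.eigenvectorUnitary : Matrix n n ℂ) *
      diagonal (fun i => (f (hA.eigenvalues i) : ℂ)) *
      (hA.eigenvectorUnitary : Matrix n n ℂ)ᴴ := by
    intro f
    rw [matFun, dif_pos hA]
    rfl
  have hid := hf (fun x => x)
  rw [matFun_id hA] at hid
  generalize (hA.eigenvectorUnitary : Matrix n n ℂ) = U at *
  refine ⟨U, hU, hU', hf, ?_⟩
  calc Uᴴ * A * U
      = Uᴴ * (U * diagonal (fun i => (hA.eigenvalues i : ℂ)) * Uᴴ) * U := congrArg (Uᴴ * · * U) hid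
    _ = (Uᴴ * U) * diagonal (fun i => (hA.eigenvalues i : ℂ)) * (Uᴴ * U) := by
        simp only [Matrix.mul_assoc]
    _ = _ := by rw [hU, Matrix.one_mul, Matrix.mul_one]

lemma re_trace_matFun {A : Matrix n n ℂ} (hA : A.IsHermitian) (f : ℝ → ℝ) :
    (matFun f A).trace.re = ∑ i, f (hA.eigenvalues i) := by
  obtain ⟨U, hU, -, hf, -⟩ := exists_diagonalization hA
  rw [hf, trace_mul_comm, ← Matrix.mul_assoc, hU, Matrix.one_mul, trace_diagonal,
    Complex.re_sum]
  simp

lemma sum_normSq_row {U : Matrix n n ℂ} (hU : U * Uᴴ = 1) (i : n) :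
    ∑ j, Complex.normSq (U i j) = 1 := by
  have := congrArg Complex.re (congrFun (congrFun hU i) i)
  simpa [Matrix.mul_apply, Complex.re_sum, Complex.normSq_apply] using this

/-- Trace functions of increasing convex functions are monotone. -/
lemma re_trace_matFun_mono {A B : Matrix n n ℂ} (hA : A.PosSemidef) (hB : B.PosSemidef)
    (hAB : A ≤ B) {f : ℝ → ℝ} (hconv : ConvexOn ℝ (Set.Ici 0) f)
    (hmono : MonotoneOn f (Set.Ici 0)) :
    (matFun f A).trace.re ≤ (matFun f B).trace.re := by
  rw [re_trace_matFun hA.1, re_trace_matFun hB.1]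
  obtain ⟨U, hU, hU', -, hUA⟩ := exists_diagonalization hA.1
  obtain ⟨V, hV, hV', hVB, -⟩ := exists_diagonalization hB.1
  set W := Uᴴ * V with hW
  have hW1 : W * Wᴴ = 1 := by
    rw [hW, conjTranspose_mul, conjTranspose_conjTranspose, Matrix.mul_assoc, ← Matrix.mul_assoc V,
      hV', Matrix.one_mul, hU]
  have hW2 : Wᴴ * Wᴴᴴ = 1 := by
    rw [hW, conjTranspose_mul, conjTranspose_conjTranspose, conjTranspose_mul,
      conjTranspose_conjTranspose, Matrix.mul_assoc, ← Matrix.mul_assoc U,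
      hU', Matrix.one_mul, hV]
  have hrow := sum_normSq_row hW1
  have hcol : ∀ j, ∑ i, Complex.normSq (W i j) = 1 := by
    intro j
    have := sum_normSq_row hW2 j
    simpa [conjTranspose_apply, Complex.normSq_conj] using this
  have hdiag : ∀ i, hA.1.eigenvalues i ≤
      ∑ j, Complex.normSq (W i j) * hB.1.eigenvalues j := by
    intro i
    have h1 := (le_iff.mp hAB).conjTranspose_mul_mul_same U
    have h2 := (Complex.le_def.mp (h1.diag_nonneg (i := i))).1
    have hBW : Uᴴ * B * U = W * diagonal (fun i => (hB.1.eigenvalues i : ℂ)) * Wᴴ := by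
      have hid := hVB (fun x => x)
      rw [matFun_id hB.1] at hid
      refine (congrArg (Uᴴ * · * U) hid).trans ?_
      rw [hW, conjTranspose_mul, conjTranspose_conjTranspose]
      simp only [Matrix.mul_assoc]
    rw [Matrix.mul_sub, Matrix.sub_mul, hUA, hBW, Matrix.sub_apply,
      diagonal_apply_eq, Complex.sub_re, Complex.ofReal_re, Complex.zero_re, sub_nonneg] at h2
    refine h2.trans_eq ?_
    rw [Matrix.mul_apply, Complex.re_sum]
    refine Finset.sum_congr rfl fun j _ => ?_
    rw [Matrix.mul_diagonal, conjTranspose_apply]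
    simp [Complex.normSq_apply]
    ring
  calc ∑ i, f (hA.1.eigenvalues i)
      ≤ ∑ i, ∑ j, Complex.normSq (W i j) * f (hB.1.eigenvalues j) := by
        refine Finset.sum_le_sum fun i _ => ?_
        refine (hmono (hA.eigenvalues_nonneg i) ((hA.eigenvalues_nonneg i).trans (hdiag i))
          (hdiag i)).trans ?_
        have := hconv.map_sum_le (t := Finset.univ) (w := fun j => Complex.normSq (W i j))
          (p := hB.1.eigenvalues) (fun j _ => Complex.normSq_nonneg _) (hrow i)
          (fun j _ => hB.eigenvalues_nonneg j)
        simpa [smul_eq_mul] using this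
    _ = ∑ j, f (hB.1.eigenvalues j) := by
        rw [Finset.sum_comm]
        refine Finset.sum_congr rfl fun j _ => ?_
        rw [← Finset.sum_mul, hcol, one_mul]

lemma re_trace_matPow_mono {A B : Matrix n n ℂ} (hA : A.PosSemidef) (hAB : A ≤ B) {a : ℝ}
    (ha : 0 < a) : (matPow a A).trace.re ≤ (matPow a B).trace.re := by
  have hB : B.PosSemidef := nonneg_iff_posSemidef.mp (hA.nonneg.trans hAB)
  rcases le_total a 1 with h1 | h1
  · have := (le_iff.mp (matPow_le_matPow hA hAB ha h1)).trace_nonneg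
    rw [trace_sub] at this
    have := (Complex.le_def.mp this).1
    simpa using this
  · have key : ∀ C : Matrix n n ℂ, C.PosSemidef → matPow a C = matFun (fun x => x ^ a) C := by
      intro C hC
      refine matFun_congr hC fun x hx => ?_
      split_ifs with h
      · rfl
      · rw [le_antisymm (not_lt.mp h) hx, Real.zero_rpow ha.ne']
    rw [key A hA, key B hB]
    exact re_trace_matFun_mono hA hB hAB (convexOn_rpow h1)
      (fun x hx y _ hxy => Real.rpow_le_rpow hx hxy ha.le)

lemma re_trace_matPow_pos {A : Matrix n n ℂ} (hA : A.PosSemidef) (h0 : A ≠ 0) (a : ℝ) :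
    0 < (matPow a A).trace.re := by
  rw [matPow, re_trace_matFun hA.1]
  obtain ⟨i, hi⟩ : ∃ i, hA.1.eigenvalues i ≠ 0 := by
    by_contra! h
    exact h0 (hA.1.eigenvalues_eq_zero_iff.mp (funext h))
  have hi' : 0 < hA.1.eigenvalues i := lt_of_le_of_ne (hA.eigenvalues_nonneg i) hi.symm
  refine Finset.sum_pos' (fun i _ => ?_) ⟨i, Finset.mem_univ i, ?_⟩
  · split_ifs with h
    · exact Real.rpow_nonneg h.le a
    · exact le_rfl
  · rw [if_pos hi']
    exact Real.rpow_pos_of_pos hi' a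

omit [DecidableEq n] in
/-- The trace norm of `D` dominates `Re tr (D W)` for every contraction `W`. -/
lemma re_trace_mul_le_re_trace_sqrt (D : Matrix m n ℂ) (W : Matrix n m ℂ) (hW : Wᴴ * W ≤ 1) :
    (D * W).trace.re ≤ (matPow (1 / 2) (D * Dᴴ)).trace.re := by
  have hA : (D * Dᴴ).PosSemidef := posSemidef_self_mul_conjTranspose D
  obtain ⟨U, hU, hU', -, hUA⟩ := exists_diagonalization hA.1
  have h1 : (D * W).trace = ((Uᴴ * D) * (W * U)).trace := by
    rw [Matrix.mul_assoc, trace_mul_comm Uᴴ, Matrix.mul_assoc, Matrix.mul_assoc, hU',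
      Matrix.mul_one]
  have hD : ∀ i, ∑ j, ‖(Uᴴ * D) i j‖ ^ 2 = hA.1.eigenvalues i := by
    intro i
    have h2 : (Uᴴ * D) * (Uᴴ * D)ᴴ = diagonal (fun i => (hA.1.eigenvalues i : ℂ)) := by
      rw [← hUA, conjTranspose_mul, conjTranspose_conjTranspose]
      simp only [Matrix.mul_assoc]
    have h3 := congrArg Complex.re (congrFun (congrFun h2 i) i)
    rw [diagonal_apply_eq, Complex.ofReal_re, Matrix.mul_apply, Complex.re_sum] at h3
    rw [← h3]
    refine Finset.sum_congr rfl fun j _ => ?_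
    rw [conjTranspose_apply, ← Complex.normSq_eq_norm_sq, Complex.normSq_apply]
    simp
  have hW' : ∀ i, ∑ j, ‖(W * U) j i‖ ^ 2 ≤ 1 := by
    intro i
    have h2 := (le_iff.mp hW).conjTranspose_mul_mul_same U
    have h3 : Uᴴ * (1 - Wᴴ * W) * U = 1 - (W * U)ᴴ * (W * U) := by
      rw [Matrix.mul_sub, Matrix.sub_mul, Matrix.mul_one, hU, conjTranspose_mul]
      simp only [Matrix.mul_assoc]
    rw [h3] at h2
    have h4 := (Complex.le_def.mp (h2.diag_nonneg (i := i))).1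
    rw [Matrix.sub_apply, one_apply_eq, Matrix.mul_apply, Complex.sub_re, Complex.re_sum,
      Complex.zero_re, Complex.one_re, sub_nonneg] at h4
    refine le_trans (le_of_eq ?_) h4
    refine Finset.sum_congr rfl fun j _ => ?_
    rw [conjTranspose_apply, ← Complex.normSq_eq_norm_sq, Complex.normSq_apply]
    simp
  rw [h1, matPow, re_trace_matFun hA.1, Matrix.trace, Complex.re_sum]
  refine Finset.sum_le_sum fun i _ => ?_
  have hsqrt : (if 0 < hA.1.eigenvalues i then (hA.1.eigenvalues i).rpow (1 / 2) else 0) =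
      √(hA.1.eigenvalues i) := by
    split_ifs with h
    · rw [Real.sqrt_eq_rpow]
      rfl
    · rw [Real.sqrt_eq_zero_of_nonpos (not_lt.mp h)]
  rw [hsqrt, Matrix.diag_apply, Matrix.mul_apply, ← hD i]
  calc (∑ j, (Uᴴ * D) i j * (W * U) j i).re ≤ ‖∑ j, (Uᴴ * D) i j * (W * U) j i‖ :=
        Complex.re_le_norm _
    _ ≤ ∑ j, ‖(Uᴴ * D) i j‖ * ‖(W * U) j i‖ :=
        (norm_sum_le _ _).trans (le_of_eq (Finset.sum_congr rfl fun j _ => norm_mul _ _))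
    _ ≤ √(∑ j, ‖(Uᴴ * D) i j‖ ^ 2) * √(∑ j, ‖(W * U) j i‖ ^ 2) :=
        Real.sum_mul_le_sqrt_mul_sqrt _ _ _
    _ ≤ √(∑ j, ‖(Uᴴ * D) i j‖ ^ 2) * 1 := by
        gcongr
        exact Real.sqrt_le_one.mpr (hW' i)
    _ = _ := mul_one _

end TraceInequalities
end SandwichedRenyi

namespace SandwichedRenyi

section SecondArgument

open scoped MatrixOrder Matrix.Norms.L2Operator
open Matrix

variable {n : Type*} [Fintype n] [DecidableEq n]

lemma matFun_matFun {A : Matrix n n ℂ} (hA : A.IsHermitian) (f g : ℝ → ℝ) :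
    matFun f (matFun g A) = matFun (fun x => f (g x)) A := by
  rw [matFun_eq_cfc (matFun_isHermitian A g), matFun_eq_cfc hA, matFun_eq_cfc hA]
  exact (cfc_comp' f g A (((finite_real_spectrum).image g).continuousOn f)
    (continuousOn_spectrum A g) hA).symm

lemma matFun_add {A : Matrix n n ℂ} (hA : A.IsHermitian) (f g : ℝ → ℝ) :
    matFun (fun x => f x + g x) A = matFun f A + matFun g A := by
  rw [matFun_eq_cfc hA, matFun_eq_cfc hA, matFun_eq_cfc hA]
  exact cfc_add A f g (continuousOn_spectrum A f) (continuousOn_spectrum A g)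

lemma matFun_const_mul {A : Matrix n n ℂ} (hA : A.IsHermitian) (r : ℝ) (f : ℝ → ℝ) :
    matFun (fun x => r * f x) A = r • matFun f A := by
  rw [matFun_eq_cfc hA, matFun_eq_cfc hA]
  exact cfc_const_mul r f A (continuousOn_spectrum A f)

lemma matFun_one {A : Matrix n n ℂ} (hA : A.IsHermitian) :
    matFun (fun _ => 1) A = 1 := by
  rw [matFun_eq_cfc hA]
  exact cfc_const_one ℝ A

lemma matFun_smul {A : Matrix n n ℂ} (hA : A.IsHermitian) (f : ℝ → ℝ) (r : ℝ) :
    matFun f (r • A) = matFun (fun x => f (r * x)) A := by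
  rw [← matFun_matFun hA f (fun x => r * x), matFun_const_mul hA r (fun x => x), matFun_id hA]

lemma matPow_smul {A : Matrix n n ℂ} (hA : A.PosSemidef) {r : ℝ} (hr : 0 < r) (p : ℝ) :
    matPow p (r • A) = r ^ p • matPow p A := by
  rw [matPow, matPow, matFun_smul hA.1, ← matFun_const_mul hA.1]
  refine matFun_congr hA fun x hx => ?_
  by_cases h : 0 < x
  · rw [if_pos h, if_pos (mul_pos hr h)]
    exact Real.mul_rpow hr.le hx
  · rw [if_neg h, if_neg (by rw [le_antisymm (not_lt.mp h) hx]; simp), mul_zero]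

lemma matLog2_smul {A : Matrix n n ℂ} (hA : A.PosDef) {r : ℝ} (hr : 0 < r) :
    matLog2 (r • A) = Real.logb 2 r • 1 + matLog2 A := by
  rw [matLog2, matLog2, matFun_smul hA.1, ← matFun_one hA.1, ← matFun_const_mul hA.1,
    ← matFun_add hA.1]
  refine matFun_congr_posDef hA fun x hx => ?_
  rw [if_pos hx, if_pos (mul_pos hr hx), mul_one, Real.logb_mul hr.ne' hx.ne']

/-- The projection onto the kernel of a positive semidefinite matrix. -/
noncomputable def kerProj (A : Matrix n n ℂ) : Matrix n n ℂ := matFun (fun x => if 0 < x then 0 else 1) A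

lemma kerProj_posSemidef {A : Matrix n n ℂ} (hA : A.PosSemidef) : (kerProj A).PosSemidef := by
  refine matFun_posSemidef hA fun x hx => ?_
  split_ifs <;> norm_num

lemma kerProj_le_one {A : Matrix n n ℂ} (hA : A.PosSemidef) : kerProj A ≤ 1 := by
  have h : (matFun (fun x => if 0 < x then 1 else 0) A).PosSemidef := by
    refine matFun_posSemidef hA fun x hx => ?_
    split_ifs <;> norm_num
  have h2 : kerProj A + matFun (fun x => if 0 < x then 1 else 0) A = 1 := by
    rw [kerProj, ← matFun_add hA.1, ← matFun_one hA.1]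
    congr 1
    funext x
    split_ifs <;> norm_num
  rw [le_iff, ← h2, add_sub_cancel_left]
  exact h

lemma self_mul_kerProj {A : Matrix n n ℂ} (hA : A.PosSemidef) : A * kerProj A = 0 := by
  conv_lhs => rw [← matFun_id hA.1]
  rw [kerProj, matFun_id hA.1]
  conv_lhs => enter [1]; rw [← matFun_id hA.1]
  rw [matFun_mul hA.1, show (0 : Matrix n n ℂ) = matFun (fun x => 0 * x) A by
    rw [matFun_const_mul hA.1, zero_smul]]
  refine matFun_congr hA fun x hx => ?_
  split_ifs with h
  · simp
  · simp [le_antisymm (not_lt.mp h) hx]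

lemma mul_kerProj_of_suppLE {ρ τ : Matrix n n ℂ} (hτ : τ.PosSemidef) (h : suppLE ρ τ) :
    ρ * kerProj τ = 0 := by
  ext i j
  have h1 := h (fun l => kerProj τ l j) (by
    have := self_mul_kerProj hτ
    funext l
    exact congrFun (congrFun this l) j)
  exact congrFun h1 i

/-- A positive semidefinite matrix with its kernel filled in by the eigenvalue `δ`. -/
lemma add_smul_kerProj {A : Matrix n n ℂ} (hA : A.PosSemidef) (δ : ℝ) :
    A + δ • kerProj A = matFun (fun x => if 0 < x then x else δ) A := by
  conv_lhs => enter [1]; rw [← matFun_id hA.1]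
  rw [kerProj, ← matFun_const_mul hA.1, ← matFun_add hA.1]
  refine matFun_congr hA fun x hx => ?_
  split_ifs with h
  · simp
  · simp [le_antisymm (not_lt.mp h) hx]

lemma posDef_add_smul_kerProj {A : Matrix n n ℂ} (hA : A.PosSemidef) {δ : ℝ} (hδ : 0 < δ) :
    (A + δ • kerProj A).PosDef := by
  rw [add_smul_kerProj hA, ← isStrictlyPositive_iff_posDef, matFun_eq_cfc hA.1,
    cfc_isStrictlyPositive_iff _ _ (continuousOn_spectrum A _)]
  intro x _
  split_ifs with h
  · exact h
  · exact hδ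

lemma matPow_add_smul_kerProj {A : Matrix n n ℂ} (hA : A.PosSemidef) {δ : ℝ} (hδ : 0 < δ)
    (p : ℝ) : matPow p (A + δ • kerProj A) = matPow p A + δ ^ p • kerProj A := by
  rw [add_smul_kerProj hA, matPow, matFun_matFun hA.1, matPow, kerProj, ← matFun_const_mul hA.1,
    ← matFun_add hA.1]
  congr 1
  funext x
  by_cases h : 0 < x
  · simp [h]
  · simp [h, hδ]

lemma matLog2_add_smul_kerProj {A : Matrix n n ℂ} (hA : A.PosSemidef) {δ : ℝ} (hδ : 0 < δ) :
    matLog2 (A + δ • kerProj A) = matLog2 A + Real.logb 2 δ • kerProj A := by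
  rw [add_smul_kerProj hA, matLog2, matFun_matFun hA.1, matLog2, kerProj,
    ← matFun_const_mul hA.1, ← matFun_add hA.1]
  congr 1
  funext x
  by_cases h : 0 < x
  · simp [h]
  · simp [h, hδ]

lemma add_smul_kerProj_le {τ ω : Matrix n n ℂ} (hτ : τ.PosSemidef) {δ : ℝ} (hδ : 0 < δ)
    (h : τ + δ • 1 ≤ ω) : τ + δ • kerProj τ ≤ ω := by
  refine le_trans ?_ h
  rw [le_iff, add_sub_add_left_eq_sub, ← smul_sub]
  exact (le_iff.mp (kerProj_le_one hτ)).smul hδ.le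

lemma re_trace_mul_nonneg {A B : Matrix n n ℂ} (hA : A.PosSemidef) (hB : B.PosSemidef) :
    0 ≤ (A * B).trace.re := by
  have h1 := matPow_half_mul_self hA
  have hs : (matPow (1 / 2) A)ᴴ = matPow (1 / 2) A := (matPow_posSemidef hA _).1
  have h2 := (hB.mul_mul_conjTranspose_same (matPow (1 / 2) A)).trace_nonneg
  rw [hs, Matrix.mul_assoc, trace_mul_comm, Matrix.mul_assoc, h1, trace_mul_comm] at h2
  simpa using (Complex.le_def.mp h2).1

lemma exists_eq_mul_conjTranspose {A : Matrix n n ℂ} (hA : A.PosSemidef) :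
    ∃ G : Matrix n n ℂ, A = G * Gᴴ := by
  refine ⟨matPow (1 / 2) A, ?_⟩
  rw [show (matPow (1 / 2) A)ᴴ = matPow (1 / 2) A from (matPow_posSemidef hA _).1,
    matPow_half_mul_self hA]

lemma suppLE_of_posDef (ρ : Matrix n n ℂ) {σ : Matrix n n ℂ} (hσ : σ.PosDef) : suppLE ρ σ := by
  intro v hv
  have := Matrix.mulVec_injective_of_isUnit hσ.isUnit (hv.trans (Matrix.mulVec_zero σ).symm)
  rw [this, Matrix.mulVec_zero]

lemma exists_le_smul {ρ σ : Matrix n n ℂ} (hρ : ρ.PosSemidef) (hσ : σ.PosDef) :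
    ∃ l : ℝ, 0 ≤ l ∧ ρ ≤ l • σ := by
  cases isEmpty_or_nonempty n
  · exact ⟨0, le_rfl, (Subsingleton.elim _ _ : ρ = _).le⟩
  have hσ' : IsStrictlyPositive σ := isStrictlyPositive_iff_posDef.mpr hσ
  obtain ⟨r, hr, hrσ⟩ := (CFC.exists_pos_algebraMap_le_iff (A := Matrix n n ℂ) (a := σ)
    hσ'.isSelfAdjoint).2 fun x hx => hσ'.spectrum_pos hx
  have h2 : ρ ≤ algebraMap ℝ _ ‖ρ‖ := IsSelfAdjoint.le_algebraMap_norm_self hρ.1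
  refine ⟨‖ρ‖ * r⁻¹, by positivity, h2.trans ?_⟩
  rw [Algebra.algebraMap_eq_smul_one] at hrσ ⊢
  rw [le_iff] at hrσ ⊢
  have := hrσ.smul (α := ℝ) (show 0 ≤ ‖ρ‖ * r⁻¹ by positivity)
  rwa [smul_sub, smul_smul, mul_assoc, inv_mul_cancel₀ hr.ne', mul_one] at this

lemma re_trace_sandwich_pos {ρ σ : Matrix n n ℂ} (hρ : ρ.PosSemidef) (hρ0 : ρ ≠ 0)
    (hσ : σ.PosDef) (s a : ℝ) :
    0 < (matPow a (matPow s σ * ρ * matPow s σ)).trace.re := by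
  have hs : (matPow s σ)ᴴ = matPow s σ := (matPow_posSemidef hσ.posSemidef s).1
  refine re_trace_matPow_pos ?_ (fun h => hρ0 ?_) a
  · have := hρ.mul_mul_conjTranspose_same (matPow s σ)
    rwa [hs] at this
  · have h1 : matPow (-s) σ * matPow s σ = 1 := by
      rw [matPow_mul_matPow hσ.posSemidef, neg_add_cancel, ← matFun_one hσ.1]
      refine matFun_congr_posDef hσ fun x hx => ?_
      rw [if_pos hx]
      exact Real.rpow_zero x
    have h2 : matPow s σ * matPow (-s) σ = 1 := mul_eq_one_comm.mp h1
    calc ρ = (matPow (-s) σ * matPow s σ) * ρ * (matPow s σ * matPow (-s) σ) := by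
          rw [h1, h2, Matrix.one_mul, Matrix.mul_one]
      _ = matPow (-s) σ * (matPow s σ * ρ * matPow s σ) * matPow (-s) σ := by
          simp only [Matrix.mul_assoc]
      _ = 0 := by rw [h, Matrix.mul_zero, Matrix.zero_mul]

omit [DecidableEq n] in
lemma IsDensityMatrix.ne_zero {ρ : Matrix n n ℂ} (hρ : IsDensityMatrix ρ) : ρ ≠ 0 := by
  rintro rfl
  simpa using hρ.2

lemma maxRelEntropy_antitone {ρ τ σ : Matrix n n ℂ} (hρ : IsDensityMatrix ρ)
    (hσ : σ.PosDef) {μ : ℝ} (hμ : 0 < μ) (h : τ ≤ μ • σ) :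
    ∃ r : ℝ, sandRenyi ⊤ ρ σ = r ∧ ((r - Real.logb 2 μ : ℝ) : EReal) ≤ sandRenyi ⊤ ρ τ := by
  have hex : ∃ l : ℝ, 0 ≤ l ∧ loewnerLE ρ (l • σ) := exists_le_smul hρ.1 hσ
  have hσtr : 0 ≤ σ.trace.re := (Complex.le_def.mp hσ.posSemidef.trace_nonneg).1
  have htr : ∀ l : ℝ, loewnerLE ρ (l • σ) → 1 ≤ l * σ.trace.re := by
    intro l hl
    have := (Complex.le_def.mp (PosSemidef.trace_nonneg hl)).1
    rw [trace_sub, trace_smul, hρ.2] at this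
    simpa using this
  have hσpos : 0 < σ.trace.re := by
    obtain ⟨l, _, hl⟩ := hex
    refine lt_of_le_of_ne hσtr fun h0 => ?_
    have := htr l hl
    rw [← h0, mul_zero] at this
    linarith
  set T := {l : ℝ | 0 ≤ l ∧ loewnerLE ρ (l • σ)} with hT
  have hbdd : BddBelow T := ⟨0, fun l hl => hl.1⟩
  have hpos : 0 < sInf T := by
    refine lt_of_lt_of_le (inv_pos.mpr hσpos) (le_csInf hex fun l hl => ?_)
    rw [inv_le_iff_one_le_mul₀ hσpos]
    exact htr l hl.2
  refine ⟨Real.logb 2 (sInf T), by rw [sandRenyi, if_pos rfl, if_pos hex], ?_⟩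
  rw [sandRenyi, if_pos rfl]
  split_ifs with hτ
  · set T' := {l : ℝ | 0 ≤ l ∧ loewnerLE ρ (l • τ)}
    have h1 : sInf T / μ ≤ sInf T' := by
      refine le_csInf hτ fun l hl => ?_
      rw [div_le_iff₀ hμ]
      refine csInf_le hbdd ⟨mul_nonneg hl.1 hμ.le, ?_⟩
      have h2 : ρ ≤ l • τ := hl.2
      have h3 : l • τ ≤ (l * μ) • σ := by
        rw [mul_smul, le_iff, ← smul_sub]
        exact (le_iff.mp h).smul hl.1
      exact h2.trans h3
    rw [EReal.coe_le_coe_iff, ← Real.logb_div hpos.ne' hμ.ne']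
    exact Real.logb_le_logb_of_le one_lt_two (div_pos hpos hμ) h1
  · exact le_top

lemma relEntropy_antitone {ρ τ σ : Matrix n n ℂ} (hρ : IsDensityMatrix ρ) (hτ : τ.PosSemidef)
    (hσ : σ.PosDef) {μ δ : ℝ} (hμ : 0 < μ) (hδ : 0 < δ) (h : τ + δ • 1 ≤ μ • σ) :
    ∃ r : ℝ, sandRenyi 1 ρ σ = r ∧ ((r - Real.logb 2 μ : ℝ) : EReal) ≤ sandRenyi 1 ρ τ := by
  refine ⟨(ρ * (matLog2 ρ - matLog2 σ)).trace.re, by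
    rw [sandRenyi, if_neg ENNReal.one_ne_top, if_pos rfl, if_pos (suppLE_of_posDef ρ hσ)], ?_⟩
  rw [sandRenyi, if_neg ENNReal.one_ne_top, if_pos rfl]
  split_ifs with hs
  · rw [EReal.coe_le_coe_iff]
    have h1 := matFun_log_le (posDef_add_smul_kerProj hτ hδ) (add_smul_kerProj_le hτ hδ h)
    rw [matLog2_smul hσ hμ, matLog2_add_smul_kerProj hτ hδ, le_iff] at h1
    have h2 := re_trace_mul_nonneg hρ.1 h1
    have h3 : ρ * (Real.logb 2 μ • 1 + matLog2 σ - (matLog2 τ + Real.logb 2 δ • kerProj τ)) =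
        Real.logb 2 μ • ρ + ρ * matLog2 σ - ρ * matLog2 τ := by
      rw [Matrix.mul_sub, Matrix.mul_add, Matrix.mul_add, Matrix.mul_smul, Matrix.mul_smul,
        mul_kerProj_of_suppLE hτ hs, smul_zero, add_zero, Matrix.mul_one]
    rw [h3, trace_sub, trace_add, trace_smul, hρ.2] at h2
    simp only [Complex.sub_re, Complex.add_re, Complex.real_smul, mul_one,
      Complex.ofReal_re] at h2
    rw [Matrix.mul_sub, Matrix.mul_sub, trace_sub, trace_sub, Complex.sub_re, Complex.sub_re]
    linarith
  · exact le_top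

lemma sandwiched_antitone {α : ℝ≥0∞} (hα : 1 / 2 ≤ α) (hα1 : α ≠ 1) (hαt : α ≠ ⊤)
    {ρ τ σ : Matrix n n ℂ} (hρ : IsDensityMatrix ρ) (hτ : τ.PosSemidef)
    (hσ : σ.PosDef) {μ δ : ℝ} (hμ : 0 < μ) (hδ : 0 < δ) (h : τ + δ • 1 ≤ μ • σ) :
    ∃ r : ℝ, sandRenyi α ρ σ = r ∧ ((r - Real.logb 2 μ : ℝ) : EReal) ≤ sandRenyi α ρ τ := by
  have ha : 1 / 2 ≤ α.toReal := by
    have := ENNReal.toReal_mono hαt hα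
    simpa using this
  have ha1 : α.toReal ≠ 1 := by
    intro h1
    exact hα1 ((ENNReal.toReal_eq_one_iff α).mp h1)
  rw [sandRenyi, if_neg hαt, if_neg hα1, if_neg (fun h => h.2 (suppLE_of_posDef ρ hσ)),
    sandRenyi, if_neg hαt, if_neg hα1]
  set a := α.toReal
  have hQσ := re_trace_sandwich_pos hρ.1 (IsDensityMatrix.ne_zero hρ) hσ
    ((1 - a) / (2 * a)) a
  rw [if_pos hQσ]
  refine ⟨_, rfl, ?_⟩
  split_ifs with hs hQ
  · exact le_top
  · rw [EReal.coe_le_coe_iff]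
    obtain ⟨G, hG⟩ := exists_eq_mul_conjTranspose hρ.1
    have hss : (1 - a) / (2 * a) + (1 - a) / (2 * a) = (1 - a) / a := by
      field_simp
      norm_num
    rw [trace_sandwich hτ hG, hss] at hQ ⊢
    rw [trace_sandwich hσ.posSemidef hG, hss] at hQσ ⊢
    have hGpos : ∀ C : Matrix n n ℂ, C.PosSemidef → (Gᴴ * C * G).PosSemidef := fun C hC =>
      hC.conjTranspose_mul_mul_same G
    have hGmono : ∀ {C D : Matrix n n ℂ}, C ≤ D → Gᴴ * C * G ≤ Gᴴ * D * G := by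
      intro C D hCD
      rw [le_iff, ← Matrix.sub_mul, ← Matrix.mul_sub]
      exact hGpos _ hCD
    have hscale : (matPow a (Gᴴ * matPow ((1 - a) / a) (μ • σ) * G)).trace.re =
        μ ^ (1 - a) * (matPow a (Gᴴ * matPow ((1 - a) / a) σ * G)).trace.re := by
      rw [matPow_smul hσ.posSemidef hμ, Matrix.mul_smul, Matrix.smul_mul,
        matPow_smul (hGpos _ (matPow_posSemidef hσ.posSemidef _)) (Real.rpow_pos_of_pos hμ _),
        ← Real.rpow_mul hμ.le, div_mul_cancel₀ _ (by linarith), trace_smul, Complex.real_smul,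
        Complex.re_ofReal_mul]
    have hlog : Real.logb 2 (μ ^ (1 - a) *
        (matPow a (Gᴴ * matPow ((1 - a) / a) σ * G)).trace.re) =
        (1 - a) * Real.logb 2 μ +
          Real.logb 2 (matPow a (Gᴴ * matPow ((1 - a) / a) σ * G)).trace.re := by
      rw [Real.logb_mul (Real.rpow_pos_of_pos hμ _).ne' hQσ.ne',
        Real.logb_rpow_eq_mul_logb_of_pos hμ]
    have hne : a - 1 ≠ 0 := sub_ne_zero.mpr ha1
    have hgoal : (a - 1)⁻¹ * Real.logb 2 (matPow a (Gᴴ * matPow ((1 - a) / a) σ * G)).trace.re -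
        Real.logb 2 μ = (a - 1)⁻¹ * Real.logb 2 (μ ^ (1 - a) *
        (matPow a (Gᴴ * matPow ((1 - a) / a) σ * G)).trace.re) := by
      rw [hlog]
      field_simp
      ring
    rw [hgoal]
    rcases lt_or_gt_of_ne ha1 with hlt | hgt
    · refine mul_le_mul_of_nonpos_left ?_ (inv_nonpos.mpr (by linarith))
      refine Real.logb_le_logb_of_le one_lt_two hQ ?_
      rw [← hscale]
      refine re_trace_matPow_mono (hGpos _ (matPow_posSemidef hτ _)) (hGmono ?_) (by linarith)
      refine matPow_le_matPow hτ ?_ (div_pos (by linarith) (by linarith)) ?_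
      · refine le_trans ?_ h
        rw [le_iff, add_sub_cancel_left]
        exact PosSemidef.one.smul hδ.le
      · rw [div_le_one (by linarith)]
        linarith
    · refine mul_le_mul_of_nonneg_left ?_ (inv_nonneg.mpr (by linarith))
      refine Real.logb_le_logb_of_le one_lt_two
        (mul_pos (Real.rpow_pos_of_pos hμ _) hQσ) ?_
      rw [← hscale]
      have hsupp : suppLE ρ τ := by
        by_contra hns
        exact hs ⟨hgt, hns⟩
      have hPG : kerProj τ * G = 0 := by
        have h0 : (kerProj τ * G) * (kerProj τ * G)ᴴ = 0 := by
          rw [conjTranspose_mul, (kerProj_posSemidef hτ).1, Matrix.mul_assoc,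
            ← Matrix.mul_assoc G, ← hG, mul_kerProj_of_suppLE hτ hsupp, Matrix.mul_zero]
        exact self_mul_conjTranspose_eq_zero.mp h0
      have hfill : Gᴴ * matPow ((1 - a) / a) τ * G =
          Gᴴ * matPow ((1 - a) / a) (τ + δ • kerProj τ) * G := by
        rw [matPow_add_smul_kerProj hτ hδ, Matrix.mul_assoc, Matrix.mul_assoc, Matrix.add_mul,
          Matrix.smul_mul, hPG, smul_zero, add_zero]
      rw [hfill]
      have hpow : (1 - a) / a = -((a - 1) / a) := by ring
      have hμσ : (μ • σ).PosDef := hσ.smul hμ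
      refine re_trace_matPow_mono (hGpos _ (matPow_posSemidef hμσ.posSemidef _))
        (hGmono ?_) (by linarith)
      rw [hpow]
      refine matPow_neg_le_matPow_neg (posDef_add_smul_kerProj hτ hδ)
        (add_smul_kerProj_le hτ hδ h) (div_pos (by linarith) (by linarith)) ?_
      rw [div_le_one (by linarith)]
      linarith
  · exact le_top

/-- Up to scaling, the sandwiched Rényi relative entropy is antitone in its second argument. -/
lemma sandRenyi_antitone {α : ℝ≥0∞} (hα : 1 / 2 ≤ α) {ρ τ σ : Matrix n n ℂ}
    (hρ : IsDensityMatrix ρ) (hτ : τ.PosSemidef) (hσ : σ.PosDef) {μ δ : ℝ} (hμ : 0 < μ)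
    (hδ : 0 < δ) (h : τ + δ • 1 ≤ μ • σ) :
    ∃ r : ℝ, sandRenyi α ρ σ = r ∧ ((r - Real.logb 2 μ : ℝ) : EReal) ≤ sandRenyi α ρ τ := by
  by_cases hαt : α = ⊤
  · subst hαt
    refine maxRelEntropy_antitone hρ hσ hμ (le_trans ?_ h)
    rw [le_iff, add_sub_cancel_left]
    exact PosSemidef.one.smul hδ.le
  by_cases hα1 : α = 1
  · subst hα1
    exact relEntropy_antitone hρ hτ hσ hμ hδ h
  exact sandwiched_antitone hα hα1 hαt hρ hτ hσ hμ hδ h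

end SecondArgument
end SandwichedRenyi

namespace SandwichedRenyi

section Minimax

open scoped MatrixOrder
open Matrix

variable {n I : Type*} [Fintype n] [DecidableEq n] [Fintype I]

omit [DecidableEq n] in
lemma convex_setOf_isDensityMatrix : Convex ℝ {σ : Matrix n n ℂ | IsDensityMatrix σ} := by
  rintro σ ⟨hσ, hσt⟩ τ ⟨hτ, hτt⟩ a b ha hb hab
  refine ⟨(hσ.smul ha).add (hτ.smul hb), ?_⟩
  rw [trace_add, trace_smul, trace_smul, hσt, hτt, ← add_smul, hab, one_smul]

lemma isCompact_setOf_isDensityMatrix : IsCompact {σ : Matrix n n ℂ | IsDensityMatrix σ} := by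
  have himage : {σ : Matrix n n ℂ | IsDensityMatrix σ} =
      (fun G : Matrix n n ℂ => G * Gᴴ) '' {G | (G * Gᴴ).trace = 1} := by
    ext σ
    constructor
    · rintro ⟨hσ, hσt⟩
      obtain ⟨G, rfl⟩ := exists_eq_mul_conjTranspose hσ
      exact ⟨G, hσt, rfl⟩
    · rintro ⟨G, hG, rfl⟩
      exact ⟨posSemidef_self_mul_conjTranspose G, hG⟩
  rw [himage]
  refine IsCompact.image ?_ (by fun_prop)
  have hbox : IsCompact (Set.univ.pi fun _ : n => Set.univ.pi fun _ : n =>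
      Metric.closedBall (0 : ℂ) 1) :=
    isCompact_univ_pi fun _ => isCompact_univ_pi fun _ => isCompact_closedBall 0 1
  refine IsCompact.of_isClosed_subset hbox (isClosed_eq (by fun_prop) continuous_const) ?_
  intro G hG
  have hsum : ∑ i, ∑ j, Complex.normSq (G i j) = 1 := by
    have := congrArg Complex.re (show (G * Gᴴ).trace = 1 from hG)
    rw [← Complex.one_re, ← this, trace, Complex.re_sum]
    refine Finset.sum_congr rfl fun i _ => ?_
    simp [mul_apply, Complex.mul_conj]
  refine Set.mem_univ_pi.mpr fun i => Set.mem_univ_pi.mpr fun j => mem_closedBall_zero_iff.mpr ?_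
  have h1 : Complex.normSq (G i j) ≤ 1 := by
    rw [← hsum]
    exact (Finset.single_le_sum (f := fun j => Complex.normSq (G i j))
      (fun _ _ => Complex.normSq_nonneg _) (Finset.mem_univ j)).trans
      (Finset.single_le_sum (f := fun i => ∑ j, Complex.normSq (G i j))
      (fun _ _ => Finset.sum_nonneg fun _ _ => Complex.normSq_nonneg _) (Finset.mem_univ i))
  rw [Complex.normSq_eq_norm_sq] at h1
  exact (sq_le_one_iff₀ (norm_nonneg _)).mp h1

lemma exists_isDensityMatrix_top_eigenvalue [Nonempty n] {A : Matrix n n ℂ} (hA : A.PosSemidef) :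
    ∃ (l : ℝ) (σ : Matrix n n ℂ), 0 ≤ l ∧ A ≤ l • 1 ∧ IsDensityMatrix σ ∧
      (A * σ).trace.re = l := by
  obtain ⟨U, hU, hU', hf, hd⟩ := exists_diagonalization hA.1
  obtain ⟨i, -, hi⟩ := Finset.exists_max_image Finset.univ hA.1.eigenvalues Finset.univ_nonempty
  have hs : (single i i (1 : ℂ)).PosSemidef := by
    rw [← diagonal_single]
    refine PosSemidef.diagonal fun j => ?_
    by_cases h : j = i
    · subst h
      simp
    · simp [h]
  refine ⟨hA.1.eigenvalues i, U * single i i 1 * Uᴴ, hA.eigenvalues_nonneg i, ?_,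
    ⟨hs.mul_mul_conjTranspose_same U, ?_⟩, ?_⟩
  · rw [le_iff]
    have h1 : hA.1.eigenvalues i • (1 : Matrix n n ℂ) - A =
        matFun (fun x => hA.1.eigenvalues i * 1 + (-1) * x) A := by
      rw [matFun_add hA.1, matFun_const_mul hA.1, matFun_const_mul hA.1, matFun_one hA.1,
        matFun_id hA.1, neg_one_smul, sub_eq_add_neg]
    rw [h1, hf]
    refine (PosSemidef.diagonal fun j => ?_).mul_mul_conjTranspose_same U
    have := hi j (Finset.mem_univ j)
    have h2 : 0 ≤ hA.1.eigenvalues i * 1 + (-1) * hA.1.eigenvalues j := by linarith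
    exact Complex.zero_le_real.mpr h2
  · rw [trace_mul_comm, ← Matrix.mul_assoc, hU, Matrix.one_mul]
    simp
  · rw [← Matrix.mul_assoc, ← Matrix.mul_assoc, trace_mul_comm, ← Matrix.mul_assoc,
      ← Matrix.mul_assoc, hd, trace_mul_comm, trace_single_mul, diagonal_apply_eq]
    simp

omit [DecidableEq n] in
lemma posSemidef_of_forall_re_trace_nonneg {A : Matrix n n ℂ} (hA : A.IsHermitian)
    (h : ∀ N : Matrix n n ℂ, N.PosSemidef → 0 ≤ (A * N).trace.re) : A.PosSemidef := by
  refine PosSemidef.of_dotProduct_mulVec_nonneg hA fun x => ?_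
  have h1 := h _ (posSemidef_vecMulVec_self_star x)
  rw [mul_vecMulVec, trace_vecMulVec, dotProduct_comm] at h1
  rw [Complex.nonneg_iff]
  exact ⟨h1, (hA.im_star_dotProduct_mulVec_self x).symm⟩

/-- Strong duality for the conditional min-entropy of a classical-quantum operator. -/
lemma exists_isDensityMatrix_le_smul [Nonempty n] {P : I → Matrix n n ℂ}
    (hP : ∀ i, (P i).IsHermitian) {μ : ℝ}
    (h : ∀ N : I → Matrix n n ℂ, (∀ i, (N i).PosSemidef) → ∑ i, N i ≤ 1 →
      ∑ i, (P i * N i).trace.re ≤ μ) :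
    ∃ σ : Matrix n n ℂ, IsDensityMatrix σ ∧ ∀ i, P i ≤ μ • σ := by
  classical
  set f : Matrix n n ℂ → (I → Matrix n n ℂ) → ℝ :=
    fun σ N => ∑ i, ((P i - μ • σ) * N i).trace.re with hfdef
  set X : Set (Matrix n n ℂ) := {σ | IsDensityMatrix σ} with hX
  set Y : Set (I → Matrix n n ℂ) := {N | ∀ i, (N i).PosSemidef} with hY
  have hμ : 0 ≤ μ := by
    have := h 0 (fun _ => PosSemidef.zero) (by simp)
    simpa using this
  have hf_eq : ∀ σ N, f σ N = ∑ i, (P i * N i).trace.re - μ * ((∑ i, N i) * σ).trace.re := by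
    intro σ N
    rw [trace_mul_comm (∑ i, N i) σ, Finset.mul_sum, trace_sum, Complex.re_sum, Finset.mul_sum,
      ← Finset.sum_sub_distrib]
    refine Finset.sum_congr rfl fun i _ => ?_
    simp [sub_mul]
  have hXne : X.Nonempty := by
    obtain ⟨_, σ, -, -, hσ, -⟩ := exists_isDensityMatrix_top_eigenvalue
      (PosSemidef.zero : (0 : Matrix n n ℂ).PosSemidef)
    exact ⟨σ, hσ⟩
  have hYc : Convex ℝ Y := fun N hN N' hN' a b ha hb _ i =>
    ((hN i).smul ha).add ((hN' i).smul hb)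
  have hle : ∀ N ∈ Y, ∃ σ ∈ X, f σ N ≤ 0 := by
    intro N hN
    obtain ⟨l, σ, hl, hNl, hσ, hσl⟩ := exists_isDensityMatrix_top_eigenvalue
      (posSemidef_sum Finset.univ fun i _ => hN i : (∑ i, N i).PosSemidef)
    refine ⟨σ, hσ, ?_⟩
    rw [hf_eq, hσl]
    clear_value f
    have hscale : ∀ t : ℝ, 0 ≤ t → t * l ≤ 1 → t * ∑ i, (P i * N i).trace.re ≤ μ := by
      intro t ht htl
      have := h (fun i => t • N i) (fun i => (hN i).smul ht) ?_
      · simpa [Finset.mul_sum] using this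
      · rw [← Finset.smul_sum]
        refine (smul_le_smul_of_nonneg_left hNl ht).trans ?_
        rw [smul_smul, le_iff]
        have h1 : (1 : Matrix n n ℂ) - (t * l) • 1 = (1 - t * l) • 1 := by
          rw [sub_smul, one_smul]
        rw [h1]
        exact PosSemidef.one.smul (by linarith)
    generalize ∑ i, (P i * N i).trace.re = y at hscale ⊢
    rcases hl.eq_or_lt with rfl | hl
    · by_contra! hy
      have hy' : 0 < y := by linarith
      have := hscale ((μ + 1) / y) (by positivity) (by simp)
      rw [div_mul_cancel₀ _ hy'.ne'] at this
      linarith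
    · have := hscale l⁻¹ (by positivity) (by rw [inv_mul_cancel₀ hl.ne'])
      rw [inv_mul_le_iff₀ hl] at this
      linarith
  have hcont : ∀ N, Continuous fun σ => f σ N := fun N => by
    refine continuous_finsetSum _ fun i _ => Complex.continuous_re.comp ?_
    fun_prop
  have hcont' : ∀ σ, Continuous fun N => f σ N := fun σ => by
    refine continuous_finsetSum _ fun i _ => Complex.continuous_re.comp ?_
    fun_prop
  have hlin : ∀ σ σ' N (a b : ℝ), a + b = 1 → f (a • σ + b • σ') N = a * f σ N + b * f σ' N := by
    intro σ σ' N a b hab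
    rw [hf_eq, hf_eq, hf_eq]
    simp only [Matrix.mul_add, trace_add, Complex.add_re, Matrix.mul_smul, trace_smul,
      Complex.real_smul, Complex.re_ofReal_mul]
    linear_combination (-(∑ i, (P i * N i).trace.re)) * hab
  have hlin' : ∀ σ N N' (a b : ℝ), f σ (a • N + b • N') = a * f σ N + b * f σ N' := by
    intro σ N N' a b
    simp only [hfdef, Finset.mul_sum, ← Finset.sum_add_distrib]
    refine Finset.sum_congr rfl fun i _ => ?_
    simp only [Pi.add_apply, Pi.smul_apply, Matrix.mul_add, trace_add, Complex.add_re,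
      Matrix.mul_smul, trace_smul, Complex.real_smul, Complex.re_ofReal_mul]
  obtain ⟨σ, hσ, hσN⟩ : ∃ σ ∈ X, ∀ N ∈ Y, f σ N ≤ 0 := by
    by_contra! hcon
    choose! g hgY hg using hcon
    obtain ⟨t, ht, hcover⟩ := isCompact_setOf_isDensityMatrix.elim_nhds_subcover
      (fun σ => {τ : Matrix n n ℂ | 0 < f τ (g σ)}) fun σ hσ =>
        (isOpen_lt continuous_const (hcont (g σ))).mem_nhds (hg σ hσ)
    obtain ⟨N, hN, hN'⟩ := Sion.exists_lt_iInf_of_lt_iInf_of_finite (X := X) (Y := Y) (f := f)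
      (t := 0) (s := g '' t) (ne_X := hXne) (kX := isCompact_setOf_isDensityMatrix)
      (hfy := fun N _ => (hcont N).lowerSemicontinuous.lowerSemicontinuousOn _)
      (hfy' := fun N _ => ConvexOn.quasiconvexOn ⟨convex_setOf_isDensityMatrix,
        fun σ _ σ' _ a b _ _ hab => (hlin σ σ' N a b hab).le⟩)
      (hfx := fun σ _ => (hcont' σ).upperSemicontinuous.upperSemicontinuousOn _)
      (cY := hYc)
      (hfx' := fun σ _ => ConcaveOn.quasiconcaveOn ⟨hYc,
        fun N _ N' _ a b _ _ _ => (hlin' σ N N' a b).ge⟩)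
      (cX := convex_setOf_isDensityMatrix)
      (hs := t.finite_toSet.image g)
      (hsY := by rintro _ ⟨σ, hσ, rfl⟩; exact hgY σ (ht σ hσ))
      (ht := fun τ hτ => by
        obtain ⟨σ, hσ, hσ'⟩ := Set.mem_iUnion₂.mp (hcover hτ)
        exact ⟨g σ, ⟨σ, hσ, rfl⟩, hσ'⟩)
    obtain ⟨σ, hσ, hσ'⟩ := hle N hN
    exact absurd hσ' (not_le.mpr (hN' σ hσ))
  refine ⟨σ, hσ, fun i => le_iff.mpr (posSemidef_of_forall_re_trace_nonneg
    ((hσ.1.1.smul (IsSelfAdjoint.all μ)).sub (hP i)) fun N hN => ?_)⟩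
  have hNi : (Pi.single i N : I → Matrix n n ℂ) ∈ Y := by
    intro j
    by_cases hj : j = i
    · subst hj
      simpa using hN
    · simpa [hj] using PosSemidef.zero
  have h1 := hσN _ hNi
  rw [hfdef] at h1
  simp only at h1
  rw [Finset.sum_eq_single i (fun j _ hj => by simp [hj]) (by simp), Pi.single_eq_same] at h1
  rw [← neg_sub, Matrix.neg_mul, trace_neg, Complex.neg_re]
  linarith

end Minimax

end SandwichedRenyi

namespace SandwichedRenyi

section ClassicalQuantum

open scoped MatrixOrder
open Matrix

variable {I m n k : Type*} [DecidableEq I]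

/-- The block-diagonal matrix `∑ i, |i⟩⟨i| ⊗ A i`. -/
def cqMatrix (A : I → Matrix m n ℂ) : Matrix (I × m) (I × n) ℂ :=
  (blockDiagonal A).submatrix Prod.swap Prod.swap

lemma cqMatrix_apply (A : I → Matrix m n ℂ) (p : I × m) (q : I × n) :
    cqMatrix A p q = if p.1 = q.1 then A p.1 p.2 q.2 else 0 := rfl

lemma cqMatrix_mul [Fintype I] [Fintype n] (A : I → Matrix m n ℂ) (B : I → Matrix n k ℂ) :
    cqMatrix A * cqMatrix B = cqMatrix fun i => A i * B i := by
  rw [cqMatrix, cqMatrix, cqMatrix, blockDiagonal_mul]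
  exact submatrix_mul_equiv _ _ _ (Equiv.prodComm I n) _

lemma cqMatrix_conjTranspose (A : I → Matrix m n ℂ) :
    (cqMatrix A)ᴴ = cqMatrix fun i => (A i)ᴴ := by
  rw [cqMatrix, conjTranspose_submatrix, blockDiagonal_conjTranspose, cqMatrix]

lemma cqMatrix_trace [Fintype I] [Fintype n] (A : I → Matrix n n ℂ) :
    (cqMatrix A).trace = ∑ i, (A i).trace := by
  simp [trace, cqMatrix_apply, Fintype.sum_prod_type]

lemma cqMatrix_const (A : Matrix m n ℂ) : cqMatrix (fun _ : I => A) = (1 : Matrix I I ℂ) ⊗ₖ A := by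
  ext ⟨i, a⟩ ⟨j, b⟩
  simp [cqMatrix_apply, one_apply]

lemma cqMatrix_one [DecidableEq n] : cqMatrix (fun _ : I => (1 : Matrix n n ℂ)) = 1 := by
  rw [cqMatrix_const, one_kronecker_one]

lemma cqMatrix_posSemidef [Fintype I] [Fintype n] [DecidableEq n] {A : I → Matrix n n ℂ}
    (hA : ∀ i, (A i).PosSemidef) : (cqMatrix A).PosSemidef := by
  choose G hG using fun i => exists_eq_mul_conjTranspose (hA i)
  have : cqMatrix A = cqMatrix G * (cqMatrix G)ᴴ := by
    rw [cqMatrix_conjTranspose, cqMatrix_mul]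
    exact congrArg cqMatrix (funext hG)
  rw [this]
  exact posSemidef_self_mul_conjTranspose _

lemma cqMatrix_le_cqMatrix [Fintype I] [Fintype n] [DecidableEq n] {A B : I → Matrix n n ℂ}
    (h : ∀ i, A i ≤ B i) : cqMatrix A ≤ cqMatrix B := by
  rw [le_iff]
  have : cqMatrix B - cqMatrix A = cqMatrix fun i => B i - A i := by
    ext p q
    simp only [Matrix.sub_apply, cqMatrix_apply]
    split_ifs <;> simp
  rw [this]
  exact cqMatrix_posSemidef fun i => le_iff.mp (h i)

end ClassicalQuantum

section KroneckerOrder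

open scoped MatrixOrder
open Matrix

variable {I m n : Type*} [Fintype m] [Fintype n]

omit [Fintype m] [Fintype n] in
lemma sum_kronecker (s : Finset I) (A : I → Matrix m m ℂ) (B : Matrix n n ℂ) :
    (∑ i ∈ s, A i) ⊗ₖ B = ∑ i ∈ s, A i ⊗ₖ B := by
  ext a b
  simp [Matrix.sum_apply, Finset.sum_mul]

omit [Fintype m] [Fintype n] in
lemma kronecker_sum (s : Finset I) (A : Matrix m m ℂ) (B : I → Matrix n n ℂ) :
    A ⊗ₖ (∑ i ∈ s, B i) = ∑ i ∈ s, A ⊗ₖ B i := by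
  ext a b
  simp [Matrix.sum_apply, Finset.mul_sum]

lemma kronecker_le_kronecker_right {A B : Matrix m m ℂ} (h : A ≤ B) {C : Matrix n n ℂ}
    (hC : C.PosSemidef) : A ⊗ₖ C ≤ B ⊗ₖ C := by
  have h1 : B ⊗ₖ C = A ⊗ₖ C + (B - A) ⊗ₖ C := by
    rw [← add_kronecker, add_sub_cancel]
  rw [h1]
  exact le_add_of_nonneg_right ((le_iff.mp h).kronecker hC).nonneg

lemma kronecker_le_kronecker_left {A B : Matrix n n ℂ} (h : A ≤ B) {C : Matrix m m ℂ}
    (hC : C.PosSemidef) : C ⊗ₖ A ≤ C ⊗ₖ B := by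
  have h1 : C ⊗ₖ B = C ⊗ₖ A + C ⊗ₖ (B - A) := by
    rw [← kronecker_add, add_sub_cancel]
  rw [h1]
  exact le_add_of_nonneg_right (hC.kronecker (le_iff.mp h)).nonneg

end KroneckerOrder

section MaxEntropy

open scoped MatrixOrder
open Matrix

variable {S Q M X Z : Type*} [Fintype S] [DecidableEq S] [Fintype Q] [DecidableEq Q]
  [Fintype M] [DecidableEq M] [Fintype X] [DecidableEq X] [Fintype Z]

lemma sandRenyi_half {n : Type*} [Fintype n] [DecidableEq n] {σ : Matrix n n ℂ}
    {k : Type*} [Fintype k] [DecidableEq k] (hσ : σ.PosSemidef) (G : Matrix n k ℂ)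
    (h : 0 < (matPow (1 / 2) (Gᴴ * σ * G)).trace.re) :
    sandRenyi (1 / 2) (G * Gᴴ) σ =
      ((-(2 * Real.logb 2 (matPow (1 / 2) (Gᴴ * σ * G)).trace.re) : ℝ) : EReal) := by
  have h1 : (1 / 2 : ℝ≥0∞).toReal = 1 / 2 := by simp
  have h2 : (1 / 2 : ℝ≥0∞) ≠ 1 := fun h => by
    rw [h] at h1
    norm_num at h1
  have h3 : (1 - (1 / 2 : ℝ)) / (2 * (1 / 2)) = 1 / 2 := by norm_num
  rw [sandRenyi, if_neg (by simp), if_neg h2, h1, if_neg (fun h => by norm_num at h), h3,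
    trace_sandwich hσ rfl]
  norm_num only [add_halves]
  rw [matPow_one hσ, if_pos h]
  norm_num

lemma logb_le_condRenyi_half (Ψ : Matrix (S × Q) M ℂ) {u : X → Matrix S S ℂ}
    {v : Z → Matrix S S ℂ} {w : Z → Matrix Q Q ℂ} (hu : ∀ x, (u x).IsHermitian)
    (hv : ∀ z, (v z).IsHermitian) (hw : ∀ z, (w z).IsHermitian) (hu1 : ∑ x, u x * u x = 1)
    (hw1 : ∑ z, w z * w z ≤ 1) {c : ℝ} (hc : 0 < c)
    (huv : ∀ x z, (u x * v z) * (u x * v z)ᴴ ≤ c • 1) {p : ℝ}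
    (hp : p = ∑ z, (Ψᴴ * ((v z * v z) ⊗ₖ (w z * w z)) * Ψ).trace.re) (hp0 : 0 < p) :
    ((Real.logb 2 (p / c) : ℝ) : EReal) ≤
      condRenyi (1 / 2) (cqMatrix fun x => (Ψᴴ * ((u x * u x) ⊗ₖ (1 : Matrix Q Q ℂ)) * Ψ)ᵀ) := by
  let L : X → Matrix (S × Q) M ℂ := fun x => (u x ⊗ₖ (1 : Matrix Q Q ℂ)) * Ψ
  let Φ : Matrix (Z × (S × Q)) M ℂ := of fun a b => ((v a.1 ⊗ₖ w a.1) * Ψ) a.2 b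
  let V : X → Matrix (S × Q) (Z × (S × Q)) ℂ :=
    fun x => of fun t a => ((u x * v a.1) ⊗ₖ w a.1) t a.2
  have hLL : ∀ x, (L x)ᴴ * L x = Ψᴴ * ((u x * u x) ⊗ₖ (1 : Matrix Q Q ℂ)) * Ψ := by
    intro x
    simp only [L]
    rw [conjTranspose_mul, conjTranspose_kronecker, conjTranspose_one, (hu x).eq,
      ← Matrix.mul_assoc, Matrix.mul_assoc Ψᴴ, ← mul_kronecker_mul, Matrix.mul_one]
  have hΦΦ : Φᴴ * Φ = ∑ z, Ψᴴ * ((v z * v z) ⊗ₖ (w z * w z)) * Ψ := by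
    have h1 : ∀ z, Ψᴴ * ((v z * v z) ⊗ₖ (w z * w z)) * Ψ =
        ((v z ⊗ₖ w z) * Ψ)ᴴ * ((v z ⊗ₖ w z) * Ψ) := by
      intro z
      rw [conjTranspose_mul, conjTranspose_kronecker, (hv z).eq, (hw z).eq, mul_kronecker_mul]
      simp only [Matrix.mul_assoc]
    simp only [h1]
    ext a b
    rw [Matrix.sum_apply, mul_apply, Fintype.sum_prod_type]
    rfl
  have hVV : ∀ x, V x * (V x)ᴴ ≤ c • 1 := by
    intro x
    have h1 : V x * (V x)ᴴ = ∑ z, ((u x * v z) * (u x * v z)ᴴ) ⊗ₖ (w z * w z) := by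
      have h2 : ∀ z, ((u x * v z) * (u x * v z)ᴴ) ⊗ₖ (w z * w z) =
          ((u x * v z) ⊗ₖ w z) * ((u x * v z) ⊗ₖ w z)ᴴ := by
        intro z
        rw [conjTranspose_kronecker, (hw z).eq, ← mul_kronecker_mul]
      simp only [h2]
      ext a b
      rw [Matrix.sum_apply, mul_apply, Fintype.sum_prod_type]
      rfl
    rw [h1]
    calc ∑ z, ((u x * v z) * (u x * v z)ᴴ) ⊗ₖ (w z * w z)
        ≤ ∑ z, (c • (1 : Matrix S S ℂ)) ⊗ₖ (w z * w z) :=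
          Finset.sum_le_sum fun z _ => kronecker_le_kronecker_right (huv x z) <| by
            have := posSemidef_self_mul_conjTranspose (w z)
            rwa [(hw z).eq] at this
      _ = (c • (1 : Matrix S S ℂ)) ⊗ₖ ∑ z, w z * w z := (kronecker_sum _ _ _).symm
      _ ≤ (c • (1 : Matrix S S ℂ)) ⊗ₖ 1 :=
          kronecker_le_kronecker_left hw1 (PosSemidef.one.smul hc.le)
      _ = c • 1 := by rw [smul_kronecker, one_kronecker_one]
  have hVΦ : ∀ x, V x * Φ = ∑ z, (u x ⊗ₖ (1 : Matrix Q Q ℂ)) *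
      ((v z * v z) ⊗ₖ (w z * w z)) * Ψ := by
    intro x
    have h2 : ∀ z, (u x ⊗ₖ (1 : Matrix Q Q ℂ)) * ((v z * v z) ⊗ₖ (w z * w z)) * Ψ =
          ((u x * v z) ⊗ₖ w z) * ((v z ⊗ₖ w z) * Ψ) := by
      intro z
      rw [← Matrix.mul_assoc, ← mul_kronecker_mul, ← mul_kronecker_mul, Matrix.one_mul,
        Matrix.mul_assoc]
    simp only [h2]
    ext a b
    rw [Matrix.sum_apply, mul_apply, Fintype.sum_prod_type]
    rfl
  have htr : ∑ x, (V x * Φ * (L x)ᴴ).trace.re = p := by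
    rw [hp]
    have h1 : ∀ x, (V x * Φ * (L x)ᴴ).trace =
        ∑ z, (((u x * u x) ⊗ₖ (1 : Matrix Q Q ℂ)) *
          (((v z * v z) ⊗ₖ (w z * w z)) * (Ψ * Ψᴴ))).trace := by
      intro x
      have hK : (u x * u x) ⊗ₖ (1 : Matrix Q Q ℂ) = (u x ⊗ₖ 1) * (u x ⊗ₖ 1) := by
        rw [← mul_kronecker_mul, Matrix.mul_one]
      rw [hVΦ, Matrix.sum_mul, trace_sum]
      refine Finset.sum_congr rfl fun z _ => ?_
      simp only [L]
      rw [conjTranspose_mul, conjTranspose_kronecker, conjTranspose_one, (hu x).eq,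
        ← Matrix.mul_assoc, trace_mul_comm, hK]
      simp only [Matrix.mul_assoc]
    rw [← Complex.re_sum, ← Complex.re_sum, Finset.sum_congr rfl fun x _ => h1 x,
      Finset.sum_comm]
    congr 1
    refine Finset.sum_congr rfl fun z _ => ?_
    rw [← trace_sum, ← Matrix.sum_mul, ← sum_kronecker, hu1, one_kronecker_one, Matrix.one_mul,
      Matrix.mul_assoc, trace_mul_comm Ψᴴ, Matrix.mul_assoc]
  let G : Matrix (X × M) (X × (S × Q)) ℂ := cqMatrix fun x => (L x)ᵀ
  let B : Matrix (X × M) (X × (Z × (S × Q))) ℂ := cqMatrix fun _ => Φᵀ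
  let W : Matrix (X × (Z × (S × Q))) (X × (S × Q)) ℂ :=
    cqMatrix fun x => (Real.sqrt c)⁻¹ • (V x)ᵀ
  have hGG : G * Gᴴ = cqMatrix fun x => (Ψᴴ * ((u x * u x) ⊗ₖ (1 : Matrix Q Q ℂ)) * Ψ)ᵀ := by
    simp only [G, cqMatrix_conjTranspose, cqMatrix_mul, ← hLL, transpose_mul]
    rfl
  have hBB : B * Bᴴ = (1 : Matrix X X ℂ) ⊗ₖ (Φᴴ * Φ)ᵀ := by
    rw [← cqMatrix_const, cqMatrix_conjTranspose, cqMatrix_mul]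
    simp only [transpose_mul]
    rfl
  have hWW : Wᴴ * W ≤ 1 := by
    have hs : (Real.sqrt c)⁻¹ * (Real.sqrt c)⁻¹ = c⁻¹ := by
      rw [← mul_inv, Real.mul_self_sqrt hc.le]
    rw [← cqMatrix_one, cqMatrix_conjTranspose, cqMatrix_mul]
    refine cqMatrix_le_cqMatrix fun x => ?_
    have h1 : ((Real.sqrt c)⁻¹ • (V x)ᵀ)ᴴ * (Real.sqrt c)⁻¹ • (V x)ᵀ =
        (c⁻¹ • (V x * (V x)ᴴ))ᵀ := by
      rw [conjTranspose_smul, star_trivial, Matrix.smul_mul, Matrix.mul_smul, smul_smul, hs, transpose_smul,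
        transpose_mul]
      rfl
    have h2 : c⁻¹ • (V x * (V x)ᴴ) ≤ 1 := by
      refine (smul_le_smul_of_nonneg_left (hVV x) (by positivity)).trans_eq ?_
      rw [smul_smul, inv_mul_cancel₀ hc.ne', one_smul]
    rw [h1, le_iff, ← transpose_one, ← transpose_sub]
    exact (le_iff.mp h2).transpose
  have htrGBW : (Gᴴ * B * W).trace.re = (Real.sqrt c)⁻¹ * p := by
    have h1 : Gᴴ * B * W = cqMatrix fun x => ((Real.sqrt c)⁻¹ • (V x * Φ * (L x)ᴴ))ᵀ := by
      simp only [G, B, W]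
      rw [cqMatrix_conjTranspose, cqMatrix_mul, cqMatrix_mul]
      refine congrArg cqMatrix (funext fun x => ?_)
      rw [Matrix.mul_smul, transpose_smul, transpose_mul _ (L x)ᴴ, transpose_mul (V x),
        Matrix.mul_assoc]
      rfl
    rw [h1, cqMatrix_trace, Complex.re_sum, ← htr, Finset.mul_sum]
    refine Finset.sum_congr rfl fun x _ => ?_
    rw [trace_transpose, trace_smul, Complex.smul_re, smul_eq_mul]
  have hη : IsDensityMatrix (p⁻¹ • (Φᴴ * Φ)ᵀ) := by
    have hP := (posSemidef_conjTranspose_mul_self Φ).transpose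
    refine ⟨hP.smul (by positivity), ?_⟩
    have h1 : (Φᴴ * Φ).trace = p := by
      refine Complex.ext ?_ ?_
      · rw [hΦΦ, trace_sum, Complex.re_sum, hp]
        rfl
      · rw [Complex.ofReal_im]
        exact ((Complex.nonneg_iff.mp (posSemidef_conjTranspose_mul_self Φ).trace_nonneg).2).symm
    rw [trace_smul, trace_transpose, h1, Complex.real_smul, ← Complex.ofReal_mul,
      inv_mul_cancel₀ hp0.ne', Complex.ofReal_one]
  have hkey : Real.sqrt (p / c) ≤
      (matPow (1 / 2) (Gᴴ * ((1 : Matrix X X ℂ) ⊗ₖ (p⁻¹ • (Φᴴ * Φ)ᵀ)) * G)).trace.re := by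
    have h1 : Gᴴ * ((1 : Matrix X X ℂ) ⊗ₖ (p⁻¹ • (Φᴴ * Φ)ᵀ)) * G =
        p⁻¹ • ((Gᴴ * B) * (Gᴴ * B)ᴴ) := by
      rw [kronecker_smul, ← hBB, Matrix.mul_smul, Matrix.smul_mul, conjTranspose_mul, conjTranspose_conjTranspose]
      simp only [Matrix.mul_assoc]
    have h2 := re_trace_mul_le_re_trace_sqrt (Gᴴ * B) W hWW
    rw [htrGBW] at h2
    rw [h1, matPow_smul (posSemidef_self_mul_conjTranspose _) (by positivity), trace_smul,
      Complex.smul_re, smul_eq_mul]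
    calc Real.sqrt (p / c) = p⁻¹ ^ (1 / 2 : ℝ) * ((Real.sqrt c)⁻¹ * p) := by
          rw [← Real.sqrt_eq_rpow, Real.sqrt_inv, Real.sqrt_div hp0.le]
          have h3 := Real.mul_self_sqrt hp0.le
          have h4 : 0 < Real.sqrt p := Real.sqrt_pos.mpr hp0
          have h5 : 0 < Real.sqrt c := Real.sqrt_pos.mpr hc
          field_simp
          rw [sq, h3]
      _ ≤ _ := mul_le_mul_of_nonneg_left h2 (by positivity)
  have hpos : 0 < Real.sqrt (p / c) := Real.sqrt_pos.mpr (by positivity)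
  refine le_trans ?_ (le_sSup ⟨_, hη, rfl⟩)
  rw [← hGG, sandRenyi_half (PosSemidef.one.kronecker hη.1) G (hpos.trans_le hkey),
    ← EReal.coe_neg, EReal.coe_le_coe_iff, neg_neg]
  calc Real.logb 2 (p / c) = 2 * Real.logb 2 (Real.sqrt (p / c)) := by
        rw [Real.sqrt_eq_rpow, Real.logb_rpow_eq_mul_logb_of_pos (by positivity)]
        ring
    _ ≤ _ := by
        gcongr
        norm_num

end MaxEntropy

end SandwichedRenyi

namespace SandwichedRenyi

section Channel

open Matrix

variable {S T R : Type*} [Fintype S] [Fintype T] [Fintype R] {Φ : Matrix S S ℂ →ₗ[ℂ] Matrix T T ℂ}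

lemma extendRight_posSemidef (hΦ : IsCompletelyPositive Φ) {A : Matrix (S × R) (S × R) ℂ}
    (hA : A.PosSemidef) : (extendRight Φ A).PosSemidef := by
  let e := Fintype.equivFin R
  have h := (hΦ _ _ (hA.submatrix (Prod.map id e.symm))).submatrix (Prod.map id e)
  have h1 : extendRight Φ A = (extendRight Φ (A.submatrix (Prod.map id e.symm)
      (Prod.map id e.symm))).submatrix (Prod.map id e) (Prod.map id e) := by
    ext p q
    simp [extendRight]
  rwa [h1]

lemma trace_extendRight (hΦ : IsTracePreserving Φ) (A : Matrix (S × R) (S × R) ℂ) :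
    (extendRight Φ A).trace = A.trace := by
  have h : ∀ r, ∑ t, extendRight Φ A (t, r) (t, r) = ∑ s, A (s, r) (s, r) :=
    fun r => hΦ fun s s' => A (s, r) (s', r)
  simp only [trace, diag, Fintype.sum_prod_type_right, h]

end Channel

section Overlap

open scoped MatrixOrder
open Matrix

variable {S : Type*} [Fintype S] [DecidableEq S]

open scoped Matrix.Norms.L2Operator in
lemma self_mul_conjTranspose_le_sq_norm (T : Matrix S S ℂ) :
    T * Tᴴ ≤ ‖toEuclideanCLM (𝕜 := ℂ) T‖ ^ 2 • (1 : Matrix S S ℂ) := by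
  have h := CStarAlgebra.mul_star_le_algebraMap_norm_sq (a := T)
  rwa [Algebra.algebraMap_eq_smul_one] at h

end Overlap

section Uncertainty

lemma sum_rotate {a b c : Type*} [Fintype a] [Fintype b] [Fintype c] (f : a → b → c → ℂ) :
    ∑ i, ∑ j, ∑ k, f i j k = ∑ k, ∑ i, ∑ j, f i j k :=
  (Finset.sum_congr rfl fun _ _ => Finset.sum_comm).trans Finset.sum_comm

open scoped MatrixOrder
open Matrix

variable {S M R K X Z : Type*} [Fintype S] [DecidableEq S] [Fintype M] [DecidableEq M]
  [Fintype R] [DecidableEq R] [Fintype K] [DecidableEq K]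
  [Fintype X] [DecidableEq X] [Fintype Z]

omit [DecidableEq S] [Fintype M] [DecidableEq M] [DecidableEq R] in
lemma sandwich_kronecker_apply (G : Matrix ((S × M) × R) K ℂ) (A : Matrix S S ℂ)
    (B : Matrix R R ℂ) (Ψ : Matrix (S × (R × K)) M ℂ)
    (hΨ : ∀ s r k m, Ψ (s, (r, k)) m = G ((s, m), r) k) (m m' : M) :
    (Ψᴴ * (A ⊗ₖ (B ⊗ₖ (1 : Matrix K K ℂ))) * Ψ) m' m =
      ∑ s, ∑ s', ∑ r, ∑ r', A s s' * B r r' * (G * Gᴴ) ((s', m), r') ((s, m'), r) := by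
  simp only [mul_apply, Fintype.sum_prod_type, kroneckerMap_apply, conjTranspose_apply, hΨ,
    one_apply, mul_ite, mul_one, mul_zero, Finset.sum_ite_eq', Finset.mem_univ,
    if_true, Finset.sum_mul, Finset.mul_sum]
  calc _ = ∑ s, ∑ s', ∑ r', ∑ k, ∑ r,
        star (G ((s, m'), r) k) * (A s s' * B r r') * G ((s', m), r') k :=
        (Finset.sum_congr rfl fun _ _ => sum_rotate _).trans Finset.sum_comm
    _ = _ := Finset.sum_congr rfl fun s _ => Finset.sum_congr rfl fun s' _ =>
        (sum_rotate _).trans <| Finset.sum_congr rfl fun r _ => Finset.sum_congr rfl fun r' _ =>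
          Finset.sum_congr rfl fun k _ => by ring

lemma logb_le_condRenyi_half_of_purification (G : Matrix ((S × M) × R) K ℂ) {E : X → Matrix S S ℂ} (hE : IsPOVM E) {F : Z → Matrix S S ℂ}
    (hF : ∀ z, (F z).PosSemidef) {c : ℝ} (hc : 0 < c)
    (hEF : ∀ x z, (matPow (1 / 2) (E x) * matPow (1 / 2) (F z)) *
      (matPow (1 / 2) (E x) * matPow (1 / 2) (F z))ᴴ ≤ c • 1)
    {N : Z → Matrix R R ℂ} (hN : ∀ z, (N z).PosSemidef) (hN1 : ∑ z, N z ≤ 1) {p : ℝ}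
    (hp : p = ∑ z, ((of fun r r' => ∑ s, ∑ s', ∑ m, F z s s' * (G * Gᴴ) ((s', m), r) ((s, m), r')) *
      N z).trace.re) (hp0 : 0 < p) :
    ((Real.logb 2 (p / c) : ℝ) : EReal) ≤ condRenyi (1 / 2) (cqMatrix fun x =>
      of fun m m' => ∑ s, ∑ s', ∑ r, E x s s' * (G * Gᴴ) ((s', m), r) ((s, m'), r)) := by
  let Ψ : Matrix (S × (R × K)) M ℂ := of fun a m => G ((a.1, m), a.2.1) a.2.2
  have hΨ := fun A B => sandwich_kronecker_apply G A B Ψ fun _ _ _ _ => rfl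
  have h1 : ∀ z, ((N z) ⊗ₖ (1 : Matrix K K ℂ)).PosSemidef :=
    fun z => (hN z).kronecker PosSemidef.one
  have hw : ∑ z, matPow (1 / 2) (N z ⊗ₖ (1 : Matrix K K ℂ)) *
      matPow (1 / 2) (N z ⊗ₖ (1 : Matrix K K ℂ)) ≤ 1 := by
    simp only [matPow_half_mul_self (h1 _)]
    rw [← sum_kronecker, ← one_kronecker_one]
    exact kronecker_le_kronecker_right hN1 PosSemidef.one
  have hp' : p = ∑ z, (Ψᴴ * ((matPow (1 / 2) (F z) * matPow (1 / 2) (F z)) ⊗ₖ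
      (matPow (1 / 2) (N z ⊗ₖ (1 : Matrix K K ℂ)) *
        matPow (1 / 2) (N z ⊗ₖ (1 : Matrix K K ℂ)))) * Ψ).trace.re := by
    simp only [matPow_half_mul_self (h1 _), matPow_half_mul_self (hF _)]
    rw [hp]
    refine Finset.sum_congr rfl fun z _ => congrArg Complex.re ?_
    simp only [trace, diag, hΨ]
    simp only [mul_apply (N := N z), of_apply, Finset.sum_mul]
    symm
    calc _ = ∑ r', ∑ r, ∑ m, ∑ s, ∑ s', F z s s' * N z r r' *
          (G * Gᴴ) ((s', m), r') ((s, m), r) :=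
          ((Finset.sum_congr rfl fun _ _ => sum_rotate _).trans Finset.sum_comm).trans <|
            (Finset.sum_congr rfl fun _ _ => (Finset.sum_congr rfl fun _ _ =>
              sum_rotate _).trans Finset.sum_comm).trans Finset.sum_comm
      _ = _ := Finset.sum_congr rfl fun r' _ => Finset.sum_congr rfl fun r _ =>
          (sum_rotate _).symm.trans <| Finset.sum_congr rfl fun s _ => Finset.sum_congr rfl
            fun s' _ => Finset.sum_congr rfl fun m _ => by ring
  have hu : ∑ x, matPow (1 / 2) (E x) * matPow (1 / 2) (E x) = 1 := by
    simp only [matPow_half_mul_self (hE.1 _), hE.2]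
  have h2 := logb_le_condRenyi_half Ψ (fun x => (matPow_posSemidef (hE.1 x) (1 / 2)).1)
    (fun z => (matPow_posSemidef (hF z) (1 / 2)).1)
    (fun z => (matPow_posSemidef (h1 z) (1 / 2)).1) hu hw hc hEF hp' hp0
  refine h2.trans_eq ?_
  congr 2
  ext x m m'
  rw [transpose_apply, matPow_half_mul_self (hE.1 _), ← one_kronecker_one, hΨ]
  simp [one_apply]

lemma logb_le_condRenyi_half_of_povm {ρ : Matrix ((S × M) × R) ((S × M) × R) ℂ}
    (hρ : ρ.PosSemidef) {E : X → Matrix S S ℂ} (hE : IsPOVM E) {F : Z → Matrix S S ℂ}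
    (hF : ∀ z, (F z).PosSemidef) {c : ℝ} (hc : 0 < c)
    (hEF : ∀ x z, (matPow (1 / 2) (E x) * matPow (1 / 2) (F z)) *
      (matPow (1 / 2) (E x) * matPow (1 / 2) (F z))ᴴ ≤ c • 1)
    {N : Z → Matrix R R ℂ} (hN : ∀ z, (N z).PosSemidef) (hN1 : ∑ z, N z ≤ 1) {p : ℝ}
    (hp : p = ∑ z, ((of fun r r' => ∑ s, ∑ s', ∑ m, F z s s' * ρ ((s', m), r) ((s, m), r')) *
      N z).trace.re) (hp0 : 0 < p) :
    ((Real.logb 2 (p / c) : ℝ) : EReal) ≤ condRenyi (1 / 2) (cqMatrix fun x =>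
      of fun m m' => ∑ s, ∑ s', ∑ r, E x s s' * ρ ((s', m), r) ((s, m'), r)) := by
  obtain ⟨G, rfl⟩ := exists_eq_mul_conjTranspose hρ
  exact logb_le_condRenyi_half_of_purification G hE hF hc hEF hN hN1 hp hp0

end Uncertainty

end SandwichedRenyi

namespace SandwichedRenyi

section Steering

open scoped MatrixOrder
open Matrix

variable {S M R Z : Type*} [Fintype S] [Fintype M] [Fintype R]

/-- The unnormalised conditional operator `tr_S[(A ⊗ 1) ω]`. -/
def steer (A : Matrix S S ℂ) (ω : Matrix (S × R) (S × R) ℂ) : Matrix R R ℂ :=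
  of fun r r' => ∑ s, ∑ s', A s s' * ω (s', r) (s, r')

lemma trace_steer_mul (A : Matrix S S ℂ) (ω : Matrix (S × R) (S × R) ℂ) (N : Matrix R R ℂ) :
    (steer A ω * N).trace = ((A ⊗ₖ N) * ω).trace := by
  simp only [trace, diag, mul_apply, steer, of_apply, Fintype.sum_prod_type, Finset.sum_mul,
    kroneckerMap_apply]
  calc _ = ∑ s, ∑ r, ∑ r', ∑ s', A s s' * ω (s', r) (s, r') * N r' r := sum_rotate _
    _ = _ := Finset.sum_congr rfl fun s _ => Finset.sum_comm.trans <|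
      Finset.sum_congr rfl fun r' _ => Finset.sum_comm.trans <|
        Finset.sum_congr rfl fun s' _ => Finset.sum_congr rfl fun r _ => by ring

omit [Fintype R] in
lemma steer_isHermitian {A : Matrix S S ℂ} (hA : A.IsHermitian) {ω : Matrix (S × R) (S × R) ℂ}
    (hω : ω.IsHermitian) : (steer A ω).IsHermitian := by
  ext r r'
  simp only [conjTranspose_apply, steer, of_apply, star_sum, star_mul']
  rw [Finset.sum_comm]
  refine Finset.sum_congr rfl fun s _ => Finset.sum_congr rfl fun s' _ => ?_
  rw [hA.apply, hω.apply]

lemma steer_posSemidef [DecidableEq S] [DecidableEq R] {A : Matrix S S ℂ} (hA : A.PosSemidef)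
    {ω : Matrix (S × R) (S × R) ℂ} (hω : ω.PosSemidef) : (steer A ω).PosSemidef :=
  posSemidef_of_forall_re_trace_nonneg (steer_isHermitian hA.1 hω.1) fun N hN => by
    rw [trace_steer_mul]
    exact re_trace_mul_nonneg (hA.kronecker hN) hω

lemma sum_trace_steer [DecidableEq S] [DecidableEq R] [Fintype Z] {F : Z → Matrix S S ℂ}
    (hF : ∑ z, F z = 1) (ω : Matrix (S × R) (S × R) ℂ) :
    ∑ z, (steer (F z) ω).trace = ω.trace := by
  have h : ∀ z, (steer (F z) ω).trace = ((F z ⊗ₖ (1 : Matrix R R ℂ)) * ω).trace := fun z => by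
    rw [← trace_steer_mul, Matrix.mul_one]
  simp only [h]
  rw [← trace_sum, ← Matrix.sum_mul, ← sum_kronecker, hF, one_kronecker_one, Matrix.one_mul]

/-- The partial trace over the middle factor. -/
def traceMiddle (ω : Matrix ((S × M) × R) ((S × M) × R) ℂ) : Matrix (S × R) (S × R) ℂ :=
  ∑ m, ω.submatrix (fun a => ((a.1, m), a.2)) fun a => ((a.1, m), a.2)

omit [Fintype S] [Fintype R] in
lemma traceMiddle_posSemidef {ω : Matrix ((S × M) × R) ((S × M) × R) ℂ} (hω : ω.PosSemidef) :
    (traceMiddle ω).PosSemidef :=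
  posSemidef_sum _ fun _ _ => hω.submatrix _

lemma trace_traceMiddle (ω : Matrix ((S × M) × R) ((S × M) × R) ℂ) :
    (traceMiddle ω).trace = ω.trace := by
  rw [traceMiddle, trace_sum]
  simp only [trace, diag, submatrix_apply, Fintype.sum_prod_type]
  exact Finset.sum_comm

omit [Fintype R] in
lemma steer_traceMiddle (A : Matrix S S ℂ) (ω : Matrix ((S × M) × R) ((S × M) × R) ℂ) :
    steer A (traceMiddle ω) =
      of fun r r' => ∑ s, ∑ s', ∑ m, A s s' * ω ((s', m), r) ((s, m), r') := by
  ext r r'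
  simp only [steer, traceMiddle, of_apply, Matrix.sum_apply, submatrix_apply, Finset.mul_sum]

end Steering

section Duality

open scoped MatrixOrder
open Matrix

variable {R Z : Type*} [Fintype R] [DecidableEq R] [Nonempty R] [Fintype Z] [DecidableEq Z]

lemma neg_logb_le_sandRenyi_add_condRenyi {α : ℝ≥0∞} (hα : 1 / 2 ≤ α)
    {ρ τ : Matrix (Z × R) (Z × R) ℂ} (hρ : IsDensityMatrix ρ) (hτ : τ.PosSemidef)
    {σ : Matrix R R ℂ} (hσ : IsDensityMatrix σ) {μ : ℝ} (hμ : 0 < μ)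
    (h : τ ≤ μ • ((1 : Matrix Z Z ℂ) ⊗ₖ σ)) :
    ((-Real.logb 2 μ : ℝ) : EReal) ≤ sandRenyi α ρ τ + condRenyi α ρ := by
  have hlim : Filter.Tendsto (fun δ : ℝ => ((-Real.logb 2 (μ + δ * Fintype.card R) : ℝ) : EReal))
      (nhdsWithin 0 (Set.Ioi 0)) (nhds ((-Real.logb 2 μ : ℝ) : EReal)) := by
    have h1 : ContinuousAt (fun δ : ℝ => -Real.logb 2 (μ + δ * Fintype.card R)) 0 :=
      (ContinuousAt.logb (by fun_prop) (by simpa using hμ.ne')).neg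
    have h2 := (continuous_coe_real_ereal.continuousAt.comp h1).tendsto
    simp only [Function.comp_def, zero_mul, add_zero] at h2
    exact h2.mono_left nhdsWithin_le_nhds
  refine le_of_tendsto hlim (eventually_nhdsWithin_of_forall fun δ (hδ : 0 < δ) => ?_)
  have hμ' : 0 < μ + δ * Fintype.card R := by positivity
  have hηp : ((μ + δ * Fintype.card R)⁻¹ • (μ • σ + δ • (1 : Matrix R R ℂ))).PosDef :=
    (PosDef.posSemidef_add (hσ.1.smul hμ.le) (PosDef.one.smul hδ)).smul (by positivity)
  have hη : IsDensityMatrix ((μ + δ * Fintype.card R)⁻¹ • (μ • σ + δ • (1 : Matrix R R ℂ))) := by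
    refine ⟨hηp.posSemidef, ?_⟩
    rw [trace_smul, trace_add, trace_smul, trace_smul, hσ.2, trace_one]
    simp only [Complex.real_smul, mul_one]
    rw [← Complex.ofReal_natCast, ← Complex.ofReal_mul, ← Complex.ofReal_add,
      ← Complex.ofReal_mul, inv_mul_cancel₀ hμ'.ne', Complex.ofReal_one]
  have hle : τ + δ • 1 ≤ (μ + δ * Fintype.card R) • ((1 : Matrix Z Z ℂ) ⊗ₖ
      ((μ + δ * Fintype.card R)⁻¹ • (μ • σ + δ • (1 : Matrix R R ℂ)))) := by
    rw [kronecker_smul, smul_smul, mul_inv_cancel₀ hμ'.ne', one_smul, kronecker_add,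
      kronecker_smul, kronecker_smul, one_kronecker_one]
    exact add_le_add_left h _
  obtain ⟨r, hr, hr'⟩ := sandRenyi_antitone hα hρ hτ (PosDef.one.kronecker hηp) hμ' hδ hle
  have h1 : ((-r : ℝ) : EReal) ≤ condRenyi α ρ := by
    rw [EReal.coe_neg, ← hr]
    exact le_sSup ⟨_, hη, rfl⟩
  refine le_trans (le_of_eq ?_) (add_le_add hr' h1)
  rw [← EReal.coe_add]
  congr 1
  ring

lemma sandRenyi_add_condRenyi_ne_bot {α : ℝ≥0∞} (hα : 1 / 2 ≤ α)
    {ρ τ : Matrix (Z × R) (Z × R) ℂ} (hρ : IsDensityMatrix ρ) (hτ : τ.PosSemidef) :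
    sandRenyi α ρ τ + condRenyi α ρ ≠ ⊥ := by
  have hne : Nonempty (Z × R) := by
    by_contra hn
    rw [not_nonempty_iff] at hn
    have := hρ.2
    simp [trace] at this
  obtain ⟨l, -, hl, hle, -⟩ := exists_isDensityMatrix_top_eigenvalue hτ
  have hR : (0 : ℝ) < Fintype.card R := by positivity
  have h1 : IsDensityMatrix ((Fintype.card R : ℝ)⁻¹ • (1 : Matrix R R ℂ)) := by
    refine ⟨PosSemidef.one.smul (by positivity), ?_⟩
    rw [trace_smul, trace_one, Complex.real_smul, ← Complex.ofReal_natCast, ← Complex.ofReal_mul,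
      inv_mul_cancel₀ hR.ne', Complex.ofReal_one]
  have h2 : τ ≤ ((l + 1) * Fintype.card R) •
      ((1 : Matrix Z Z ℂ) ⊗ₖ ((Fintype.card R : ℝ)⁻¹ • (1 : Matrix R R ℂ))) := by
    rw [kronecker_smul, smul_smul, mul_assoc, mul_inv_cancel₀ hR.ne', mul_one, one_kronecker_one,
      add_smul, one_smul]
    exact hle.trans (le_add_of_nonneg_right PosSemidef.one.nonneg)
  have h3 := neg_logb_le_sandRenyi_add_condRenyi hα hρ hτ h1 (by positivity) h2
  exact ((EReal.bot_lt_coe _).trans_le h3).ne'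

end Duality

section Overlap

open Matrix

variable {S X Z : Type*} [Fintype S] [DecidableEq S]

lemma overlap_pos [Nonempty S] [Fintype X] [Fintype Z] {E : X → Matrix S S ℂ} (hE : IsPOVM E)
    {F : Z → Matrix S S ℂ} (hF : IsPOVM F) {c : ℝ}
    (h : ∀ x z, ‖toEuclideanCLM (𝕜 := ℂ) (matPow (1 / 2) (E x) * matPow (1 / 2) (F z))‖ ^ 2 ≤ c) :
    0 < c := by
  by_contra! hc
  have h0 : ∀ x z, matPow (1 / 2) (E x) * matPow (1 / 2) (F z) = 0 := fun x z => by
    have h1 := pow_eq_zero_iff two_ne_zero |>.mp (le_antisymm ((h x z).trans hc) (sq_nonneg _))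
    exact (map_eq_zero_iff _ toEuclideanCLM.injective).mp (norm_eq_zero.mp h1)
  have h1 : ∀ x z, E x * F z = 0 := fun x z => by
    rw [← matPow_half_mul_self (hE.1 x), ← matPow_half_mul_self (hF.1 z), Matrix.mul_assoc,
      ← Matrix.mul_assoc (matPow (1 / 2) (E x)) (matPow (1 / 2) (F z)), h0, Matrix.zero_mul,
      Matrix.mul_zero]
  have h2 : (1 : Matrix S S ℂ) = 0 := by
    rw [← Matrix.mul_one (1 : Matrix S S ℂ)]
    nth_rewrite 1 [← hE.2]
    rw [← hF.2]
    simp only [Matrix.sum_mul, Matrix.mul_sum, h1, Finset.sum_const_zero]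
  exact one_ne_zero h2

end Overlap

end SandwichedRenyi

/-- **State-dependent entropic measurement-disturbance relation** (Theorem 1 of
Coles–Furrer).  For any bipartite state `ρ_{SR}`, POVMs `X`, `Z` on `S`, and CPTP map
`ℰ : S → S ⊗ M`,
`D_α(ρ_{ZR} ‖ ρ^ℰ_{ZR}) + H_max(X|M)_{ρ^ℰ} + H_α(Z|R)_ρ ≥ log₂(1/c)`
for all `α ∈ [1/2, ∞]`, where `c = max_{x,z} ‖√X_x √Z_z‖_∞²`. -/
theorem measurement_disturbance_relation
    {S M R XI ZI : Type*}
    [Fintype S] [DecidableEq S] [Fintype M] [DecidableEq M]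
    [Fintype R] [DecidableEq R]
    [Fintype XI] [DecidableEq XI] [Nonempty XI]
    [Fintype ZI] [DecidableEq ZI] [Nonempty ZI]
    (ρSR : Matrix (S × R) (S × R) ℂ) (hρ : IsDensityMatrix ρSR)
    (Xp : XI → Matrix S S ℂ) (hX : IsPOVM Xp)
    (Zp : ZI → Matrix S S ℂ) (hZ : IsPOVM Zp)
    (ℰ : Matrix S S ℂ →ₗ[ℂ] Matrix (S × M) (S × M) ℂ)
    (hCP : IsCompletelyPositive ℰ) (hTP : IsTracePreserving ℰ)
    -- the post-interaction state ρ^ℰ_{SMR} = (ℰ ⊗ id_R)(ρ_{SR})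
    (ρE : Matrix ((S × M) × R) ((S × M) × R) ℂ) (hρE : ρE = extendRight ℰ ρSR)
    -- the classical-quantum state ρ_{ZR} = Σ_z |z⟩⟨z| ⊗ tr_S[(Z_z ⊗ 1_R) ρ_{SR}]
    (ρZR : Matrix (ZI × R) (ZI × R) ℂ)
    (hZR : ρZR = fun p q => if p.1 = q.1 then
        ∑ s : S, ∑ s' : S, Zp p.1 s s' * ρSR (s', p.2) (s, q.2) else 0)
    -- the classical-quantum state ρ^ℰ_{ZR} = Σ_z |z⟩⟨z| ⊗ tr_{SM}[(Z_z ⊗ 1_{MR}) ρ^ℰ_{SMR}]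
    (ρZRE : Matrix (ZI × R) (ZI × R) ℂ)
    (hZRE : ρZRE = fun p q => if p.1 = q.1 then
        ∑ s : S, ∑ s' : S, ∑ m : M, Zp p.1 s s' * ρE ((s', m), p.2) ((s, m), q.2) else 0)
    -- the classical-quantum state ρ^ℰ_{XM} = Σ_x |x⟩⟨x| ⊗ tr_{SR}[(X_x ⊗ 1_{MR}) ρ^ℰ_{SMR}]
    (ρXME : Matrix (XI × M) (XI × M) ℂ)
    (hXME : ρXME = fun p q => if p.1 = q.1 then
        ∑ s : S, ∑ s' : S, ∑ r : R, Xp p.1 s s' * ρE ((s', p.2), r) ((s, q.2), r) else 0)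
    -- the overlap c = max_{x,z} ‖√X_x √Z_z‖_∞²
    (c : ℝ)
    (hc : c = ⨆ x : XI, ⨆ z : ZI,
        ‖Matrix.toEuclideanCLM (𝕜 := ℂ) (matPow (1/2) (Xp x) * matPow (1/2) (Zp z))‖ ^ 2)
    (α : ℝ≥0∞) (hα : 1 / 2 ≤ α) :
    sandRenyi α ρZR ρZRE + condRenyi (1/2 : ℝ≥0∞) ρXME + condRenyi α ρZR
      ≥ ((Real.logb 2 (1 / c) : ℝ) : EReal) := by
  open SandwichedRenyi Matrix MatrixOrder in
  have hne : Nonempty (S × R) := by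
    by_contra hn
    rw [not_nonempty_iff] at hn
    have := hρ.2
    simp [trace] at this
  obtain ⟨hS, hR⟩ := nonempty_prod.mp hne
  have hE : ρE.PosSemidef := hρE ▸ extendRight_posSemidef hCP hρ.1
  have hE1 : ρE.trace = 1 := by rw [hρE, trace_extendRight hTP, hρ.2]
  have hcle : ∀ x z, ‖toEuclideanCLM (𝕜 := ℂ)
      (matPow (1 / 2) (Xp x) * matPow (1 / 2) (Zp z))‖ ^ 2 ≤ c := fun x z => by
    rw [hc]
    exact (le_ciSup (Set.finite_range fun z => ‖toEuclideanCLM (𝕜 := ℂ)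
      (matPow (1 / 2) (Xp x) * matPow (1 / 2) (Zp z))‖ ^ 2).bddAbove z).trans
        (le_ciSup (f := fun x => ⨆ z, ‖toEuclideanCLM (𝕜 := ℂ)
          (matPow (1 / 2) (Xp x) * matPow (1 / 2) (Zp z))‖ ^ 2) (Set.finite_range _).bddAbove x)
  have hc0 : 0 < c := overlap_pos hX hZ hcle
  have hXZ : ∀ x z, (matPow (1 / 2) (Xp x) * matPow (1 / 2) (Zp z)) *
      (matPow (1 / 2) (Xp x) * matPow (1 / 2) (Zp z))ᴴ ≤ c • 1 := fun x z =>
    (self_mul_conjTranspose_le_sq_norm _).trans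
      (smul_le_smul_of_nonneg_right (hcle x z) PosSemidef.one.nonneg)
  have hZR' : ρZR = cqMatrix fun z => steer (Zp z) ρSR := hZR
  have hZRE' : ρZRE = cqMatrix fun z => steer (Zp z) (traceMiddle ρE) := by
    simp only [steer_traceMiddle]
    exact hZRE
  have hXME' : ρXME = cqMatrix fun x =>
      of fun m m' => ∑ s, ∑ s', ∑ r, Xp x s s' * ρE ((s', m), r) ((s, m'), r) := hXME
  have hP : ∀ z, (steer (Zp z) (traceMiddle ρE)).PosSemidef :=
    fun z => steer_posSemidef (hZ.1 z) (traceMiddle_posSemidef hE)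
  have hρ' : IsDensityMatrix ρZR := by
    rw [hZR']
    exact ⟨cqMatrix_posSemidef fun z => steer_posSemidef (hZ.1 z) hρ.1, by
      rw [cqMatrix_trace, sum_trace_steer hZ.2, hρ.2]⟩
  have hτ : ρZRE.PosSemidef := hZRE' ▸ cqMatrix_posSemidef hP
  have hbound : ∀ N : ZI → Matrix R R ℂ, (∀ z, (N z).PosSemidef) → ∑ z, N z ≤ 1 →
      0 < ∑ z, (steer (Zp z) (traceMiddle ρE) * N z).trace.re →
      ((Real.logb 2 ((∑ z, (steer (Zp z) (traceMiddle ρE) * N z).trace.re) / c) : ℝ) : EReal) ≤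
        condRenyi (1 / 2) ρXME := fun N hN hN1 hpos => by
    rw [hXME']
    refine logb_le_condRenyi_half_of_povm hE hX hZ.1 hc0 hXZ hN hN1 ?_ hpos
    simp only [steer_traceMiddle]
  have hne_bot := sandRenyi_add_condRenyi_ne_bot hα hρ' hτ
  have hmax_ne_bot : condRenyi (1 / 2) ρXME ≠ ⊥ := by
    have hsum : ∑ z, (steer (Zp z) (traceMiddle ρE) *
        ((Fintype.card ZI : ℝ)⁻¹ • (1 : Matrix R R ℂ))).trace.re = (Fintype.card ZI : ℝ)⁻¹ := by
      simp only [Matrix.mul_smul, Matrix.mul_one, trace_smul, Complex.smul_re, smul_eq_mul]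
      rw [← Finset.mul_sum, ← Complex.re_sum, sum_trace_steer hZ.2, trace_traceMiddle, hE1,
        Complex.one_re, mul_one]
    refine ((EReal.bot_lt_coe _).trans_le (hbound (fun _ => (Fintype.card ZI : ℝ)⁻¹ • 1)
      (fun _ => PosSemidef.one.smul (by positivity)) ?_ (hsum.symm ▸ by positivity))).ne'
    rw [Finset.sum_const, Finset.card_univ, ← Nat.cast_smul_eq_nsmul ℝ, smul_smul,
      mul_inv_cancel₀ (Nat.cast_ne_zero.mpr Fintype.card_ne_zero), one_smul]
  rw [ge_iff_le, add_right_comm]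
  obtain hh | ⟨h, hh⟩ : condRenyi (1 / 2) ρXME = ⊤ ∨ ∃ h : ℝ, condRenyi (1 / 2) ρXME = h := by
    induction hx : condRenyi (1 / 2) ρXME with
    | bot => exact absurd hx hmax_ne_bot
    | coe h => exact Or.inr ⟨h, rfl⟩
    | top => exact Or.inl rfl
  · rw [hh, EReal.add_top_of_ne_bot hne_bot]
    exact le_top
  have hμ : 0 < c * 2 ^ h := by positivity
  obtain ⟨σ, hσ, hPσ⟩ := exists_isDensityMatrix_le_smul (fun z => (hP z).1) (μ := c * 2 ^ h)
    fun N hN hN1 => by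
      by_cases hpos : 0 < ∑ z, (steer (Zp z) (traceMiddle ρE) * N z).trace.re
      · have h1 := hbound N hN hN1 hpos
        rw [hh, EReal.coe_le_coe_iff, Real.logb_le_iff_le_rpow one_lt_two (by positivity),
          div_le_iff₀ hc0] at h1
        rwa [mul_comm]
      · exact (not_lt.mp hpos).trans hμ.le
  have hle : ρZRE ≤ (c * 2 ^ h) • ((1 : Matrix ZI ZI ℂ) ⊗ₖ σ) := by
    rw [hZRE', ← kronecker_smul, ← cqMatrix_const]
    exact cqMatrix_le_cqMatrix hPσ
  refine le_trans (le_of_eq ?_) (add_le_add_left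
    (neg_logb_le_sandRenyi_add_condRenyi hα hρ' hτ hσ hμ hle) _)
  rw [hh, ← EReal.coe_add, Real.logb_mul hc0.ne' (by positivity), Real.logb_rpow (by norm_num)
    (by norm_num), one_div, Real.logb_inv]
  congr 1
  ring
end

section
/- Let ρ_{AB} and σ_{AB} be density matrices on a finite-dimensional bipartite Hilbert space A⊗B. Then for every α ∈ [1/2, ∞], D_α(ρ_{AB} ∥ σ_{AB}) ≥ H_min(A|B)_σ − H_α(A|B)_ρ. -/
open scoped Kronecker ComplexOrder ENNReal
open scoped Classical

/-- Antitonicity of the inverse, with generalized inverses compressed to a common support. -/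
lemma posSemidef_compress_inv_sub {n : Type*} [Fintype n] {S T S' T' N : Matrix n n ℂ}
    (hS : S.PosSemidef) (hTS : (T - S).PosSemidef)
    (hS' : S'.IsHermitian) (hT' : T'.IsHermitian)
    (hSN : S * S' * N.conjTranspose = N.conjTranspose)
    (hTN : T * T' * N.conjTranspose = N.conjTranspose) :
    (N * S' * N.conjTranspose - N * T' * N.conjTranspose).PosSemidef := by
  have hNS : N * S' * S = N := by
    simpa [Matrix.conjTranspose_mul, hS'.eq, hS.1.eq, Matrix.mul_assoc] using
      congrArg Matrix.conjTranspose hSN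
  have h := (hS.conjTranspose_mul_mul_same ((S' - T') * N.conjTranspose)).add
    (hTS.conjTranspose_mul_mul_same (T' * N.conjTranspose))
  convert h using 1
  simp only [Matrix.conjTranspose_mul, Matrix.conjTranspose_conjTranspose, Matrix.conjTranspose_sub,
    hS'.eq, hT'.eq]
  have e1 : N * T' * T * (T' * N.conjTranspose) = N * T' * N.conjTranspose := by
    rw [Matrix.mul_assoc (N * T'), ← Matrix.mul_assoc T, hTN]
  have e2 : N * S' * S * (S' * N.conjTranspose) = N * S' * N.conjTranspose := by
    rw [hNS, Matrix.mul_assoc]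
  have e3 : N * S' * S * (T' * N.conjTranspose) = N * T' * N.conjTranspose := by
    rw [hNS, Matrix.mul_assoc]
  have e4 : N * T' * S * (S' * N.conjTranspose) = N * T' * N.conjTranspose := by
    rw [Matrix.mul_assoc (N * T'), ← Matrix.mul_assoc S, hSN]
  simp only [Matrix.mul_sub, Matrix.sub_mul, e1, e2, e3, e4]
  abel

section FunctionalCalculus

variable {n : Type*} [Fintype n] [DecidableEq n] {A B : Matrix n n ℂ}

lemma matFun_eq_cfc (hA : A.IsHermitian) (f : ℝ → ℝ) : matFun f A = cfc f A := by
  rw [hA.cfc_eq, matFun, dif_pos hA, Matrix.IsHermitian.cfc, Unitary.conjStarAlgAut_apply]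
  rfl

lemma isHermitian_matFun (f : ℝ → ℝ) (A : Matrix n n ℂ) : (matFun f A).IsHermitian := by
  by_cases hA : A.IsHermitian
  · rw [matFun_eq_cfc hA]
    exact cfc_predicate (p := IsSelfAdjoint) f A
  · simp [matFun, hA]

lemma isHermitian_matPow (p : ℝ) (A : Matrix n n ℂ) : (matPow p A).IsHermitian :=
  isHermitian_matFun _ A

lemma matFun_mul (hA : A.IsHermitian) (f g : ℝ → ℝ) :
    matFun f A * matFun g A = matFun (fun x => f x * g x) A := by
  have : ∀ h : ℝ → ℝ, ContinuousOn h (spectrum ℝ A) := fun h =>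
    (Matrix.finite_real_spectrum (A := A)).continuousOn h
  rw [matFun_eq_cfc hA, matFun_eq_cfc hA, matFun_eq_cfc hA, ← cfc_mul f g A (this _) (this _)]

lemma matFun_congr (hA : A.IsHermitian) {f g : ℝ → ℝ}
    (h : ∀ i, f (hA.eigenvalues i) = g (hA.eigenvalues i)) :
    matFun f A = matFun g A := by
  simp only [matFun, dif_pos hA, h]

lemma matFun_id (hA : A.IsHermitian) : matFun (fun x => x) A = A := by
  rw [matFun_eq_cfc hA]
  exact cfc_id' ℝ A

lemma matFun_const_smul (hA : A.IsHermitian) (c : ℝ) (f : ℝ → ℝ) :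
    matFun (fun x => c * f x) A = c • matFun f A := by
  rw [matFun_eq_cfc hA, matFun_eq_cfc hA]
  exact cfc_const_mul c f A ((Matrix.finite_real_spectrum (A := A)).continuousOn f)

lemma matFun_smul (hA : A.IsHermitian) (c : ℝ) (f : ℝ → ℝ) :
    matFun f (c • A) = matFun (fun x => f (c * x)) A := by
  have hc : (c • A).IsHermitian := (IsSelfAdjoint.all c).smul hA
  rw [matFun_eq_cfc hc, matFun_eq_cfc hA]
  exact (cfc_comp_const_mul c f A
    (((Matrix.finite_real_spectrum (A := A)).image _).continuousOn f)).symm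

lemma matPow_smul (hA : A.PosSemidef) {c : ℝ} (hc : 0 < c) (p : ℝ) :
    matPow p (c • A) = c ^ p • matPow p A := by
  rw [matPow, matFun_smul hA.1, matPow, ← matFun_const_smul hA.1]
  refine matFun_congr hA.1 fun i => ?_
  have h0 := hA.eigenvalues_nonneg i
  simp only [mul_pos_iff_of_pos_left hc, mul_ite, mul_zero]
  split_ifs with h
  · exact Real.mul_rpow hc.le h0
  · rfl

lemma trace_mul_matFun (hA : A.IsHermitian) (f : ℝ → ℝ) (ρ : Matrix n n ℂ) :
    (ρ * matFun f A).trace.re = ∑ i, f (hA.eigenvalues i) *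
      ((star (hA.eigenvectorUnitary : Matrix n n ℂ) * ρ * hA.eigenvectorUnitary) i i).re := by
  rw [matFun, dif_pos hA, ← Matrix.mul_assoc, Matrix.trace_mul_comm, ← Matrix.mul_assoc,
    ← Matrix.mul_assoc]
  simp [Matrix.trace, mul_comm]

lemma trace_matFun (hA : A.IsHermitian) (f : ℝ → ℝ) :
    (matFun f A).trace.re = ∑ i, f (hA.eigenvalues i) := by
  rw [matFun, dif_pos hA, Matrix.trace_mul_cycle]
  simp [Matrix.trace]

open scoped Matrix.Norms.L2Operator MatrixOrder in
lemma matPow_mono (hA : A.PosSemidef) (hB : B.PosSemidef) (hAB : (B - A).PosSemidef) {p : ℝ}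
    (hp0 : 0 < p) (hp1 : p ≤ 1) : (matPow p B - matPow p A).PosSemidef := by
  have key : ∀ C : Matrix n n ℂ, C.PosSemidef → matPow p C = C ^ p := by
    intro C hC
    rw [CFC.rpow_eq_cfc_real (Matrix.nonneg_iff_posSemidef.2 hC), ← matFun_eq_cfc hC.1, matPow]
    refine matFun_congr hC.1 fun i => ?_
    have h0 := hC.eigenvalues_nonneg i
    split_ifs with h
    · rfl
    · rw [le_antisymm (not_lt.1 h) h0, Real.zero_rpow hp0.ne']
  rw [key A hA, key B hB, ← Matrix.le_iff]
  exact CFC.monotone_rpow ⟨hp0.le, hp1⟩ (Matrix.le_iff.2 hAB)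

lemma trace_matFun_mul_conjTranspose_comm (f : ℝ → ℝ) (M : Matrix n n ℂ) :
    (matFun f (M * M.conjTranspose)).trace.re = (matFun f (M.conjTranspose * M)).trace.re := by
  have hP := Matrix.isHermitian_mul_conjTranspose_self M
  have hQ := Matrix.isHermitian_conjTranspose_mul_self M
  have h : ∀ {C : Matrix n n ℂ} (hC : C.IsHermitian), (matFun f C).trace.re =
      (C.charpoly.roots.map fun z => f z.re).sum := fun hC => by
    rw [trace_matFun hC, hC.roots_charpoly_eq_eigenvalues, Multiset.map_map]
    simp
  rw [h hP, h hQ, Matrix.charpoly_mul_comm]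

lemma matPow_mul_matPow (hA : A.IsHermitian) (p q : ℝ) :
    matPow p A * matPow q A = matPow (p + q) A := by
  rw [matPow, matPow, matFun_mul hA, matPow]
  refine matFun_congr hA fun i => ?_
  split_ifs with h
  · exact (Real.rpow_add h p q).symm
  · simp

lemma matPow_one (hA : A.PosSemidef) : matPow 1 A = A := by
  conv_rhs => rw [← matFun_id hA.1]
  refine matFun_congr hA.1 fun i => ?_
  split_ifs with h
  · exact Real.rpow_one _
  · exact le_antisymm (hA.eigenvalues_nonneg i) (not_lt.1 h)

lemma posSemidef_matPow (hA : A.IsHermitian) (p : ℝ) : (matPow p A).PosSemidef := by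
  have h := Matrix.posSemidef_conjTranspose_mul_self (matPow (p / 2) A)
  rwa [(isHermitian_matPow _ _).eq, matPow_mul_matPow hA,
    add_halves] at h

lemma exists_eq_conjTranspose_mul_self (hA : A.PosSemidef) :
    ∃ N : Matrix n n ℂ, A = N.conjTranspose * N :=
  ⟨matPow (1 / 2) A, by
    rw [(isHermitian_matPow _ _).eq, matPow_mul_matPow hA.1, add_halves, matPow_one hA]⟩

lemma trace_matPow (hA : A.PosSemidef) {p : ℝ} (hp : 0 < p) :
    (matPow p A).trace.re = ∑ i, hA.1.eigenvalues i ^ p := by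
  rw [matPow, trace_matFun hA.1]
  refine Finset.sum_congr rfl fun i _ => ?_
  split_ifs with h
  · rfl
  · rw [le_antisymm (not_lt.1 h) (hA.eigenvalues_nonneg i), Real.zero_rpow hp.ne']

lemma sum_normSq_row (W : Matrix n n ℂ) (hW : W * star W = 1) (i : n) :
    ∑ j, Complex.normSq (W i j) = 1 := by
  have h := congrArg Complex.re (congrFun (congrFun hW i) i)
  simpa [Matrix.mul_apply, Complex.normSq_apply] using h

lemma trace_matPow_mono_of_one_le (hA : A.PosSemidef) (hB : B.PosSemidef)
    (hAB : (B - A).PosSemidef) {p : ℝ} (hp : 1 ≤ p) :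
    (matPow p A).trace.re ≤ (matPow p B).trace.re := by
  have hp0 : 0 < p := by linarith
  rw [trace_matPow hA hp0, trace_matPow hB hp0]
  set U : Matrix n n ℂ := (hA.1.eigenvectorUnitary : Matrix n n ℂ) with hU
  set V : Matrix n n ℂ := (hB.1.eigenvectorUnitary : Matrix n n ℂ) with hV
  have hUU : U * star U = 1 := Unitary.mul_star_self_of_mem hA.1.eigenvectorUnitary.2
  have hUU' : star U * U = 1 := Unitary.star_mul_self_of_mem hA.1.eigenvectorUnitary.2
  have hVV : V * star V = 1 := Unitary.mul_star_self_of_mem hB.1.eigenvectorUnitary.2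
  have hVV' : star V * V = 1 := Unitary.star_mul_self_of_mem hB.1.eigenvectorUnitary.2
  set W := star U * V with hW
  have hWW : W * star W = 1 := by
    rw [hW, star_mul, star_star, Matrix.mul_assoc, ← Matrix.mul_assoc V, hVV, Matrix.one_mul, hUU']
  have hWW' : star W * W = 1 := by
    rw [hW, star_mul, star_star, Matrix.mul_assoc, ← Matrix.mul_assoc U, hUU, Matrix.one_mul, hVV']
  have hrow := sum_normSq_row W hWW
  have hcol : ∀ j, ∑ i, Complex.normSq (W i j) = 1 := fun j => by
    simpa [Matrix.star_apply] using sum_normSq_row (star W) (by rwa [star_star]) j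
  have hAd : star U * A * U = Matrix.diagonal (fun i => (hA.1.eigenvalues i : ℂ)) := by
    conv_lhs => rw [← matFun_id hA.1, matFun, dif_pos hA.1, ← hU]
    simp only [Matrix.mul_assoc, hUU', Matrix.mul_one]
    rw [← Matrix.mul_assoc, hUU', Matrix.one_mul]
  have hBd : star U * B * U = W * Matrix.diagonal (fun i => (hB.1.eigenvalues i : ℂ)) * star W := by
    conv_lhs => rw [← matFun_id hB.1, matFun, dif_pos hB.1, ← hV]
    rw [hW, star_mul, star_star]
    simp only [Matrix.mul_assoc]
  have hle : ∀ i, hA.1.eigenvalues i ≤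
      ∑ j, Complex.normSq (W i j) * hB.1.eigenvalues j := fun i => by
    have h1 := (hAB.conjTranspose_mul_mul_same U).diag_nonneg (i := i)
    rw [← Matrix.star_eq_conjTranspose, Matrix.mul_sub, Matrix.sub_mul, hAd, hBd] at h1
    have h2 := (Complex.le_def.1 h1).1
    simp only [Matrix.sub_apply, Matrix.diagonal_apply_eq, Matrix.mul_apply (M := _ * _),
      Matrix.mul_diagonal, Matrix.star_apply, Complex.sub_re, Complex.zero_re, Complex.re_sum,
      Complex.ofReal_re, sub_nonneg] at h2
    refine h2.trans_eq (Finset.sum_congr rfl fun j _ => ?_)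
    simp [Complex.normSq_apply]
    ring
  calc ∑ i, hA.1.eigenvalues i ^ p
      ≤ ∑ i, ∑ j, Complex.normSq (W i j) * hB.1.eigenvalues j ^ p := by
        refine Finset.sum_le_sum fun i _ => ?_
        refine (Real.rpow_le_rpow (hA.eigenvalues_nonneg i) (hle i) hp0.le).trans ?_
        exact Real.rpow_arith_mean_le_arith_mean_rpow _ _ _ (fun j _ => Complex.normSq_nonneg _)
          (hrow i) (fun j _ => hB.eigenvalues_nonneg j) hp
    _ = ∑ j, hB.1.eigenvalues j ^ p := by
        rw [Finset.sum_comm]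
        simp_rw [← Finset.sum_mul, hcol, one_mul]

lemma trace_matPow_mono (hA : A.PosSemidef) (hB : B.PosSemidef)
    (hAB : (B - A).PosSemidef) {p : ℝ} (hp : 0 < p) :
    (matPow p A).trace.re ≤ (matPow p B).trace.re := by
  rcases le_total 1 p with h | h
  · exact trace_matPow_mono_of_one_le hA hB hAB h
  · have h1 := (matPow_mono hA hB hAB hp h).trace_nonneg
    rw [Matrix.trace_sub] at h1
    simpa using (Complex.le_def.1 h1).1

lemma trace_matPow_pos (hA : A.PosSemidef) (hA0 : A ≠ 0) {p : ℝ} (hp : 0 < p) :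
    0 < (matPow p A).trace.re := by
  rw [trace_matPow hA hp]
  obtain ⟨i, hi⟩ : ∃ i, hA.1.eigenvalues i ≠ 0 := by
    by_contra! h
    exact hA0 (hA.1.eigenvalues_eq_zero_iff.1 (funext h))
  exact Finset.sum_pos' (fun j _ => Real.rpow_nonneg (hA.eigenvalues_nonneg j) p)
    ⟨i, Finset.mem_univ i, Real.rpow_pos_of_pos ((hA.eigenvalues_nonneg i).lt_of_ne' hi) p⟩

lemma matPow_zero_mul_of_suppLE {N : Matrix n n ℂ} (hA : A.PosSemidef)
    (h : suppLE (N.conjTranspose * N) A) : matPow 0 A * N.conjTranspose = N.conjTranspose := by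
  have hker : A * (1 - matPow 0 A) = 0 := by
    rw [Matrix.mul_sub, Matrix.mul_one, sub_eq_zero]
    simpa [matPow_one hA] using (matPow_mul_matPow hA.1 1 0).symm
  have h1 : N.conjTranspose * N * (1 - matPow 0 A) = 0 := by
    refine Matrix.ext_of_mulVec_single fun i => ?_
    rw [← Matrix.mulVec_mulVec, h _ (by rw [Matrix.mulVec_mulVec, hker, Matrix.zero_mulVec]),
      Matrix.zero_mulVec]
  rw [Matrix.conjTranspose_mul_self_mul_eq_zero, Matrix.mul_sub, Matrix.mul_one, sub_eq_zero] at h1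
  have h2 := congrArg Matrix.conjTranspose h1
  rw [Matrix.conjTranspose_mul, (isHermitian_matPow _ _).eq] at h2
  exact h2.symm

end FunctionalCalculus

section Support

variable {n : Type*} [Fintype n] {ρ σ τ : Matrix n n ℂ} {c : ℝ}

lemma suppLE_of_le_smul (hσ : σ.PosSemidef) (h : (c • τ - σ).PosSemidef) : suppLE σ τ := by
  intro v hv
  rw [← hσ.dotProduct_mulVec_zero_iff]
  refine le_antisymm ?_ (hσ.dotProduct_mulVec_nonneg v)
  have h1 := h.dotProduct_mulVec_nonneg v
  simpa [Matrix.sub_mulVec, Matrix.smul_mulVec, hv] using h1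

lemma suppLE.trans (h₁ : suppLE ρ σ) (h₂ : suppLE σ τ) : suppLE ρ τ := fun v hv => h₁ v (h₂ v hv)

end Support

section Monotonicity

variable {n : Type*} [Fintype n] [DecidableEq n] {ρ σ τ N : Matrix n n ℂ} {c α : ℝ}

/-- The trace quantity whose logarithm defines the sandwiched Rényi relative entropy. -/
noncomputable def sandTrace (α : ℝ) (ρ σ : Matrix n n ℂ) : ℝ :=
  (matPow α (matPow ((1 - α) / (2 * α)) σ * ρ * matPow ((1 - α) / (2 * α)) σ)).trace.re

lemma sandTrace_conjTranspose_mul_self (hσ : σ.PosSemidef) :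
    sandTrace α (N.conjTranspose * N) σ =
      (matPow α (N * matPow ((1 - α) / α) σ * N.conjTranspose)).trace.re := by
  set K := matPow ((1 - α) / (2 * α)) σ with hK
  have hKh : K.conjTranspose = K := (isHermitian_matPow _ σ).eq
  have hKK : matPow ((1 - α) / α) σ = K * K := by
    rw [hK, matPow_mul_matPow hσ.1]
    congr 1
    ring
  have h := trace_matFun_mul_conjTranspose_comm
    (fun x => if 0 < x then Real.rpow x α else 0) (N * K)
  rw [Matrix.conjTranspose_mul, hKh] at h
  rw [sandTrace, ← hK, hKK]
  simp only [matPow, Matrix.mul_assoc] at h ⊢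
  exact h.symm

lemma matPow_le_smul (hσ : σ.PosSemidef) (hτ : τ.PosSemidef) (hc : 0 < c)
    (h : (c • τ - σ).PosSemidef) {p : ℝ} (hp0 : 0 < p) (hp1 : p ≤ 1) :
    (c ^ p • matPow p τ - matPow p σ).PosSemidef := by
  rw [← matPow_smul hτ hc]
  exact matPow_mono hσ (hτ.smul hc.le) h hp0 hp1

lemma sandTrace_le_of_lt_one (hρ : ρ.PosSemidef) (hσ : σ.PosSemidef) (hτ : τ.PosSemidef)
    (hc : 0 < c) (h : (c • τ - σ).PosSemidef) (hα0 : 1 / 2 ≤ α) (hα1 : α < 1) :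
    sandTrace α ρ σ ≤ c ^ (1 - α) * sandTrace α ρ τ := by
  obtain ⟨N, rfl⟩ := exists_eq_conjTranspose_mul_self hρ
  have hα : 0 < α := by linarith
  rw [sandTrace_conjTranspose_mul_self hσ, sandTrace_conjTranspose_mul_self hτ]
  have h1 := (matPow_le_smul hσ hτ hc h (p := (1 - α) / α) (div_pos (by linarith) hα)
    ((div_le_one hα).2 (by linarith))).mul_mul_conjTranspose_same N
  rw [Matrix.mul_sub, Matrix.sub_mul, Matrix.mul_smul, Matrix.smul_mul] at h1
  have hT := (posSemidef_matPow hτ.1 ((1 - α) / α)).mul_mul_conjTranspose_same N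
  have hcp : 0 < c ^ ((1 - α) / α) := Real.rpow_pos_of_pos hc _
  have h2 := trace_matPow_mono ((posSemidef_matPow hσ.1 _).mul_mul_conjTranspose_same N)
    (hT.smul hcp.le) h1 hα
  rw [matPow_smul hT hcp, ← Real.rpow_mul hc.le, div_mul_cancel₀ _ hα.ne'] at h2
  simpa [Matrix.trace_smul] using h2

lemma le_sandTrace_of_one_lt (hρ : ρ.PosSemidef) (hσ : σ.PosSemidef) (hτ : τ.PosSemidef)
    (hc : 0 < c) (h : (c • τ - σ).PosSemidef) (hs : suppLE ρ σ) (hα : 1 < α) :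
    c ^ (1 - α) * sandTrace α ρ τ ≤ sandTrace α ρ σ := by
  obtain ⟨N, rfl⟩ := exists_eq_conjTranspose_mul_self hρ
  have hα0 : 0 < α := by linarith
  rw [sandTrace_conjTranspose_mul_self hσ, sandTrace_conjTranspose_mul_self hτ]
  set r := (α - 1) / α with hr
  have hr' : (1 - α) / α = -r := by rw [hr]; ring
  have hcr : 0 < c ^ r := Real.rpow_pos_of_pos hc _
  have hcr' : 0 < c ^ (-r) := Real.rpow_pos_of_pos hc _
  have hrr : r + -r = 0 := by ring
  rw [hr']
  have h1 := posSemidef_compress_inv_sub (N := N) (S := matPow r σ) (T := c ^ r • matPow r τ)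
    (S' := matPow (-r) σ) (T' := c ^ (-r) • matPow (-r) τ) (posSemidef_matPow hσ.1 r)
    (matPow_le_smul hσ hτ hc h (div_pos (by linarith) hα0) ((div_le_one hα0).2 (by linarith)))
    (isHermitian_matPow _ _) ((posSemidef_matPow hτ.1 _).smul hcr'.le).1
    (by rw [matPow_mul_matPow hσ.1, hrr, matPow_zero_mul_of_suppLE hσ hs])
    (by rw [Matrix.smul_mul, Matrix.mul_smul, smul_smul, ← Real.rpow_add hc, hrr, Real.rpow_zero,
      one_smul, matPow_mul_matPow hτ.1, hrr,
      matPow_zero_mul_of_suppLE hτ (hs.trans (suppLE_of_le_smul hσ h))])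
  rw [Matrix.mul_smul, Matrix.smul_mul] at h1
  have hT := (posSemidef_matPow hτ.1 (-r)).mul_mul_conjTranspose_same N
  have h2 := trace_matPow_mono (hT.smul hcr'.le)
    ((posSemidef_matPow hσ.1 _).mul_mul_conjTranspose_same N) h1 hα0
  rw [matPow_smul hT hcr', ← Real.rpow_mul hc.le, ← hr', div_mul_cancel₀ _ hα0.ne'] at h2
  simpa [Matrix.trace_smul, hr'] using h2

lemma sandTrace_pos (hρ : ρ.PosSemidef) (hρ0 : ρ ≠ 0) (hσ : σ.PosSemidef) (hs : suppLE ρ σ)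
    (hα : 0 < α) : 0 < sandTrace α ρ σ := by
  obtain ⟨N, rfl⟩ := exists_eq_conjTranspose_mul_self hρ
  rw [sandTrace]
  set K := matPow ((1 - α) / (2 * α)) σ with hK
  have hKh : K.conjTranspose = K := (isHermitian_matPow _ σ).eq
  refine trace_matPow_pos ?_ (fun h0 => hρ0 ?_) hα
  · simpa [hKh] using hρ.conjTranspose_mul_mul_same K
  · have h1 : (N * K).conjTranspose * (N * K) = 0 := by
      rw [← h0, Matrix.conjTranspose_mul, hKh]
      simp only [Matrix.mul_assoc]
    rw [Matrix.conjTranspose_mul_self_eq_zero] at h1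
    have h2 : N = 0 := by
      have h3 := congrArg Matrix.conjTranspose (matPow_zero_mul_of_suppLE hσ hs)
      rw [Matrix.conjTranspose_mul, Matrix.conjTranspose_conjTranspose,
        (isHermitian_matPow _ _).eq, ← add_neg_cancel ((1 - α) / (2 * α)),
        ← matPow_mul_matPow hσ.1, ← Matrix.mul_assoc, h1, Matrix.zero_mul] at h3
      exact h3.symm
    simp [h2]

lemma trace_mul_matLog2_hasDerivAt (hρ : IsDensityMatrix ρ) (hσ : σ.PosSemidef)
    (hs : suppLE ρ σ) :
    (ρ * matPow 0 σ).trace.re = 1 ∧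
      HasDerivAt (fun p => (ρ * matPow p σ).trace.re)
        (Real.log 2 * (ρ * matLog2 σ).trace.re) 0 := by
  constructor
  · obtain ⟨N, rfl⟩ := exists_eq_conjTranspose_mul_self hρ.1
    rw [Matrix.trace_mul_comm, ← Matrix.mul_assoc, matPow_zero_mul_of_suppLE hσ hs, hρ.2,
      Complex.one_re]
  · simp only [matPow, matLog2, trace_mul_matFun hσ.1]
    rw [Finset.mul_sum]
    refine HasDerivAt.fun_sum fun i _ => ?_
    rw [← mul_assoc]
    refine HasDerivAt.mul_const ?_ _
    split_ifs with hi
    · have h := (Real.hasStrictDerivAt_const_rpow hi 0).hasDerivAt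
      have hl : Real.log 2 ≠ 0 := (Real.log_pos one_lt_two).ne'
      simpa [Real.logb, mul_div_cancel₀ _ hl] using h
    · simpa using hasDerivAt_const (0 : ℝ) (0 : ℝ)

lemma trace_mul_matLog2_le (hρ : IsDensityMatrix ρ) (hσ : σ.PosSemidef) (hτ : τ.PosSemidef)
    (hc : 0 < c) (h : (c • τ - σ).PosSemidef) (hs : suppLE ρ σ) :
    (ρ * matLog2 σ).trace.re ≤ Real.logb 2 c + (ρ * matLog2 τ).trace.re := by
  obtain ⟨a0, a1⟩ := trace_mul_matLog2_hasDerivAt hρ hσ hs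
  obtain ⟨b0, b1⟩ := trace_mul_matLog2_hasDerivAt hρ hτ (hs.trans (suppLE_of_le_smul hσ h))
  have hd := ((Real.hasStrictDerivAt_const_rpow hc 0).hasDerivAt.mul b1).sub a1
  have hlim := (hasDerivAt_iff_tendsto_slope.1 hd).mono_left
    (nhdsWithin_mono (0 : ℝ) fun x (hx : x ∈ Set.Ioi 0) => ne_of_gt hx)
  have hnn := ge_of_tendsto (b := 0) hlim (by
    filter_upwards [Ioo_mem_nhdsGT one_pos] with p hp
    obtain ⟨N, rfl⟩ := exists_eq_conjTranspose_mul_self hρ.1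
    have h1 := ((matPow_le_smul hσ hτ hc h hp.1 hp.2.le).mul_mul_conjTranspose_same N).trace_nonneg
    rw [Matrix.trace_mul_comm, ← Matrix.mul_assoc, Matrix.mul_sub, Matrix.mul_smul,
      Matrix.trace_sub, Matrix.trace_smul] at h1
    have h2 := (Complex.le_def.1 h1).1
    simp only [slope_def_field, Pi.sub_apply, Pi.mul_apply, a0, b0, Real.rpow_zero]
    refine div_nonneg ?_ (by linarith [hp.1])
    simpa using h2)
  simp only [Real.rpow_zero, one_mul, b0, mul_one] at hnn
  have hl : 0 < Real.log 2 := Real.log_pos one_lt_two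
  rw [Real.logb, ← mul_le_mul_iff_right₀ hl, mul_add, mul_div_cancel₀ _ hl.ne']
  linarith

end Monotonicity

section MaxDivergence

variable {n : Type*} [Fintype n] {ρ σ τ : Matrix n n ℂ}

lemma isClosed_setOf_loewnerLE_smul (ρ σ : Matrix n n ℂ) :
    IsClosed {l : ℝ | 0 ≤ l ∧ loewnerLE ρ (l • σ)} := by
  have hcont : ∀ v : n → ℂ, Continuous fun l : ℝ =>
      star v ⬝ᵥ ((l • σ - ρ).mulVec v) := fun v => by
    simp only [dotProduct, Matrix.mulVec, Matrix.sub_apply, Matrix.smul_apply]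
    fun_prop
  have hherm : IsClosed {l : ℝ | (l • σ - ρ).IsHermitian} := by
    refine isClosed_eq ?_ ?_ <;> fun_prop
  simp only [loewnerLE, Matrix.posSemidef_iff_dotProduct_mulVec, Set.ofPred_and, Set.ofPred_forall]
  exact isClosed_Ici.inter
    (hherm.inter (isClosed_iInter fun v => isClosed_le continuous_const (hcont v)))

lemma sInf_loewnerLE_mem (h : ∃ l : ℝ, 0 ≤ l ∧ loewnerLE ρ (l • σ)) :
    sInf {l : ℝ | 0 ≤ l ∧ loewnerLE ρ (l • σ)} ∈ {l : ℝ | 0 ≤ l ∧ loewnerLE ρ (l • σ)} :=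
  (isClosed_setOf_loewnerLE_smul ρ σ).csInf_mem h ⟨0, fun _ hl => hl.1⟩

lemma pos_of_loewnerLE_smul (hρ : IsDensityMatrix ρ) {l : ℝ} (hl : 0 ≤ l)
    (h : loewnerLE ρ (l • σ)) : 0 < l := by
  refine hl.lt_of_ne ?_
  rintro rfl
  have h1 := h.trace_nonneg
  rw [zero_smul, zero_sub, Matrix.trace_neg, hρ.2] at h1
  have h2 := (Complex.le_def.1 h1).1
  norm_num at h2

lemma loewnerLE_smul_trans {l c : ℝ} (hl : 0 ≤ l) (h₁ : loewnerLE ρ (l • σ))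
    (h₂ : loewnerLE σ (c • τ)) : loewnerLE ρ ((l * c) • τ) := by
  have h := (h₂.smul hl).add h₁
  rwa [smul_sub, smul_smul, sub_add_sub_cancel] at h

end MaxDivergence

/-- Antitonicity of the sandwiched Rényi relative entropy in its second argument, combined with its
behaviour under scaling. -/
lemma sandRenyi_le_add_logb {n : Type*} [Fintype n] [DecidableEq n] {ρ σ τ : Matrix n n ℂ}
    (hρ : IsDensityMatrix ρ) (hσ : IsDensityMatrix σ) (hτ : τ.PosSemidef) {c : ℝ} (hc : 0 < c)
    (h : loewnerLE σ (c • τ)) {α : ℝ≥0∞} (hα : 1 / 2 ≤ α) :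
    sandRenyi α ρ τ ≤ sandRenyi α ρ σ + (Real.logb 2 c : ℝ) := by
  have hρ0 : ρ ≠ 0 := by
    rintro rfl
    simpa using hρ.2
  have hστ := suppLE_of_le_smul hσ.1 h
  have htop : (⊤ : EReal) + (Real.logb 2 c : ℝ) = ⊤ := EReal.top_add_coe _
  rcases eq_or_ne α ⊤ with rfl | hαt
  · simp only [sandRenyi, if_true]
    by_cases hs : ∃ l : ℝ, 0 ≤ l ∧ loewnerLE ρ (l • σ)
    · have hl := sInf_loewnerLE_mem hs
      rw [if_pos hs]
      set l := sInf {l : ℝ | 0 ≤ l ∧ loewnerLE ρ (l • σ)}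
      have hmem : l * c ∈ {l : ℝ | 0 ≤ l ∧ loewnerLE ρ (l • τ)} :=
        ⟨mul_nonneg hl.1 hc.le, loewnerLE_smul_trans hl.1 hl.2 h⟩
      have hm := sInf_loewnerLE_mem ⟨_, hmem⟩
      rw [if_pos ⟨_, hmem⟩, ← EReal.coe_add, EReal.coe_le_coe_iff,
        ← Real.logb_mul (pos_of_loewnerLE_smul hρ hl.1 hl.2).ne' hc.ne']
      exact Real.logb_le_logb_of_le one_lt_two (pos_of_loewnerLE_smul hρ hm.1 hm.2)
        (csInf_le ⟨0, fun _ hx => hx.1⟩ hmem)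
    · rw [if_neg hs, htop]
      exact le_top
  rcases eq_or_ne α 1 with rfl | hα1
  · simp only [sandRenyi, if_neg hαt, if_true]
    by_cases hs : suppLE ρ σ
    · rw [if_pos hs, if_pos (hs.trans hστ), ← EReal.coe_add, EReal.coe_le_coe_iff]
      have := trace_mul_matLog2_le hρ hσ.1 hτ hc h hs
      simp only [Matrix.mul_sub, Matrix.trace_sub, Complex.sub_re]
      linarith
    · rw [if_neg hs, htop]
      exact le_top
  have hαr : 1 / 2 ≤ α.toReal := by
    simpa using (ENNReal.toReal_le_toReal (by simp) hαt).2 hα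
  have hαr1 : α.toReal ≠ 1 := fun h1 => hα1 (by simpa using (ENNReal.toReal_eq_one_iff _).1 h1)
  have hform : ∀ ω : Matrix n n ℂ, sandRenyi α ρ ω =
      if 1 < α.toReal ∧ ¬ suppLE ρ ω then ⊤ else if 0 < sandTrace α.toReal ρ ω then
        (((α.toReal - 1)⁻¹ * Real.logb 2 (sandTrace α.toReal ρ ω) : ℝ) : EReal) else ⊤ := fun ω => by
    rw [sandRenyi, if_neg hαt, if_neg hα1]
    rfl
  rw [hform σ, hform τ]
  set a := α.toReal
  by_cases hs : 1 < a ∧ ¬ suppLE ρ σ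
  · rw [if_pos hs, htop]
    exact le_top
  rw [if_neg hs]
  by_cases hq : 0 < sandTrace a ρ σ
  swap
  · rw [if_neg hq, htop]
    exact le_top
  have hcp : 0 < c ^ (1 - a) := Real.rpow_pos_of_pos hc _
  have hτs : ¬ (1 < a ∧ ¬ suppLE ρ τ) := fun h' => hs ⟨h'.1, fun h'' => h'.2 (h''.trans hστ)⟩
  suffices H : 0 < sandTrace a ρ τ ∧ (a - 1)⁻¹ * Real.logb 2 (c ^ (1 - a) * sandTrace a ρ τ) ≤
      (a - 1)⁻¹ * Real.logb 2 (sandTrace a ρ σ) by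
    rw [if_neg hτs, if_pos hq, if_pos H.1, ← EReal.coe_add, EReal.coe_le_coe_iff]
    have h2 := H.2
    rw [Real.logb_mul hcp.ne' H.1.ne', Real.logb_rpow_eq_mul_logb_of_pos hc, mul_add,
      ← mul_assoc, show (a - 1)⁻¹ * (1 - a) = -1 by
        rw [← neg_sub a 1, mul_neg, inv_mul_cancel₀ (sub_ne_zero.2 hαr1)]] at h2
    linarith
  rcases lt_or_gt_of_ne hαr1 with ha | ha
  · have hle := sandTrace_le_of_lt_one hρ.1 hσ.1 hτ hc h hαr ha
    have hpos : 0 < sandTrace a ρ τ := (mul_pos_iff_of_pos_left hcp).1 (hq.trans_le hle)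
    exact ⟨hpos, mul_le_mul_of_nonpos_left (Real.logb_le_logb_of_le one_lt_two hq hle)
      (inv_nonpos.2 (by linarith))⟩
  · have hsσ : suppLE ρ σ := by
      by_contra h'
      exact hs ⟨ha, h'⟩
    have hpos := sandTrace_pos hρ.1 hρ0 hτ (hsσ.trans hστ) (by linarith : 0 < a)
    exact ⟨hpos, mul_le_mul_of_nonneg_left (Real.logb_le_logb_of_le one_lt_two (mul_pos hcp hpos)
      (le_sandTrace_of_one_lt hρ.1 hσ.1 hτ hc h hsσ ha)) (inv_nonneg.2 (by linarith))⟩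

lemma sandRenyi_ne_bot {n : Type*} [Fintype n] [DecidableEq n] (α : ℝ≥0∞) (ρ σ : Matrix n n ℂ) :
    sandRenyi α ρ σ ≠ ⊥ := by
  unfold sandRenyi
  split_ifs <;> first | exact top_ne_bot | exact EReal.coe_ne_bot _

theorem renyi_divergence_ge_minEntropy_sub_condRenyi {A B : Type*} [Fintype A] [DecidableEq A] [Fintype B] [DecidableEq B]
    (ρ σ : Matrix (A × B) (A × B) ℂ) (hρ : IsDensityMatrix ρ) (hσ : IsDensityMatrix σ)
    (α : ℝ≥0∞) (hα : 1 / 2 ≤ α) :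
    sandRenyi α ρ σ ≥ condRenyi ⊤ σ - condRenyi α ρ := by
  rcases eq_or_ne (sandRenyi α ρ σ) ⊤ with htop | htop
  · rw [htop]
    exact le_top
  refine EReal.sub_le_of_le_add (sSup_le ?_)
  rintro _ ⟨η, hη, rfl⟩
  by_cases hex : ∃ l : ℝ, 0 ≤ l ∧ loewnerLE σ (l • ((1 : Matrix A A ℂ) ⊗ₖ η))
  swap
  · simp [sandRenyi, hex]
  have hl := sInf_loewnerLE_mem hex
  have hdiv := sandRenyi_le_add_logb hρ hσ (Matrix.PosSemidef.one.kronecker hη.1)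
    (pos_of_loewnerLE_smul hσ hl.1 hl.2) hl.2 hα
  have hcond : -sandRenyi α ρ ((1 : Matrix A A ℂ) ⊗ₖ η) ≤ condRenyi α ρ :=
    le_sSup ⟨η, hη, rfl⟩
  refine le_trans ?_ (add_le_add_right hcond _)
  have hne := sandRenyi_ne_bot α ρ ((1 : Matrix A A ℂ) ⊗ₖ η)
  have hne' := sandRenyi_ne_bot α ρ σ
  rw [show sandRenyi ⊤ σ ((1 : Matrix A A ℂ) ⊗ₖ η) = _ from (if_pos rfl).trans (if_pos hex)]
  generalize Real.logb 2 (sInf {l : ℝ | 0 ≤ l ∧ loewnerLE σ (l • ((1 : Matrix A A ℂ) ⊗ₖ η))}) = m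
    at hdiv ⊢
  generalize sandRenyi α ρ ((1 : Matrix A A ℂ) ⊗ₖ η) = x at hdiv hne ⊢
  generalize sandRenyi α ρ σ = y at hdiv hne' htop ⊢
  lift y to ℝ using ⟨htop, hne'⟩
  lift x to ℝ using ⟨ne_top_of_le_ne_top (EReal.coe_ne_top (y + m)) (by exact_mod_cast hdiv), hne⟩
  norm_cast at hdiv ⊢
  linarith
end

section
/- Let A and B be finite sets and let P and Q be probability distributions on A×B, with Q(a,b) > 0 for all (a,b). Then for every α ∈ [1/2, ∞], D_α(P ∥ Q) ≥ H_min(A|B)_Q − H_α(A|B)_P. -/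
open scoped ENNReal
open scoped Classical

noncomputable section

/-- The classical Rényi relative entropy `D_α(P‖R)` (in bits) of nonnegative functions on a
finite set, for `α ∈ [1/2,∞]` (parametrized by `ℝ≥0∞`), with the limiting definitions at
`α = 1` (Kullback–Leibler divergence) and `α = ∞` (max-divergence); terms with `P z = 0`
contribute `0`, and the value is `+∞` if `α > 1` and some `P z > 0 = R z`. -/
def renyiDiv {Z : Type*} [Fintype Z] (α : ℝ≥0∞) (P R : Z → ℝ) : EReal :=
  if α = ⊤ then
    if ∀ z, P z ≠ 0 → R z ≠ 0 then
      ((Real.logb 2 (⨆ z, if P z = 0 then 0 else P z / R z) : ℝ) : EReal)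
    else ⊤
  else if α = 1 then
    if ∀ z, P z ≠ 0 → R z ≠ 0 then
      (((∑ z, if P z = 0 then 0 else P z * Real.logb 2 (P z / R z)) : ℝ) : EReal)
    else ⊤
  else
    if 1 < α.toReal ∧ ¬ (∀ z, P z ≠ 0 → R z ≠ 0) then ⊤
    else
      if 0 < (∑ z, if P z = 0 then 0 else (P z) ^ α.toReal * (R z) ^ (1 - α.toReal)) then
        (((α.toReal - 1)⁻¹ * Real.logb 2
          (∑ z, if P z = 0 then 0 else (P z) ^ α.toReal * (R z) ^ (1 - α.toReal)) : ℝ) : EReal)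
      else ⊤

/-- `P` is a probability distribution on a finite set. -/
def IsProbDist {Z : Type*} [Fintype Z] (P : Z → ℝ) : Prop :=
  (∀ z, 0 ≤ P z) ∧ ∑ z, P z = 1

/-- The classical conditional Rényi entropy
`H_α(A|B)_P = sup_η [ - D_α(P ‖ 1_A ⊗ η) ]`, the supremum running over probability
distributions `η` on `B`; `H_min = H_∞` and `H_max = H_{1/2}`. -/
def condRenyiC {A B : Type*} [Fintype A] [Fintype B] (α : ℝ≥0∞) (P : A × B → ℝ) : EReal :=
  sSup {x : EReal | ∃ η : B → ℝ, IsProbDist η ∧ x = - renyiDiv α P (fun z => η z.2)}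

end

/-- A probability distribution charges some point. -/
theorem IsProbDist.exists_pos {Z : Type*} [Fintype Z] {P : Z → ℝ} (hP : IsProbDist P) :
    ∃ z, 0 < P z := by
  by_contra! h
  have h0 : ∑ z, P z ≤ 0 := Finset.sum_nonpos fun z _ => h z
  linarith [hP.2]

/-- On positive second arguments the Rényi relative entropy is real-valued, and it increases by
at most `log₂ l` when the second argument `Q` is replaced by some `R` with `Q ≤ l R`. -/
theorem renyiDiv_le_add_logb {Z : Type*} [Fintype Z] {P Q R : Z → ℝ} (hP : IsProbDist P)
    (hQ : ∀ z, 0 < Q z) (hR : ∀ z, 0 < R z) {l : ℝ} (hl : 0 < l) (h : ∀ z, Q z ≤ l * R z)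
    (α : ℝ≥0∞) :
    ∃ x y : ℝ, renyiDiv α P R = x ∧ renyiDiv α P Q = y ∧ x ≤ y + Real.logb 2 l := by
  have hQ' : ∀ z, P z ≠ 0 → Q z ≠ 0 := fun z _ => (hQ z).ne'
  have hR' : ∀ z, P z ≠ 0 → R z ≠ 0 := fun z _ => (hR z).ne'
  obtain ⟨z₀, hz₀⟩ := hP.exists_pos
  have hdiv : ∀ z, P z / R z ≤ P z / Q z * l := fun z => by
    rw [div_mul_eq_mul_div, div_le_div_iff₀ (hR z) (hQ z), mul_assoc]
    exact mul_le_mul_of_nonneg_left (h z) (hP.1 z)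
  unfold renyiDiv
  by_cases h_top : α = ⊤
  · simp only [h_top, if_true, if_pos hQ', if_pos hR']
    refine ⟨_, _, rfl, rfl, ?_⟩
    have hpos : ∀ S : Z → ℝ, (∀ z, 0 < S z) → 0 < ⨆ z, if P z = 0 then 0 else P z / S z := by
      intro S hS
      refine lt_of_lt_of_le (div_pos hz₀ (hS z₀)) ?_
      refine le_trans (le_of_eq ?_) (le_ciSup (Set.finite_range _).bddAbove z₀)
      rw [if_neg hz₀.ne']
    rw [← Real.logb_mul (hpos Q hQ).ne' hl.ne']
    refine Real.logb_le_logb_of_le one_lt_two (hpos R hR) ?_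
    have : Nonempty Z := ⟨z₀⟩
    refine ciSup_le fun z => ?_
    refine le_trans ?_ (mul_le_mul_of_nonneg_right
      (le_ciSup (f := fun z => if P z = 0 then 0 else P z / Q z)
        (Set.finite_range _).bddAbove z) hl.le)
    split_ifs
    · simp
    · exact hdiv z
  by_cases h_one : α = 1
  · simp only [if_neg h_top, if_pos h_one, if_pos hQ', if_pos hR']
    refine ⟨_, _, rfl, rfl, ?_⟩
    rw [← one_mul (Real.logb 2 l), ← hP.2, Finset.sum_mul, ← Finset.sum_add_distrib]
    refine Finset.sum_le_sum fun z _ => ?_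
    split_ifs with hz
    · simp [hz]
    · have hPz : 0 < P z := lt_of_le_of_ne (hP.1 z) (Ne.symm hz)
      rw [← mul_add, ← Real.logb_mul (div_pos hPz (hQ z)).ne' hl.ne']
      exact mul_le_mul_of_nonneg_left
        (Real.logb_le_logb_of_le one_lt_two (div_pos hPz (hR z)) (hdiv z)) hPz.le
  have hpos : ∀ S : Z → ℝ, (∀ z, 0 < S z) →
      0 < ∑ z, if P z = 0 then 0 else P z ^ α.toReal * S z ^ (1 - α.toReal) := by
    intro S hS
    refine Finset.sum_pos' (fun z _ => ?_) ⟨z₀, Finset.mem_univ _, ?_⟩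
    · split_ifs
      · exact le_rfl
      · exact mul_nonneg (Real.rpow_nonneg (hP.1 z) _) (Real.rpow_nonneg (hS z).le _)
    · rw [if_neg hz₀.ne']
      exact mul_pos (Real.rpow_pos_of_pos hz₀ _) (Real.rpow_pos_of_pos (hS z₀) _)
  have hne : α.toReal ≠ 1 := fun hα => h_one ((ENNReal.toReal_eq_one_iff α).1 hα)
  have hnQ : ¬ (1 < α.toReal ∧ ¬ ∀ z, P z ≠ 0 → Q z ≠ 0) := fun hn => hn.2 hQ'
  have hnR : ¬ (1 < α.toReal ∧ ¬ ∀ z, P z ≠ 0 → R z ≠ 0) := fun hn => hn.2 hR'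
  rw [if_neg h_top, if_neg h_one, if_neg hnR, if_pos (hpos R hR),
    if_neg h_top, if_neg h_one, if_neg hnQ, if_pos (hpos Q hQ)]
  refine ⟨_, _, rfl, rfl, ?_⟩
  have hposQ := hpos Q hQ
  have hposR := hpos R hR
  generalize α.toReal = t at *
  have hlt : 0 < l ^ (1 - t) := Real.rpow_pos_of_pos hl _
  have hlog : (t - 1)⁻¹ * Real.logb 2
        (∑ z, if P z = 0 then 0 else P z ^ t * (l * R z) ^ (1 - t)) + Real.logb 2 l =
      (t - 1)⁻¹ * Real.logb 2 (∑ z, if P z = 0 then 0 else P z ^ t * R z ^ (1 - t)) := by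
    have hsum : (∑ z, if P z = 0 then 0 else P z ^ t * (l * R z) ^ (1 - t)) =
        l ^ (1 - t) * ∑ z, if P z = 0 then 0 else P z ^ t * R z ^ (1 - t) := by
      rw [Finset.mul_sum]
      refine Finset.sum_congr rfl fun z _ => ?_
      rw [Real.mul_rpow hl.le (hR z).le, mul_ite, mul_zero]
      congr 1
      ring
    rw [hsum, Real.logb_mul hlt.ne' hposR.ne', Real.logb_rpow_eq_mul_logb_of_pos hl]
    have : t - 1 ≠ 0 := sub_ne_zero.2 hne
    field_simp
    ring
  rw [← hlog]
  have hposl := hpos (fun z => l * R z) fun z => mul_pos hl (hR z)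
  gcongr ?_ + _
  rcases lt_or_gt_of_ne hne with ht | ht
  · refine mul_le_mul_of_nonpos_left (Real.logb_le_logb_of_le one_lt_two hposQ ?_)
      (inv_nonpos.2 (by linarith))
    refine Finset.sum_le_sum fun z _ => ?_
    split_ifs
    · exact le_rfl
    · exact mul_le_mul_of_nonneg_left
        (Real.rpow_le_rpow (hQ z).le (h z) (by linarith)) (Real.rpow_nonneg (hP.1 z) _)
  · refine mul_le_mul_of_nonneg_left (Real.logb_le_logb_of_le one_lt_two hposl ?_)
      (inv_nonneg.2 (by linarith))
    refine Finset.sum_le_sum fun z _ => ?_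
    split_ifs
    · exact le_rfl
    · exact mul_le_mul_of_nonneg_left
        (Real.rpow_le_rpow_of_nonpos (hQ z) (h z) (by linarith)) (Real.rpow_nonneg (hP.1 z) _)

/-- **Classical divergence–entropy tradeoff**: for probability distributions `P`, `Q` on
`A × B` with `Q` everywhere positive, `D_α(P‖Q) ≥ H_min(A|B)_Q − H_α(A|B)_P` for all
`α ∈ [1/2,∞]`. -/
theorem renyiDiv_ge_condMin_sub_condRenyi {A B : Type*}
    [Fintype A] [Nonempty A] [Fintype B] [Nonempty B]
    (P Q : A × B → ℝ) (hP : IsProbDist P) (hQ : IsProbDist Q)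
    (hQpos : ∀ z, 0 < Q z) (α : ℝ≥0∞) (hα : 1 / 2 ≤ α) :
    renyiDiv α P Q ≥ condRenyiC ⊤ Q - condRenyiC α P := by
  refine EReal.sub_le_of_le_add (sSup_le ?_)
  rintro _ ⟨η, hη, rfl⟩
  by_cases hsupp : ∀ z : A × B, Q z ≠ 0 → η z.2 ≠ 0
  · have hη_pos : ∀ z : A × B, 0 < η z.2 := fun z =>
      lt_of_le_of_ne (hη.1 _) (hsupp z (hQpos z).ne').symm
    have hle : ∀ z : A × B, Q z / η z.2 ≤ ⨆ z : A × B, Q z / η z.2 := fun z =>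
      le_ciSup (f := fun z : A × B => Q z / η z.2) (Set.finite_range _).bddAbove z
    obtain ⟨z₀⟩ := (inferInstance : Nonempty (A × B))
    have hl := (div_pos (hQpos z₀) (hη_pos z₀)).trans_le (hle z₀)
    have hdiv : renyiDiv ⊤ Q (fun z => η z.2) =
        (Real.logb 2 (⨆ z : A × B, Q z / η z.2) : ℝ) := by
      simp only [renyiDiv, if_true, if_pos hsupp, (hQpos _).ne', if_false]
    obtain ⟨x, y, hx, hy, hxy⟩ := renyiDiv_le_add_logb hP hQpos hη_pos hl
      (fun z => (div_le_iff₀ (hη_pos z)).1 (hle z)) α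
    have hH : ((-x : ℝ) : EReal) ≤ condRenyiC α P :=
      le_sSup ⟨η, hη, by rw [hx, EReal.coe_neg]⟩
    rw [hdiv, hy]
    refine le_trans ?_ (add_le_add_right hH _)
    rw [← EReal.coe_neg, ← EReal.coe_add, EReal.coe_le_coe_iff]
    linarith
  · simp only [renyiDiv, if_true, if_neg hsupp, EReal.neg_top, bot_le]
end

section
/- Let μ and ν be probability measures on ℝ with μ absolutely continuous with respect to ν and finite Kullback–Leibler divergence D(μ∥ν) < ∞. For each n ∈ ℕ, define the discretized distributions P_n(k) = μ([k·2^{−n}, (k+1)·2^{−n})) and Q_n(k) = ν([k·2^{−n}, (k+1)·2^{−n})) for k ∈ ℤ. Then lim_{n→∞} Σ_{k∈ℤ} P_n(k) log₂(P_n(k)/Q_n(k)) = D(μ∥ν). -/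
open MeasureTheory
open scoped Classical

open InformationTheory Filter Topology

/-- Relative entropies of the images under maps generating an increasing sequence of σ-algebras
that exhausts the ambient one converge to the relative entropy. -/
theorem tendsto_klDiv_map {X Y : Type*} [mX : MeasurableSpace X] [mY : MeasurableSpace Y]
    {μ ν : Measure X} [IsFiniteMeasure μ] [IsFiniteMeasure ν] (hac : μ ≪ ν)
    {g : ℕ → X → Y} (hg : ∀ n, Measurable (g n)) (hmono : Monotone fun n => mY.comap (g n))
    (hsup : mX ≤ ⨆ n, mY.comap (g n)) :
    Tendsto (fun n => klDiv (μ.map (g n)) (ν.map (g n))) atTop (𝓝 (klDiv μ ν)) := by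
  let ℱ : Filtration ℕ mX := ⟨fun n => mY.comap (g n), hmono, fun n => (hg n).comap_le⟩
  have hmeas : StronglyMeasurable[⨆ n, ℱ n] fun x => (μ.rnDeriv ν x).toReal := by
    refine Measurable.stronglyMeasurable ?_
    exact ((Measure.measurable_rnDeriv μ ν).ennreal_toReal).mono hsup le_rfl
  have hconv := Integrable.tendsto_ae_condExp (ℱ := ℱ) (μ := ν)
    (Measure.integrable_toReal_rnDeriv (μ := μ)) hmeas
  have hae := ae_all_iff.2 fun n => toReal_rnDeriv_map hac (hg n)
  refine tendsto_of_le_liminf_of_limsup_le ?_ ?_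
  · have hkl : ∀ n, klDiv (μ.map (g n)) (ν.map (g n)) = ∫⁻ x, ENNReal.ofReal
        (klFun ((μ.map (g n)).rnDeriv (ν.map (g n)) (g n x)).toReal) ∂ν := fun n => by
      rw [klDiv_eq_lintegral_klFun_of_ac (hac.map (hg n)), lintegral_map (by fun_prop) (hg n)]
    simp_rw [hkl]
    rw [klDiv_eq_lintegral_klFun_of_ac hac]
    refine le_trans (le_of_eq (lintegral_congr_ae ?_)) (lintegral_liminf_le fun n => ?_)
    · filter_upwards [hconv, hae] with x hx hx'
      simp_rw [hx']
      exact (((ENNReal.continuous_ofReal.comp continuous_klFun).tendsto _).comp hx).liminf_eq.symm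
    · have := hg n
      fun_prop
  · exact limsup_le_of_le (h := Eventually.of_forall fun n => klDiv_map_le μ ν (hg n))

/-- The relative entropy on a countable space as a series. -/
theorem toReal_klDiv_eq_tsum {X : Type*} [MeasurableSpace X] [Countable X]
    [MeasurableSingletonClass X] {μ ν : Measure X} [IsFiniteMeasure μ] [IsFiniteMeasure ν]
    (hac : μ ≪ ν) (huniv : μ Set.univ = ν Set.univ) (hint : Integrable (llr μ ν) μ) :
    (klDiv μ ν).toReal = ∑' a, μ.real {a} * Real.log (μ.real {a} / ν.real {a}) := by
  rw [toReal_klDiv_of_measure_eq hac huniv, integral_countable hint]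
  refine tsum_congr fun a => ?_
  by_cases ha : ν {a} = 0
  · simp [measureReal_def, hac ha]
  have h := Measure.setLIntegral_rnDeriv hac {a}
  rw [lintegral_singleton] at h
  have h' : (μ.rnDeriv ν a).toReal = μ.real {a} / ν.real {a} := by
    rw [measureReal_def, measureReal_def, ← h, ENNReal.toReal_mul, mul_div_cancel_right₀]
    exact ENNReal.toReal_ne_zero.2 ⟨ha, measure_ne_top _ _⟩
  rw [llr, h', smul_eq_mul]

/-- The index of the dyadic interval of length `2 ^ (-n)` containing `x`. -/
noncomputable def dyadicIndex (n : ℕ) (x : ℝ) : ℤ := ⌊x * 2 ^ n⌋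

theorem measurable_dyadicIndex (n : ℕ) : Measurable (dyadicIndex n) :=
  Int.measurable_floor.comp (by fun_prop)

theorem dyadicIndex_preimage_singleton (n : ℕ) (k : ℤ) :
    dyadicIndex n ⁻¹' {k} =
      Set.Ico ((k : ℝ) * 2 ^ (-(n : ℤ))) (((k : ℝ) + 1) * 2 ^ (-(n : ℤ))) := by
  ext x
  have h : (0 : ℝ) < 2 ^ n := by positivity
  simp only [dyadicIndex, Set.mem_preimage, Set.mem_singleton_iff, Int.floor_eq_iff, Set.mem_Ico,
    zpow_neg, zpow_natCast, ← div_eq_mul_inv, div_le_iff₀ h, lt_div_iff₀ h]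

theorem dyadicIndex_succ_ediv_two (n : ℕ) (x : ℝ) :
    dyadicIndex (n + 1) x / 2 = dyadicIndex n x := by
  have h := Int.floor_div_natCast (x * 2 ^ (n + 1)) 2
  rw [dyadicIndex, dyadicIndex, ← Nat.cast_two (R := ℤ), ← h]
  congr 1
  push_cast
  ring

theorem monotone_comap_dyadicIndex :
    Monotone fun n => (inferInstance : MeasurableSpace ℤ).comap (dyadicIndex n) := by
  refine monotone_nat_of_le_succ fun n => ?_
  have h : dyadicIndex n = (fun k : ℤ => k / 2) ∘ dyadicIndex (n + 1) :=
    funext fun x => (dyadicIndex_succ_ediv_two n x).symm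
  rw [h, ← MeasurableSpace.comap_comp]
  exact MeasurableSpace.comap_mono (measurable_of_countable _).comap_le

theorem tendsto_dyadicIndex_div (x : ℝ) :
    Tendsto (fun n => (dyadicIndex n x : ℝ) / 2 ^ n) atTop (𝓝 x) := by
  have hlim : Tendsto (fun n : ℕ => x - (1 / 2 : ℝ) ^ n) atTop (𝓝 x) := by
    simpa using (tendsto_pow_atTop_nhds_zero_of_lt_one (r := (1 / 2 : ℝ))
      (by norm_num) (by norm_num)).const_sub x
  refine tendsto_of_tendsto_of_tendsto_of_le_of_le hlim tendsto_const_nhds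
    (fun n => ?_) fun n => ?_
  · have h : (0 : ℝ) < 2 ^ n := by positivity
    simp only [dyadicIndex]
    rw [le_div_iff₀ h, sub_mul, ← mul_pow]
    have := Int.sub_one_lt_floor (x * 2 ^ n)
    norm_num
    linarith
  · exact (div_le_iff₀ (by positivity)).2 (Int.floor_le _)

theorem le_iSup_comap_dyadicIndex :
    (inferInstance : MeasurableSpace ℝ) ≤
      ⨆ n, (inferInstance : MeasurableSpace ℤ).comap (dyadicIndex n) := by
  have hmeas : @Measurable ℝ ℝ (⨆ n, (inferInstance : MeasurableSpace ℤ).comap (dyadicIndex n))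
      _ id := by
    refine @measurable_of_tendsto_metrizable ℝ ℝ
      (⨆ n, (inferInstance : MeasurableSpace ℤ).comap (dyadicIndex n)) _ _ _ _
      (fun n x => (dyadicIndex n x : ℝ) / 2 ^ n) _ (fun n => ?_)
      (tendsto_pi_nhds.2 tendsto_dyadicIndex_div)
    have h : Measurable fun k : ℤ => (k : ℝ) / 2 ^ n := measurable_of_countable _
    exact (h.comp (comap_measurable (dyadicIndex n))).mono
      (le_iSup (fun n => (inferInstance : MeasurableSpace ℤ).comap (dyadicIndex n)) n) le_rfl
  simpa using hmeas.comap_le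

/-- **Convergence of discretized relative entropy** (classical case): for probability
measures `μ ≪ ν` on `ℝ` with finite Kullback–Leibler divergence
`D(μ‖ν) = ∫ log₂(dμ/dν) dμ`, the relative entropies of the dyadic discretizations
`P_n(k) = μ([k 2^{-n}, (k+1) 2^{-n}))`, `Q_n(k) = ν([k 2^{-n}, (k+1) 2^{-n}))`
converge to `D(μ‖ν)` as `n → ∞`. -/
theorem discretized_relative_entropy_tendsto
    (μ ν : Measure ℝ) [IsProbabilityMeasure μ] [IsProbabilityMeasure ν]
    (hac : μ ≪ ν)
    (hfin : Integrable (fun x => Real.logb 2 ((μ.rnDeriv ν x).toReal)) μ)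
    (P Q : ℕ → ℤ → ℝ)
    (hP : P = fun (n : ℕ) (k : ℤ) =>
      (μ (Set.Ico ((k : ℝ) * 2 ^ (-(n : ℤ))) (((k : ℝ) + 1) * 2 ^ (-(n : ℤ))))).toReal)
    (hQ : Q = fun (n : ℕ) (k : ℤ) =>
      (ν (Set.Ico ((k : ℝ) * 2 ^ (-(n : ℤ))) (((k : ℝ) + 1) * 2 ^ (-(n : ℤ))))).toReal) :
    Filter.Tendsto
      (fun n => ∑' k : ℤ, if P n k = 0 then 0 else P n k * Real.logb 2 (P n k / Q n k))
      Filter.atTop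
      (nhds (∫ x, Real.logb 2 ((μ.rnDeriv ν x).toReal) ∂μ)) := by
  have hint : Integrable (llr μ ν) μ := by
    refine (hfin.mul_const (Real.log 2)).congr (Eventually.of_forall fun x => ?_)
    simp only [llr, Real.logb]
    exact div_mul_cancel₀ _ (Real.log_pos one_lt_two).ne'
  have hlim : ∫ x, Real.logb 2 ((μ.rnDeriv ν x).toReal) ∂μ
      = (klDiv μ ν).toReal / Real.log 2 := by
    rw [toReal_klDiv_of_measure_eq hac (by simp), ← integral_div]
    rfl
  have hsum (n : ℕ) : (∑' k : ℤ, if P n k = 0 then 0 else P n k * Real.logb 2 (P n k / Q n k))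
      = (klDiv (μ.map (dyadicIndex n)) (ν.map (dyadicIndex n))).toReal / Real.log 2 := by
    have hg := measurable_dyadicIndex n
    rw [toReal_klDiv_eq_tsum (hac.map hg)
      (by simp [Measure.map_apply hg MeasurableSet.univ])
      (integrable_llr_map hac hg hint), ← tsum_div_const]
    refine tsum_congr fun k => ?_
    have hPk : P n k = μ.real (dyadicIndex n ⁻¹' {k}) := by
      rw [hP, dyadicIndex_preimage_singleton]; rfl
    have hQk : Q n k = ν.real (dyadicIndex n ⁻¹' {k}) := by
      rw [hQ, dyadicIndex_preimage_singleton]; rfl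
    rw [map_measureReal_apply hg (measurableSet_singleton k),
      map_measureReal_apply hg (measurableSet_singleton k), ← hPk, ← hQk]
    split_ifs with h
    · simp [h]
    · rw [Real.logb, mul_div_assoc]
  simp_rw [hsum, hlim]
  exact ((ENNReal.tendsto_toReal (klDiv_ne_top hac hint)).comp
    (tendsto_klDiv_map hac measurable_dyadicIndex monotone_comap_dyadicIndex
      le_iSup_comap_dyadicIndex)).div_const _
end

section
/- Let P ∈ L¹(ℝ×ℝ) be a (nonnegative, normalized) joint probability density of random variables X and Y such that ∫√(P_X(x)) dx < ∞ and ∫√(P_Y(y)) dy < ∞, where P_X and P_Y are the marginal densities. If the integral ∫_ℝ (∫_ℝ √(P(x,y)) dx)² dy is finite, then the differential conditional max-entropy satisfies h_max(X|Y)_P = log₂ ∫_ℝ (∫_ℝ √(P(x,y)) dx)² dy. -/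
open MeasureTheory

noncomputable section

/-- The differential conditional max-entropy of a joint probability density `P` on
`ℝ × ℝ`: `h_max(X|Y)_P = 2 log₂ sup_q ∫∫ √(P(x,y) q(y)) dx dy`, the supremum running
over all probability densities `q` on `ℝ`. -/
def diffCondMaxEnt (P : ℝ × ℝ → ℝ) : ℝ :=
  2 * Real.logb 2 (sSup {r : ℝ | ∃ q : ℝ → ℝ, Measurable q ∧ (∀ y, 0 ≤ q y) ∧
    Integrable q ∧ (∫ y, q y) = 1 ∧ r = ∫ z : ℝ × ℝ, Real.sqrt (P z * q z.2)})

end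

theorem integrable_sqrt_mul {α : Type*} [MeasurableSpace α] {μ : Measure α} {f g : α → ℝ}
    (hf : Integrable f μ) (hg : Integrable g μ) (hf0 : ∀ a, 0 ≤ f a) (hg0 : ∀ a, 0 ≤ g a) :
    Integrable (fun a => Real.sqrt (f a * g a)) μ := by
  refine (hf.add hg).mono'
    (Real.continuous_sqrt.comp_aestronglyMeasurable (hf.1.mul hg.1)) (.of_forall fun a => ?_)
  rw [Real.norm_of_nonneg (Real.sqrt_nonneg _), Pi.add_apply]
  exact Real.sqrt_le_iff.mpr ⟨add_nonneg (hf0 a) (hg0 a), by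
    nlinarith [mul_nonneg (hf0 a) (hg0 a), sq_nonneg (f a), sq_nonneg (g a)]⟩

/-- The Cauchy–Schwarz inequality for square roots of nonnegative integrable functions. -/
theorem integral_sqrt_mul_le {α : Type*} [MeasurableSpace α] {μ : Measure α} {f g : α → ℝ}
    (hf : Integrable f μ) (hg : Integrable g μ) (hf0 : ∀ a, 0 ≤ f a) (hg0 : ∀ a, 0 ≤ g a) :
    (∫ a, Real.sqrt (f a * g a) ∂μ) ≤ Real.sqrt (∫ a, f a ∂μ) * Real.sqrt (∫ a, g a ∂μ) := by
  have memLp_sqrt {h : α → ℝ} (hh : Integrable h μ) (hh0 : ∀ a, 0 ≤ h a) :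
      MemLp (fun a => Real.sqrt (h a)) (ENNReal.ofReal 2) μ := by
    rw [ENNReal.ofReal_ofNat, memLp_two_iff_integrable_sq
      (Real.continuous_sqrt.comp_aestronglyMeasurable hh.1)]
    simpa only [Real.sq_sqrt (hh0 _)] using hh
  have key := integral_mul_le_Lp_mul_Lq_of_nonneg (μ := μ) Real.HolderConjugate.two_two
    (.of_forall fun a => Real.sqrt_nonneg (f a)) (.of_forall fun a => Real.sqrt_nonneg (g a))
    (memLp_sqrt hf hf0) (memLp_sqrt hg hg0)
  simpa only [Real.rpow_two, Real.sq_sqrt (hf0 _), Real.sq_sqrt (hg0 _), ← Real.sqrt_eq_rpow,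
    ← Real.sqrt_mul (hf0 _)] using key

/-- If the square root of the first marginal of `P` is integrable, then so is `√(P(x,y) q(y))` for
every nonnegative integrable `q`. -/
theorem integrable_sqrt_mul_snd {P : ℝ × ℝ → ℝ} {q : ℝ → ℝ}
    (hmeas : Measurable P) (hnn : ∀ z, 0 ≤ P z) (hint : Integrable P)
    (hmargX : Integrable (fun x => Real.sqrt (∫ y, P (x, y))))
    (hq : Measurable q) (hq0 : ∀ y, 0 ≤ q y) (hqint : Integrable q) :
    Integrable (fun z : ℝ × ℝ => Real.sqrt (P z * q z.2)) := by
  have hm : Measurable (fun z : ℝ × ℝ => Real.sqrt (P z * q z.2)) := by fun_prop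
  have hslice : ∀ᵐ x : ℝ, Integrable (fun y => P (x, y)) := hint.prod_right_ae
  refine (integrable_prod_iff hm.aestronglyMeasurable).mpr ⟨?_, ?_⟩
  · filter_upwards [hslice] with x hx
    exact integrable_sqrt_mul hx hqint (fun y => hnn _) hq0
  · refine (hmargX.mul_const (Real.sqrt (∫ y, q y))).mono'
      hm.stronglyMeasurable.norm.integral_prod_right'.aestronglyMeasurable ?_
    filter_upwards [hslice] with x hx
    rw [Real.norm_of_nonneg (integral_nonneg fun _ => norm_nonneg _)]
    simp only [Real.norm_of_nonneg (Real.sqrt_nonneg _)]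
    exact integral_sqrt_mul_le hx hqint (fun y => hnn _) hq0

theorem integral_sqrt_mul_snd {P : ℝ × ℝ → ℝ} {q : ℝ → ℝ} (hnn : ∀ z, 0 ≤ P z)
    (h : Integrable (fun z : ℝ × ℝ => Real.sqrt (P z * q z.2))) :
    (∫ z : ℝ × ℝ, Real.sqrt (P z * q z.2)) =
      ∫ y, (∫ x, Real.sqrt (P (x, y))) * Real.sqrt (q y) := by
  rw [Measure.volume_eq_prod, integral_prod_symm _ h]
  simp only [Real.sqrt_mul (hnn _), integral_mul_const]

/-- **Evaluation of the differential conditional max-entropy** (Lemma 3 of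
Coles–Furrer): for a joint density `P` with `∫√P_X < ∞` and `∫√P_Y < ∞`, if
`∫(∫√P dx)² dy` is finite then `h_max(X|Y)_P = log₂ ∫(∫√P(x,y) dx)² dy`. -/
theorem diffCondMaxEnt_eq (P : ℝ × ℝ → ℝ)
    (hmeas : Measurable P) (hnn : ∀ z, 0 ≤ P z)
    (hint : Integrable P) (hnorm : (∫ z : ℝ × ℝ, P z) = 1)
    (hmargX : Integrable (fun x => Real.sqrt (∫ y, P (x, y))))
    (hmargY : Integrable (fun y => Real.sqrt (∫ x, P (x, y))))
    (hfin : Integrable (fun y => (∫ x, Real.sqrt (P (x, y))) ^ 2)) :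
    diffCondMaxEnt P = Real.logb 2 (∫ y, (∫ x, Real.sqrt (P (x, y))) ^ 2) := by
  set F : ℝ → ℝ := fun y => ∫ x, Real.sqrt (P (x, y))
  have hF0 : ∀ y, 0 ≤ F y := fun y => integral_nonneg fun _ => Real.sqrt_nonneg _
  have hFm : Measurable F := hmeas.sqrt.stronglyMeasurable.integral_prod_left'.measurable
  have hI0 : 0 < ∫ y, F y ^ 2 := by
    refine (integral_nonneg fun y => sq_nonneg (F y)).lt_of_ne' fun h0 => ?_
    have hFae : (fun y => F y ^ 2) =ᵐ[volume] 0 :=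
      (integral_eq_zero_iff_of_nonneg (fun y => sq_nonneg (F y)) hfin).mp h0
    have hgi := integrable_sqrt_mul_snd hmeas hnn hint hmargX
      (ProbabilityTheory.measurable_gaussianPDFReal 0 1)
      (ProbabilityTheory.gaussianPDFReal_nonneg 0 1)
      (ProbabilityTheory.integrable_gaussianPDFReal 0 1)
    have hg0 := integral_sqrt_mul_snd hnn hgi
    rw [integral_eq_zero_of_ae (f := fun y => F y * _) (by
      filter_upwards [hFae] with y hy
      simp [pow_eq_zero_iff two_ne_zero |>.mp hy])] at hg0
    have hP : P =ᵐ[volume] 0 := by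
      filter_upwards [(integral_eq_zero_iff_of_nonneg (fun _ => Real.sqrt_nonneg _) hgi).mp hg0]
        with z hz
      have hpos := ProbabilityTheory.gaussianPDFReal_pos 0 1 z.2 one_ne_zero
      have := (Real.sqrt_eq_zero (mul_nonneg (hnn z) hpos.le)).mp hz
      exact (mul_eq_zero.mp this).resolve_right hpos.ne'
    rw [integral_eq_zero_of_ae hP] at hnorm
    exact zero_ne_one hnorm
  have hgreatest : IsGreatest {r : ℝ | ∃ q : ℝ → ℝ, Measurable q ∧ (∀ y, 0 ≤ q y) ∧
      Integrable q ∧ (∫ y, q y) = 1 ∧ r = ∫ z : ℝ × ℝ, Real.sqrt (P z * q z.2)}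
      (Real.sqrt (∫ y, F y ^ 2)) := by
    constructor
    · have hq : Measurable fun y => F y ^ 2 / ∫ y, F y ^ 2 := by fun_prop
      have hq0 : ∀ y, 0 ≤ F y ^ 2 / ∫ y, F y ^ 2 := fun y => by positivity
      have hqi : Integrable fun y => F y ^ 2 / ∫ y, F y ^ 2 := hfin.div_const _
      refine ⟨_, hq, hq0, hqi, ?_, ?_⟩
      · rw [integral_div, div_self hI0.ne']
      · rw [integral_sqrt_mul_snd hnn
          (integrable_sqrt_mul_snd hmeas hnn hint hmargX hq hq0 hqi)]
        have : ∀ y, F y * Real.sqrt (F y ^ 2 / ∫ y, F y ^ 2) =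
            F y ^ 2 / Real.sqrt (∫ y, F y ^ 2) := fun y => by
          rw [Real.sqrt_div (sq_nonneg _), Real.sqrt_sq (hF0 y)]
          ring
        change _ = ∫ y, F y * Real.sqrt (F y ^ 2 / ∫ y, F y ^ 2)
        simp only [this, integral_div, Real.div_sqrt]
    · rintro r ⟨q, hq, hq0, hqi, hq1, rfl⟩
      rw [integral_sqrt_mul_snd hnn (integrable_sqrt_mul_snd hmeas hnn hint hmargX hq hq0 hqi)]
      have h := integral_sqrt_mul_le (f := fun y => F y ^ 2) hfin hqi (fun y => sq_nonneg (F y)) hq0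
      simpa only [Real.sqrt_mul (sq_nonneg _), Real.sqrt_sq (hF0 _), hq1, Real.sqrt_one,
        mul_one] using h
  rw [diffCondMaxEnt, hgreatest.csSup_eq, Real.logb, Real.logb, Real.log_sqrt hI0.le]
  ring
end

section
/- Let r_x ∈ [−1,1] and θ ∈ [0, π/2], and set p_± = (1 ± r_x)/2. Define the joint probability distribution Q on {0,1}×{+,−} by Q(0,+) = p_+ cos²(θ/2), Q(0,−) = p_− sin²(θ/2), Q(1,+) = p_+ sin²(θ/2), Q(1,−) = p_− cos²(θ/2). Then the classical conditional max-entropy satisfies H_max(X|M)_Q = log₂(1 + √(1 − r_x²) · sin θ). -/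
/-- **Predictive error in the weak-measurement qubit experiment**: for the joint
distribution `Q` of the probe outcome `m ∈ {0,1}` and a future `X` measurement
`x ∈ {+,-}` (encoded as `{0,1}`), given by `Q(0,+) = p₊cos²(θ/2)`,
`Q(0,−) = p₋sin²(θ/2)`, `Q(1,+) = p₊sin²(θ/2)`, `Q(1,−) = p₋cos²(θ/2)` with
`p_± = (1 ± r_x)/2`, the classical conditional max-entropy
`H_max(X|M)_Q = log₂ Σ_m (Σ_x √Q(m,x))²` equals `log₂(1 + √(1−r_x²) sin θ)`. -/
theorem condMaxEnt_weak_measurement (rx θ : ℝ)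
    (hr : rx ∈ Set.Icc (-1 : ℝ) 1) (hθ : θ ∈ Set.Icc 0 (Real.pi / 2))
    (Q : Fin 2 → Fin 2 → ℝ)
    (hQ : Q = fun m x => (if x = 0 then (1 + rx) / 2 else (1 - rx) / 2) *
      (if m = x then Real.cos (θ / 2) ^ 2 else Real.sin (θ / 2) ^ 2)) :
    Real.logb 2 (∑ m : Fin 2, (∑ x : Fin 2, Real.sqrt (Q m x)) ^ 2) =
      Real.logb 2 (1 + Real.sqrt (1 - rx ^ 2) * Real.sin θ) := by
  obtain ⟨hr₁, hr₂⟩ := hr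
  obtain ⟨hθ₁, hθ₂⟩ := hθ
  have hp : 0 ≤ (1 + rx) / 2 := by linarith
  have hm : 0 ≤ (1 - rx) / 2 := by linarith
  have hc : 0 ≤ Real.cos (θ / 2) :=
    Real.cos_nonneg_of_neg_pi_div_two_le_of_le (by linarith) (by linarith)
  have hs : 0 ≤ Real.sin (θ / 2) :=
    Real.sin_nonneg_of_nonneg_of_le_pi (by linarith) (by linarith)
  have hsqrt : √(1 - rx ^ 2) = 2 * (√((1 + rx) / 2) * √((1 - rx) / 2)) := by
    rw [← Real.sqrt_mul hp, show 1 - rx ^ 2 = 2 ^ 2 * ((1 + rx) / 2 * ((1 - rx) / 2)) by ring,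
      Real.sqrt_mul (by norm_num), Real.sqrt_sq (by norm_num)]
  have hsin : Real.sin θ = 2 * Real.sin (θ / 2) * Real.cos (θ / 2) := by
    rw [← Real.sin_two_mul, mul_div_cancel₀ θ two_ne_zero]
  subst hQ
  congr 1
  simp only [Fin.sum_univ_two, Fin.isValue, if_true, one_ne_zero, zero_ne_one, if_false,
    Real.sqrt_mul hp, Real.sqrt_mul hm, Real.sqrt_sq hc, Real.sqrt_sq hs]
  rw [hsqrt, hsin]
  have hp2 := Real.sq_sqrt hp
  have hm2 := Real.sq_sqrt hm
  have htrig := Real.sin_sq_add_cos_sq (θ / 2)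
  linear_combination (Real.sin (θ / 2) ^ 2 + Real.cos (θ / 2) ^ 2) * (hp2 + hm2) + htrig
end

section
/- Let θ ∈ [0, π/2]. Define the binary probability distributions P_Z = (1, 0) and P^ℰ_Z = ((1+sin θ)/2, (1−sin θ)/2), and let Q be the distribution on {0,1}×{+,−} given by Q(0,+) = (1/2)cos²(θ/2), Q(0,−) = (1/2)sin²(θ/2), Q(1,+) = (1/2)sin²(θ/2), Q(1,−) = (1/2)cos²(θ/2). Then D(P_Z ∥ P^ℰ_Z) = 1 − log₂(1 + sin θ) and H_max(X|M)_Q = log₂(1 + sin θ), so that D(P_Z ∥ P^ℰ_Z) + H_max(X|M)_Q = 1 for every θ; i.e., the measurement–disturbance relation is saturated for all measurement strengths. -/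
open scoped Classical

/-- **Perfect tightness of the measurement-disturbance relation for the input state
`|0⟩⟨0|`**: with `P_Z = (1,0)`, `P^ℰ_Z = ((1+sin θ)/2, (1−sin θ)/2)` and `Q` the joint
probe/`X`-outcome distribution of the weak measurement of strength `θ`, one has
`D(P_Z‖P^ℰ_Z) = 1 − log₂(1+sin θ)`, `H_max(X|M)_Q = log₂(1+sin θ)`, and hence
`D(P_Z‖P^ℰ_Z) + H_max(X|M)_Q = 1` for every `θ`. -/
theorem mdr_saturation_qubit (θ : ℝ) (hθ : θ ∈ Set.Icc 0 (Real.pi / 2))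
    (PZ PZE : Fin 2 → ℝ)
    (hPZ : PZ = fun z => if z = 0 then 1 else 0)
    (hPZE : PZE = fun z =>
      if z = 0 then (1 + Real.sin θ) / 2 else (1 - Real.sin θ) / 2)
    (Q : Fin 2 → Fin 2 → ℝ)
    (hQ : Q = fun m x => (1 / 2) *
      (if m = x then Real.cos (θ / 2) ^ 2 else Real.sin (θ / 2) ^ 2)) :
    (∑ z : Fin 2, if PZ z = 0 then 0 else PZ z * Real.logb 2 (PZ z / PZE z)) =
        1 - Real.logb 2 (1 + Real.sin θ) ∧
    Real.logb 2 (∑ m : Fin 2, (∑ x : Fin 2, Real.sqrt (Q m x)) ^ 2) =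
        Real.logb 2 (1 + Real.sin θ) ∧
    (∑ z : Fin 2, if PZ z = 0 then 0 else PZ z * Real.logb 2 (PZ z / PZE z)) +
        Real.logb 2 (∑ m : Fin 2, (∑ x : Fin 2, Real.sqrt (Q m x)) ^ 2) = 1 := by
  have hsin : 0 ≤ Real.sin θ :=
    Real.sin_nonneg_of_nonneg_of_le_pi hθ.1 (by linarith [hθ.2, Real.pi_pos])
  have hD : (∑ z : Fin 2, if PZ z = 0 then 0 else PZ z * Real.logb 2 (PZ z / PZE z)) =
      1 - Real.logb 2 (1 + Real.sin θ) := by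
    have h : (1 : ℝ) / ((1 + Real.sin θ) / 2) = 2 / (1 + Real.sin θ) := by
      field_simp
    subst hPZ hPZE
    simp only [Fin.sum_univ_two, if_true, one_ne_zero, if_false, one_mul, add_zero]
    rw [h, Real.logb_div two_ne_zero (by linarith), Real.logb_self_eq_one one_lt_two]
  have hsum : (∑ m : Fin 2, (∑ x : Fin 2, Real.sqrt (Q m x)) ^ 2) = 1 + Real.sin θ := by
    have hc : 0 ≤ Real.cos (θ / 2) :=
      Real.cos_nonneg_of_neg_pi_div_two_le_of_le
        (by linarith [hθ.1, Real.pi_pos]) (by linarith [hθ.1, hθ.2])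
    have hs : 0 ≤ Real.sin (θ / 2) :=
      Real.sin_nonneg_of_nonneg_of_le_pi
        (by linarith [hθ.1]) (by linarith [hθ.2, Real.pi_pos])
    have hdouble : Real.sin θ = 2 * Real.sin (θ / 2) * Real.cos (θ / 2) := by
      rw [← Real.sin_two_mul, mul_div_cancel₀ θ two_ne_zero]
    have hhalf : Real.sqrt (1 / 2) ^ 2 = 1 / 2 := Real.sq_sqrt (by norm_num)
    have hsqrt (a : ℝ) (ha : 0 ≤ a) :
        Real.sqrt (1 / 2 * a ^ 2) = Real.sqrt (1 / 2) * a := by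
      rw [Real.sqrt_mul (by norm_num), Real.sqrt_sq ha]
    subst hQ
    simp only [Fin.sum_univ_two, if_true, one_ne_zero, zero_ne_one, if_false,
      hsqrt _ hc, hsqrt _ hs]
    rw [hdouble]
    linear_combination 2 * (Real.cos (θ / 2) + Real.sin (θ / 2)) ^ 2 * hhalf +
      Real.sin_sq_add_cos_sq (θ / 2)
  rw [hD, hsum]
  exact ⟨rfl, rfl, sub_add_cancel _ _⟩
end

section
/- Let V_S, V_M > 0 and let g_V(x) = (2πV)^{−1/2} e^{−x²/(2V)} denote the centered Gaussian density with variance V. Define the joint density P(q,q') = g_{V_S}(q) · g_{V_M}(q'−q) on ℝ². Then ∫_ℝ (∫_ℝ √(P(q,q')) dq)² dq' = 2 √(2π V_S V_M/(V_S+V_M)); equivalently, with λ = V_M/V_S, the differential conditional max-entropy h_max(Q|Q')_P = log₂ ∫_ℝ (∫_ℝ √(P(q,q')) dq)² dq' equals log₂( 2 √(2π V_S/(1 + 1/λ)) ). -/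
open Real

noncomputable section

/-- Centered Gaussian probability density with variance `V`. -/
def gaussDensity (V x : ℝ) : ℝ := (Real.sqrt (2 * Real.pi * V))⁻¹ * Real.exp (-x ^ 2 / (2 * V))

end

/-- The square root of the joint density, with the square in `q` completed. -/
lemma sqrt_gaussDensity_mul (VS VM q q' : ℝ) (hS : 0 < VS) (hM : 0 < VM) :
    √(gaussDensity VS q * gaussDensity VM (q' - q)) =
      √((√(2 * π * VS))⁻¹ * (√(2 * π * VM))⁻¹) * exp (-q' ^ 2 / (4 * (VS + VM))) *
        exp (-((VS + VM) / (4 * VS * VM)) * (q - q' * VS / (VS + VM)) ^ 2) := by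
  have hSM : VS + VM ≠ 0 := by positivity
  have hexp : gaussDensity VS q * gaussDensity VM (q' - q) =
      ((√(2 * π * VS))⁻¹ * (√(2 * π * VM))⁻¹) *
        exp (-q ^ 2 / (2 * VS) + -(q' - q) ^ 2 / (2 * VM)) := by
    rw [exp_add, gaussDensity, gaussDensity]
    ring
  rw [hexp, sqrt_mul (by positivity), ← exp_half,
    mul_assoc √(_ * _), ← exp_add]
  congr 2
  field_simp
  ring

/-- The squared `q`-marginal of the square root of the joint density. -/
lemma sq_integral_sqrt_gaussDensity_mul (VS VM q' : ℝ) (hS : 0 < VS) (hM : 0 < VM) :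
    (∫ q : ℝ, √(gaussDensity VS q * gaussDensity VM (q' - q))) ^ 2 =
      (√(2 * π * VS))⁻¹ * (√(2 * π * VM))⁻¹ * (π / ((VS + VM) / (4 * VS * VM))) *
        exp (-(1 / (2 * (VS + VM))) * q' ^ 2) := by
  have hSM : VS + VM ≠ 0 := by positivity
  simp_rw [sqrt_gaussDensity_mul VS VM _ q' hS hM]
  rw [MeasureTheory.integral_const_mul,
    MeasureTheory.integral_sub_right_eq_self
      (fun q : ℝ => exp (-((VS + VM) / (4 * VS * VM)) * q ^ 2)),
    integral_gaussian, mul_pow, mul_pow, sq_sqrt (by positivity), sq_sqrt (by positivity),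
    ← exp_nat_mul,
    show ((2 : ℕ) : ℝ) * (-q' ^ 2 / (4 * (VS + VM))) = -(1 / (2 * (VS + VM))) * q' ^ 2 by
      push_cast
      field_simp
      ring]
  ring

/-- **Predictive error of the covariant approximate position measurement**: for the joint
density `P(q,q') = g_{V_S}(q) g_{V_M}(q'−q)` of the system position and the meter readout,
`∫(∫√P dq)² dq' = 2√(2π V_S V_M/(V_S+V_M))`; equivalently, with `λ = V_M/V_S`, the
differential conditional max-entropy `h_max(Q|Q')_P = log₂ ∫(∫√P dq)² dq'` equals
`log₂(2√(2π V_S/(1+1/λ)))`. -/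
theorem gaussian_condMaxEnt (VS VM : ℝ) (hS : 0 < VS) (hM : 0 < VM) :
    (∫ q' : ℝ, (∫ q : ℝ, Real.sqrt (gaussDensity VS q * gaussDensity VM (q' - q))) ^ 2) =
      2 * Real.sqrt (2 * Real.pi * VS * VM / (VS + VM)) ∧
    Real.logb 2
        (∫ q' : ℝ, (∫ q : ℝ, Real.sqrt (gaussDensity VS q * gaussDensity VM (q' - q))) ^ 2) =
      Real.logb 2 (2 * Real.sqrt (2 * Real.pi * VS / (1 + 1 / (VM / VS)))) := by
  have hSM : VS + VM ≠ 0 := by positivity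
  have hval : (∫ q' : ℝ,
      (∫ q : ℝ, Real.sqrt (gaussDensity VS q * gaussDensity VM (q' - q))) ^ 2) =
      2 * Real.sqrt (2 * Real.pi * VS * VM / (VS + VM)) := by
    simp_rw [sq_integral_sqrt_gaussDensity_mul VS VM _ hS hM]
    rw [MeasureTheory.integral_const_mul, integral_gaussian]
    refine (sq_eq_sq₀ (by positivity) (by positivity)).mp ?_
    simp only [mul_pow, inv_pow]
    rw [sq_sqrt (by positivity), sq_sqrt (by positivity), sq_sqrt (by positivity),
      sq_sqrt (by positivity)]
    field_simp
    ring
  refine ⟨hval, ?_⟩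
  rw [hval]
  congr 3
  field_simp
  ring
end

section
/- Let ħ > 0, V_S, V_M > 0, λ = V_M/V_S, and V_P = ħ²/(4V_S). Let D = D(N(0,V_P) ∥ N(0, V_P(1+1/λ))) be the base-2 Kullback–Leibler divergence between the centered Gaussian distributions with variances V_P and V_P(1+1/λ), let e = log₂( 2√(2π V_S V_M/(V_S+V_M)) ), and let h = (1/2) log₂(2πe·V_P) be the base-2 differential entropy of N(0,V_P) (here e in 2πe is Euler's number). Then D + e + h = log₂(2πħ) + 1/(2 ln 2 · (1+1/λ)). In particular the gap between the left- and right-hand sides of the continuous-variable measurement–disturbance relation D + e + h ≥ log₂(2πħ) equals 1/(2 ln 2 · (1+1/λ)), which tends to 0 as λ → 0. -/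
open MeasureTheory ProbabilityTheory in
lemma integral_gaussDensity_mul {V : ℝ} (hV : 0 < V) (f : ℝ → ℝ) :
    ∫ x, gaussDensity V x * f x = ∫ x, f x ∂gaussianReal 0 V.toNNReal := by
  have hv : V.toNNReal ≠ 0 := (Real.toNNReal_pos.2 hV).ne'
  rw [integral_gaussianReal_eq_integral_smul hv]
  simp only [gaussianPDFReal, gaussDensity, sub_zero, smul_eq_mul, Real.coe_toNNReal V hV.le]

open MeasureTheory ProbabilityTheory in
lemma integral_sq_gaussianReal (v : NNReal) : ∫ x, x ^ 2 ∂gaussianReal 0 v = v := by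
  have h := variance_fun_id_gaussianReal (μ := 0) (v := v)
  rwa [variance_of_integral_eq_zero aemeasurable_id' integral_id_gaussianReal] at h

lemma log_gaussDensity {V : ℝ} (hV : 0 < V) (x : ℝ) :
    Real.log (gaussDensity V x) = -(Real.log (2 * Real.pi * V) / 2) - x ^ 2 / (2 * V) := by
  have h : 0 < 2 * Real.pi * V := by positivity
  rw [gaussDensity, Real.log_mul (by positivity) (Real.exp_ne_zero _), Real.log_inv,
    Real.log_sqrt h.le, Real.log_exp]
  ring

lemma gaussDensity_pos {V : ℝ} (hV : 0 < V) (x : ℝ) : 0 < gaussDensity V x := by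
  unfold gaussDensity
  positivity

open MeasureTheory ProbabilityTheory in
/-- The base-2 Kullback-Leibler divergence between centered Gaussian densities. -/
lemma integral_gaussDensity_mul_logb_div {V W : ℝ} (hV : 0 < V) (hW : 0 < W) :
    ∫ x, gaussDensity V x * Real.logb 2 (gaussDensity V x / gaussDensity W x) =
      ((Real.log W - Real.log V) / 2 + (V / W - 1) / 2) / Real.log 2 := by
  have hlog (x : ℝ) : Real.logb 2 (gaussDensity V x / gaussDensity W x) =
      (Real.log W - Real.log V) / 2 / Real.log 2 +
        (1 / W - 1 / V) / 2 / Real.log 2 * x ^ 2 := by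
    rw [Real.logb, Real.log_div (gaussDensity_pos hV x).ne' (gaussDensity_pos hW x).ne',
      log_gaussDensity hV, log_gaussDensity hW,
      Real.log_mul (by positivity) hV.ne', Real.log_mul (by positivity) hW.ne']
    field_simp
    ring
  have hint : Integrable (fun x : ℝ => x ^ 2) (gaussianReal 0 V.toNNReal) :=
    (memLp_id_gaussianReal 2).integrable_sq
  rw [integral_gaussDensity_mul hV]
  simp_rw [hlog]
  rw [integral_add (integrable_const _) (hint.const_mul _), integral_const_mul,
    integral_sq_gaussianReal]
  simp only [integral_const, probReal_univ, one_smul, Real.coe_toNNReal V hV.le]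
  field_simp

/-- **Exact gap of the continuous-variable measurement-disturbance relation for the
covariant approximate position measurement**: with `λ = V_M/V_S`, `V_P = hbar²/(4V_S)`,
`D` the base-2 KL divergence between `N(0,V_P)` and `N(0,V_P(1+1/λ))`,
`e = log₂(2√(2π V_S V_M/(V_S+V_M)))` the predictive position error, and
`h = ½log₂(2πe·V_P)` the differential entropy of the initial momentum distribution,
one has `D + e + h = log₂(2πhbar) + 1/(2 ln 2 (1+1/λ))`; in particular the gap
`1/(2 ln 2 (1+1/λ))` tends to `0` as `λ → 0⁺`. -/
theorem cv_mdr_gap (hbar VS VM lam VP : ℝ) (hhbar : 0 < hbar) (hS : 0 < VS) (hM : 0 < VM)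
    (hlam : lam = VM / VS) (hVP : VP = hbar ^ 2 / (4 * VS))
    (D e h : ℝ)
    (hD : D = ∫ x : ℝ, gaussDensity VP x *
      Real.logb 2 (gaussDensity VP x / gaussDensity (VP * (1 + 1 / lam)) x))
    (he : e = Real.logb 2 (2 * Real.sqrt (2 * Real.pi * VS * VM / (VS + VM))))
    (hh : h = (1 / 2) * Real.logb 2 (2 * Real.pi * Real.exp 1 * VP)) :
    D + e + h = Real.logb 2 (2 * Real.pi * hbar) + 1 / (2 * Real.log 2 * (1 + 1 / lam)) ∧
    Filter.Tendsto (fun l : ℝ => 1 / (2 * Real.log 2 * (1 + 1 / l)))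
      (nhdsWithin 0 (Set.Ioi 0)) (nhds 0) := by
  have hr : 1 + 1 / lam = (VS + VM) / VM := by
    rw [hlam]
    field_simp
    ring
  have hVP0 : 0 < VP := by rw [hVP]; positivity
  have hW : 0 < VP * (1 + 1 / lam) := by rw [hr]; positivity
  have hl2 : Real.log 2 ≠ 0 := (Real.log_pos one_lt_two).ne'
  constructor
  · rw [integral_gaussDensity_mul_logb_div hVP0 hW] at hD
    have h4 : Real.log 4 = 2 * Real.log 2 := by
      rw [show (4 : ℝ) = 2 ^ 2 by norm_num, Real.log_pow]
      norm_num
    have hlogVP : Real.log VP = 2 * Real.log hbar - (2 * Real.log 2 + Real.log VS) := by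
      rw [hVP, Real.log_div (by positivity) (by positivity), Real.log_pow,
        Real.log_mul (by norm_num) hS.ne', h4]
      norm_num
    have hlogW : Real.log (VP * (1 + 1 / lam)) =
        Real.log VP + (Real.log (VS + VM) - Real.log VM) := by
      rw [hr, Real.log_mul hVP0.ne' (by positivity), Real.log_div (by positivity) hM.ne']
    have hratio : VP / (VP * (1 + 1 / lam)) = 1 / (1 + 1 / lam) := by
      rw [div_mul_eq_div_div, div_self hVP0.ne']
    have hpi := Real.pi_pos
    rw [hD, he, hh, hlogW, hratio]
    simp only [Real.logb]
    rw [Real.log_mul two_ne_zero (by positivity), Real.log_sqrt (by positivity),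
      Real.log_div (by positivity) (by positivity), Real.log_mul (by positivity) hM.ne',
      Real.log_mul (by positivity) hS.ne', Real.log_mul (by positivity) hVP0.ne',
      Real.log_mul (by positivity) (Real.exp_ne_zero _), Real.log_exp,
      Real.log_mul (by positivity) hhbar.ne', Real.log_mul two_ne_zero hpi.ne', hlogVP,
      ← div_div 1 (2 * Real.log 2)]
    have hr0 : 1 + 1 / lam ≠ 0 := by rw [hr]; positivity
    generalize 1 + 1 / lam = r at hr0 ⊢
    field_simp
    ring
  · simp only [one_div]
    exact ((Filter.tendsto_atTop_add_const_left _ (1 : ℝ) tendsto_inv_nhdsGT_zero).const_mul_atTop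
      (by have := Real.log_pos one_lt_two; positivity)).inv_tendsto_atTop
end
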